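/- arXiv:1810.09646 — 3 statements merged into one kernel-verified Lean document; each statement's English description precedes it below -/
import Mathlib

section
/- Let X ⊂ ℝ² be the image of a twice continuously differentiable regular simple closed plane curve, regarded as an mm-space with Euclidean distance and normalized arclength measure, and let S¹ be the unit circle with the same structure. If H_X(r) = H_{S¹}(r) for all r ≥ 0, then X is isometric to S¹, i.e., X is a unit circle (the image of S¹ under a Euclidean isometry of ℝ²). -/
open MeasureTheory Metric ENNReal

/-- The Euclidean plane `ℝ²`. -/
noncomputable abbrev EucPlane : Type := EuclideanSpace ℝ (Fin 2)

/-- The normalized one-dimensional Hausdorff (arclength) measure on a subset `A` of the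
plane. -/
noncomputable def curveMeasure (A : Set EucPlane) : Measure EucPlane :=
  ((MeasureTheory.Measure.hausdorffMeasure 1 : Measure EucPlane) A)⁻¹ •
    ((MeasureTheory.Measure.hausdorffMeasure 1 : Measure EucPlane).restrict A)

/-- The global distance distribution of the curve `A`:
`H_A(r) = (μ_A ⊗ μ_A)({(x,x') : ‖x − x'‖ ≤ r})`. -/
noncomputable def curveGlobalDistrib (A : Set EucPlane) (r : ℝ) : ℝ≥0∞ :=
  ((curveMeasure A).prod (curveMeasure A)) {z : EucPlane × EucPlane | dist z.1 z.2 ≤ r}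

/-- `γ` is a twice continuously differentiable regular simple closed plane curve of
period `L > 0`: `C²`, `L`-periodic, injective on a period and with nonvanishing
derivative. -/
def IsClosedC2Curve (γ : ℝ → EucPlane) (L : ℝ) : Prop :=
  0 < L ∧ ContDiff ℝ 2 γ ∧ (∀ t, γ (t + L) = γ t) ∧
    Set.InjOn γ (Set.Ico 0 L) ∧ ∀ t, deriv γ t ≠ 0

section
open Real Set

/-- A `2π`-periodic parametrization `β` of a simple closed `C¹` curve with constant speed `c` and
velocity `β'`. -/
structure IsConstSpeedLoop {E : Type*} [NormedAddCommGroup E] [NormedSpace ℝ E]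
    (β β' : ℝ → E) (c : ℝ) : Prop where
  pos : 0 < c
  hasDerivAt : ∀ s, HasDerivAt β (β' s) s
  continuous_deriv : Continuous β'
  speed : ∀ s, ‖β' s‖ = c
  periodic : Function.Periodic β (2 * π)
  inj : ∀ s t, β s = β t → ∃ n : ℤ, t = s + n * (2 * π)

/-- A regular simple closed curve has a constant speed parametrization. -/
theorem IsClosedC2Curve.exists_isConstSpeedLoop {γ : ℝ → EucPlane} {L : ℝ}
    (hγ : IsClosedC2Curve γ L) :
    ∃ (β β' : ℝ → EucPlane) (c : ℝ), IsConstSpeedLoop β β' c ∧ range β = range γ := by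
  obtain ⟨hL, hC, hper, hinj, hreg⟩ := hγ
  have hcont : Continuous (deriv γ) := hC.continuous_deriv (by norm_num)
  have hder : ∀ t, HasDerivAt γ (deriv γ t) t := fun t =>
    (hC.differentiable (by norm_num) t).hasDerivAt
  have hdper : ∀ t, deriv γ (t + L) = deriv γ t := fun t => by
    rw [← deriv_comp_add_const]
    congr 1
    exact funext hper
  have hnc : Continuous fun t => ‖deriv γ t‖ := hcont.norm
  set σ : ℝ → ℝ := fun t => ∫ u in (0 : ℝ)..t, ‖deriv γ u‖ with hσ
  have hσd : ∀ t, HasDerivAt σ ‖deriv γ t‖ t := fun t =>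
    intervalIntegral.integral_hasDerivAt_right (hnc.intervalIntegrable _ _)
      hnc.stronglyMeasurable.stronglyMeasurableAtFilter hnc.continuousAt
  have hσm : StrictMono σ := strictMono_of_deriv_pos fun t => by
    rw [(hσd t).deriv]
    exact norm_pos_iff.2 (hreg t)
  have hσ0 : σ 0 = 0 := by simp [hσ]
  have hℓ : 0 < σ L := hσ0 ▸ hσm hL
  have hσL : ∀ t, σ (t + L) = σ t + σ L := fun t => by
    have h1 : ∫ u in t..(t + L), ‖deriv γ u‖ = ∫ u in (0 : ℝ)..(0 + L), ‖deriv γ u‖ :=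
      Function.Periodic.intervalIntegral_add_eq (f := fun u => ‖deriv γ u‖)
        (fun u => by simp only [hdper]) t 0
    rw [zero_add] at h1
    simp only [hσ]
    rw [← h1, intervalIntegral.integral_add_adjacent_intervals] <;>
      exact hnc.intervalIntegrable _ _
  have hπ := Real.pi_pos
  set k : ℝ := 2 * π / σ L with hk
  have hk0 : 0 < k := by positivity
  set τ : ℝ → ℝ := fun t => k * σ t with hτ
  have hτd : ∀ t, HasDerivAt τ (k * ‖deriv γ t‖) t := fun t => (hσd t).const_mul k
  have hτm : StrictMono τ := hσm.const_mul hk0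
  have hτL : ∀ t, τ (t + L) = τ t + 2 * π := fun t => by
    simp only [hτ, hσL, mul_add]
    rw [hk]
    field_simp
  have hτn : ∀ (n : ℤ) t, τ (t + n * L) = τ t + n * (2 * π) := fun n t => by
    have hp : Function.Periodic (fun t => τ t - t / L * (2 * π)) L := fun t => by
      simp only [hτL]
      field_simp
      ring
    have := hp.int_mul n t
    have h2 : (t + n * L) / L = t / L + n := by field_simp
    rw [h2] at this
    linarith
  have hτc : Continuous τ := continuous_iff_continuousAt.2 fun t => (hτd t).continuousAt
  have hτ0 : τ 0 = 0 := by simp [hτ, hσ0]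
  have hτs : Function.Surjective τ := fun y => by
    obtain ⟨n, hn⟩ := exists_nat_gt (|y| / (2 * π))
    rw [div_lt_iff₀ (by positivity)] at hn
    have h1 := hτn n 0
    have h2 := hτn (-n) 0
    rw [hτ0] at h1 h2
    push_cast at h1 h2
    refine mem_range_of_exists_le_of_exists_ge hτc ⟨_, h2.le.trans ?_⟩ ⟨_, le_trans ?_ h1.ge⟩
    · linarith [neg_abs_le y]
    · linarith [le_abs_self y]
  set e : ℝ ≃o ℝ := hτm.orderIsoOfSurjective τ hτs
  set h : ℝ → ℝ := fun s => e.symm s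
  have hτh : ∀ s, τ (h s) = s := fun s => e.apply_symm_apply s
  have hhτ : ∀ s, h (τ s) = s := fun s => e.symm_apply_apply s
  have hhc : Continuous h := e.symm.continuous
  have hspeed : ∀ t, k * ‖deriv γ t‖ ≠ 0 := fun t => by
    have := norm_pos_iff.2 (hreg t)
    positivity
  have hhd : ∀ s, HasDerivAt h (k * ‖deriv γ (h s)‖)⁻¹ s := fun s =>
    HasDerivAt.of_local_left_inverse hhc.continuousAt (hτd _) (hspeed _)
      (Filter.Eventually.of_forall hτh)
  refine ⟨γ ∘ h, fun s => (k * ‖deriv γ (h s)‖)⁻¹ • deriv γ (h s), k⁻¹, ⟨inv_pos.2 hk0,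
    fun s => (hder _).scomp s (hhd s), ?_, fun s => ?_, fun s => ?_, fun s t hst => ?_⟩, ?_⟩
  · exact ((continuous_const.mul (hnc.comp hhc)).inv₀ fun s => hspeed _).smul (hcont.comp hhc)
  · have := norm_pos_iff.2 (hreg (h s))
    rw [norm_smul, Real.norm_eq_abs, abs_of_pos (by positivity)]
    field_simp
  · have : h (s + 2 * π) = h s + L := by
      rw [← hhτ (h s + L), hτL, hτh]
    simp only [Function.comp, this, hper]
  · have hmod : ∀ x, γ (toIcoMod hL 0 x) = γ x := fun x =>
      Function.Periodic.sub_zsmul_eq (show Function.Periodic γ L from hper) _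
    have h1 := hinj (by simpa using toIcoMod_mem_Ico hL 0 (h s))
      (by simpa using toIcoMod_mem_Ico hL 0 (h t)) (by rw [hmod, hmod]; exact hst)
    refine ⟨toIcoDiv hL 0 (h t) - toIcoDiv hL 0 (h s), ?_⟩
    rw [← hτh s, ← hτn, ← hτh t, hhτ, hhτ]
    congr 1
    simp only [toIcoMod, zsmul_eq_mul] at h1
    push_cast
    linarith
  · exact Function.Surjective.range_comp e.symm.surjective γ

/-- The uniform probability measure on `(0, 2π]`. -/
noncomputable def anglesMeasure : Measure ℝ :=
  (ENNReal.ofReal (2 * π))⁻¹ • volume.restrict (Ioc 0 (2 * π))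

theorem ofReal_two_pi_ne_zero : ENNReal.ofReal (2 * π) ≠ 0 := by
  simp [Real.pi_pos]

instance isProbabilityMeasure_anglesMeasure : IsProbabilityMeasure anglesMeasure where
  measure_univ := by
    simp only [anglesMeasure, Measure.smul_apply, Measure.restrict_apply_univ, Real.volume_Ioc,
      sub_zero, smul_eq_mul]
    exact ENNReal.inv_mul_cancel ofReal_two_pi_ne_zero ENNReal.ofReal_ne_top

theorem integral_anglesMeasure {G : Type*} [NormedAddCommGroup G] [NormedSpace ℝ G] (f : ℝ → G) :
    ∫ s, f s ∂anglesMeasure = (2 * π)⁻¹ • ∫ s in (0 : ℝ)..(2 * π), f s := by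
  rw [anglesMeasure, integral_smul_measure, intervalIntegral.integral_of_le Real.two_pi_pos.le,
    ENNReal.toReal_inv, ENNReal.toReal_ofReal Real.two_pi_pos.le]

theorem integrable_anglesMeasure {G : Type*} [NormedAddCommGroup G] {f : ℝ → G}
    (hf : Continuous f) : Integrable f anglesMeasure :=
  (hf.integrableOn_Ioc).smul_measure (ENNReal.inv_ne_top.2 ofReal_two_pi_ne_zero)

theorem measurableSet_dist_le {X : Type*} [PseudoMetricSpace X] [SecondCountableTopology X]
    [MeasurableSpace X] [OpensMeasurableSpace X] (r : ℝ) :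
    MeasurableSet {z : X × X | dist z.1 z.2 ≤ r} :=
  measurableSet_le measurable_dist measurable_const

namespace IsConstSpeedLoop

section NormedSpace

variable {E F : Type*} [NormedAddCommGroup E] [NormedSpace ℝ E] [NormedAddCommGroup F]
  [NormedSpace ℝ F] {β β' : ℝ → E} {c : ℝ}

theorem continuous (h : IsConstSpeedLoop β β' c) : Continuous β :=
  continuous_iff_continuousAt.2 fun s => (h.hasDerivAt s).continuousAt

theorem comp_isometry (h : IsConstSpeedLoop β β' c) (e : E ≃ₗᵢ[ℝ] F) :
    IsConstSpeedLoop (e ∘ β) (e ∘ β') c where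
  pos := h.pos
  hasDerivAt s := e.toContinuousLinearEquiv.hasFDerivAt.comp_hasDerivAt s (h.hasDerivAt s)
  continuous_deriv := e.continuous.comp h.continuous_deriv
  speed s := by simp [h.speed]
  periodic s := congrArg e (h.periodic s)
  inj s t hst := h.inj s t (e.injective hst)

theorem lipschitzWith (h : IsConstSpeedLoop β β' c) : LipschitzWith c.toNNReal β := by
  refine lipschitzWith_of_nnnorm_deriv_le (fun s => (h.hasDerivAt s).differentiableAt) fun s => ?_
  rw [(h.hasDerivAt s).deriv, ← NNReal.coe_le_coe, coe_nnnorm, h.speed,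
    Real.coe_toNNReal _ h.pos.le]

theorem dist_le (h : IsConstSpeedLoop β β' c) (s t : ℝ) : dist (β s) (β t) ≤ c * |s - t| := by
  simpa [Real.coe_toNNReal _ h.pos.le, Real.dist_eq] using h.lipschitzWith.dist_le_mul s t

/-- At small scales the chord length is at least `a` times the parameter distance, for every
`a` smaller than the speed. -/
theorem exists_le_dist_of_abs_sub_le (h : IsConstSpeedLoop β β' c) {a : ℝ} (ha : a < c) :
    ∃ η > 0, ∀ s ∈ Icc (-π) (3 * π), ∀ t ∈ Icc (-π) (3 * π), |s - t| ≤ η →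
      a * |s - t| ≤ dist (β s) (β t) := by
  obtain ⟨η, hη, H⟩ := Metric.uniformContinuousOn_iff_le.1
    (isCompact_Icc.uniformContinuousOn_of_continuous
      (h.continuous_deriv.continuousOn (s := Icc (-π) (3 * π)))) (c - a) (sub_pos.2 ha)
  refine ⟨η, hη, fun s hs t ht hst => ?_⟩
  have hsub : uIcc t s ⊆ Icc (-π) (3 * π) := (ordConnected_Icc).uIcc_subset ht hs
  have key := (convex_uIcc t s).norm_image_sub_le_of_norm_hasDerivWithin_le
    (f := fun u => β u - u • β' t) (f' := fun u => β' u - (1 : ℝ) • β' t) (C := c - a)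
    (fun u _ => ((h.hasDerivAt u).sub ((hasDerivAt_id u).smul_const (β' t))).hasDerivWithinAt)
    (fun u hu => by
      rw [one_smul, ← dist_eq_norm]
      refine H u (hsub hu) t ht ?_
      rw [Real.dist_eq]
      exact (abs_sub_left_of_mem_uIcc hu).trans hst)
    left_mem_uIcc right_mem_uIcc
  have h1 : β s - s • β' t - (β t - t • β' t) = (β s - β t) - (s - t) • β' t := by
    rw [sub_smul]; abel
  rw [h1, Real.norm_eq_abs] at key
  have h2 : ‖(s - t) • β' t‖ = c * |s - t| := by
    rw [norm_smul, h.speed, Real.norm_eq_abs, mul_comm]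
  have h3 := norm_sub_norm_le ((s - t) • β' t) (β s - β t)
  rw [norm_sub_rev _ (β s - β t), h2] at h3
  rw [dist_eq_norm]
  linarith

/-- Short chords have endpoints that are close in parameter distance. -/
theorem exists_abs_sub_le_of_dist_le (h : IsConstSpeedLoop β β' c) {a : ℝ} (ha : a < c) :
    ∃ δ > 0, ∀ s ∈ Ioc 0 (2 * π), ∀ t ∈ Ioc (s - π) (s + π), dist (β s) (β t) ≤ δ →
      a * |s - t| ≤ dist (β s) (β t) := by
  obtain ⟨η, hη, H⟩ := h.exists_le_dist_of_abs_sub_le ha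
  have hπ := Real.pi_pos
  set K : Set (ℝ × ℝ) := (Icc 0 (2 * π) ×ˢ Icc (-π) (3 * π)) ∩
    {z | η ≤ |z.1 - z.2| ∧ |z.1 - z.2| ≤ π} with hK
  have hKc : IsCompact K := by
    refine (isCompact_Icc.prod isCompact_Icc).inter_right ?_
    rw [ofPred_and]
    exact (isClosed_le continuous_const (continuous_fst.sub continuous_snd).abs).inter
      (isClosed_le (continuous_fst.sub continuous_snd).abs continuous_const)
  obtain ⟨δ, hδ, hδK⟩ := hKc.exists_forall_le' (f := fun z : ℝ × ℝ => dist (β z.1) (β z.2)) (a := 0)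
    (((h.continuous.comp continuous_fst).dist (h.continuous.comp continuous_snd)).continuousOn)
    (fun z hz => by
      rw [dist_pos]
      intro heq
      obtain ⟨n, hn⟩ := h.inj _ _ heq
      obtain ⟨-, h1, h2⟩ := hz
      rw [hn, sub_add_cancel_left, abs_neg, abs_mul, abs_of_pos (by positivity : 0 < 2 * π)]
        at h1 h2
      have h3 : |(n : ℝ)| < 1 := by nlinarith
      have h4 : n = 0 := by
        rw [← Int.abs_lt_one_iff]
        exact_mod_cast h3
      simp only [h4, Int.cast_zero, abs_zero, zero_mul] at h1
      exact h1.not_gt hη)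
  refine ⟨δ / 2, half_pos hδ, fun s hs t ht hst => ?_⟩
  have hs' : s ∈ Icc 0 (2 * π) := Ioc_subset_Icc_self hs
  have ht' : t ∈ Icc (-π) (3 * π) := ⟨by linarith [ht.1, hs.1], by linarith [ht.2, hs.2]⟩
  refine H s ⟨by linarith [hs.1], by linarith [hs.2]⟩ t ht' ?_
  by_contra! hlt
  have := hδK (s, t) ⟨⟨hs', ht'⟩, hlt.le, abs_le.2 ⟨by linarith [ht.2], by linarith [ht.1]⟩⟩
  simp only at this
  linarith

theorem injOn_Ioc (h : IsConstSpeedLoop β β' c) : InjOn β (Ioc 0 (2 * π)) := by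
  intro s hs t ht hst
  obtain ⟨n, hn⟩ := h.inj s t hst
  have hπ := Real.pi_pos
  have h1 : (-1 : ℝ) < n := by nlinarith [hs.1, hs.2, ht.1, ht.2]
  have h2 : (n : ℝ) < 1 := by nlinarith [hs.1, hs.2, ht.1, ht.2]
  have h3 : n = 0 := by
    have h1' : (-1 : ℤ) < n := by exact_mod_cast h1
    have h2' : n < 1 := by exact_mod_cast h2
    omega
  simp [hn, h3]

theorem image_Ioc (h : IsConstSpeedLoop β β' c) : β '' Ioc 0 (2 * π) = range β := by
  simpa using h.periodic.image_Ioc (by positivity) 0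

variable [MeasurableSpace E] [BorelSpace E]

theorem hausdorffMeasure_image (h : IsConstSpeedLoop β β' c) {S : Set ℝ}
    (hS : MeasurableSet S) (hsub : S ⊆ Ioc 0 (2 * π)) :
    (μH[1] : Measure E) (β '' S) = ENNReal.ofReal c * volume S := by
  have hle : (μH[1] : Measure E) (β '' S) ≤ ENNReal.ofReal c * volume S := by
    have := h.lipschitzWith.hausdorffMeasure_image_le zero_le_one S
    rwa [hausdorffMeasure_real, ENNReal.rpow_one] at this
  have hfin : volume S ≠ ∞ := ((measure_mono hsub).trans_lt (by rw [Real.volume_Ioc]; exact ENNReal.ofReal_lt_top)).ne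
  have hfin' : (μH[1] : Measure E) (β '' S) ≠ ∞ :=
    (hle.trans_lt (ENNReal.mul_lt_top ENNReal.ofReal_lt_top hfin.lt_top)).ne
  have hlow : ∀ a, 0 < a → a < c →
      volume S ≤ ENNReal.ofReal a⁻¹ * (μH[1] : Measure E) (β '' S) := by
    intro a ha0 hac
    obtain ⟨η, hη, H⟩ := h.exists_le_dist_of_abs_sub_le hac
    set P : ℤ → Set ℝ := fun k => S ∩ Ioc (k • η) ((k + 1) • η) with hP
    have hPS : ∀ k, P k ⊆ S := fun k => inter_subset_left
    have hPm : ∀ k, MeasurableSet (P k) := fun k => hS.inter measurableSet_Ioc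
    have hPd : Pairwise (Function.onFun Disjoint P) := fun i j hij =>
      (pairwise_disjoint_Ioc_zsmul η hij).mono inter_subset_right inter_subset_right
    have hPU : S = ⋃ k, P k := by
      rw [← inter_iUnion, iUnion_Ioc_zsmul hη, inter_univ]
    have hinj : InjOn β S := h.injOn_Ioc.mono hsub
    have hpiece : ∀ k, volume (P k) ≤ ENNReal.ofReal a⁻¹ * (μH[1] : Measure E) (β '' P k) := by
      intro k
      have hleft : LeftInvOn (Function.invFunOn β (P k)) β (P k) :=
        (hinj.mono (hPS k)).leftInvOn_invFunOn
      have hlip : LipschitzOnWith a⁻¹.toNNReal (Function.invFunOn β (P k)) (β '' P k) := by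
        refine LipschitzOnWith.of_dist_le_mul ?_
        rintro _ ⟨s, hs, rfl⟩ _ ⟨t, ht, rfl⟩
        rw [hleft hs, hleft ht, Real.coe_toNNReal _ (inv_pos.2 ha0).le, ← div_eq_inv_mul,
          le_div_iff₀' ha0, Real.dist_eq]
        have hI : ∀ u ∈ P k, u ∈ Icc (-π) (3 * π) := fun u hu => by
          have := hsub (hPS k hu)
          constructor <;> linarith [this.1, this.2, Real.pi_pos]
        refine H s (hI s hs) t (hI t ht) ?_
        have h1 := hs.2
        have h2 := ht.2
        simp only [zsmul_eq_mul, Int.cast_add, Int.cast_one, mem_Ioc] at h1 h2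
        rw [abs_le]
        constructor <;> linarith [h1.1, h1.2, h2.1, h2.2]
      have := hlip.hausdorffMeasure_image_le zero_le_one
      rwa [hleft.image_image, hausdorffMeasure_real, ENNReal.rpow_one] at this
    have him : (μH[1] : Measure E) (β '' S) = ∑' k, (μH[1] : Measure E) (β '' P k) := by
      conv_lhs => rw [hPU, image_iUnion]
      refine measure_iUnion (fun i j hij => ?_) fun k => ?_
      · exact (hPd hij).image hinj (hPS i) (hPS j)
      · exact (hPm k).image_of_continuousOn_injOn h.continuous.continuousOn (hinj.mono (hPS k))
    conv_lhs => rw [hPU, measure_iUnion hPd hPm]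
    rw [him, ← ENNReal.tsum_mul_left]
    exact ENNReal.tsum_le_tsum hpiece
  refine le_antisymm hle ?_
  rw [← ENNReal.ofReal_toReal hfin, ← ENNReal.ofReal_toReal hfin', ← ENNReal.ofReal_mul h.pos.le]
  refine ENNReal.ofReal_le_ofReal ?_
  set v := (volume S).toReal with hv
  set m := ((μH[1] : Measure E) (β '' S)).toReal with hm
  have hv0 : 0 ≤ v := ENNReal.toReal_nonneg
  have hm0 : 0 ≤ m := ENNReal.toReal_nonneg
  by_contra! hlt
  have hvpos : 0 < v := hv0.lt_of_ne fun h0 => by rw [← h0, mul_zero] at hlt; linarith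
  obtain ⟨a, ha1, ha2⟩ := exists_between ((div_lt_iff₀ hvpos).2 hlt)
  have ha0 : 0 < a := (div_nonneg hm0 hv0).trans_lt ha1
  have h1 := ENNReal.toReal_mono (ENNReal.mul_ne_top ENNReal.ofReal_ne_top hfin')
    (hlow a ha0 ha2)
  rw [ENNReal.toReal_mul, ENNReal.toReal_ofReal (inv_pos.2 ha0).le, ← div_eq_inv_mul,
    le_div_iff₀ ha0] at h1
  rw [div_lt_iff₀ hvpos] at ha1
  linarith

theorem restrict_hausdorffMeasure (h : IsConstSpeedLoop β β' c) :
    (μH[1] : Measure E).restrict (range β) =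
      ENNReal.ofReal c • Measure.map β (volume.restrict (Ioc 0 (2 * π))) := by
  ext A hA
  have hm := h.continuous.measurable hA
  rw [Measure.restrict_apply hA, Measure.smul_apply, Measure.map_apply h.continuous.measurable hA,
    Measure.restrict_apply hm, smul_eq_mul,
    ← h.hausdorffMeasure_image (hm.inter measurableSet_Ioc) inter_subset_right,
    image_preimage_inter, h.image_Ioc]

end NormedSpace
section Plane

variable {β β' β₂ β₂' : ℝ → EucPlane} {c c₂ : ℝ}

theorem curveMeasure_range (h : IsConstSpeedLoop β β' c) :
    curveMeasure (range β) = Measure.map β anglesMeasure := by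
  have hmass : (μH[1] : Measure EucPlane) (range β) =
      ENNReal.ofReal c * ENNReal.ofReal (2 * π) := by
    rw [← h.image_Ioc, h.hausdorffMeasure_image measurableSet_Ioc subset_rfl, Real.volume_Ioc,
      sub_zero]
  have hc : ENNReal.ofReal c ≠ 0 := by simp [h.pos]
  rw [curveMeasure, hmass, h.restrict_hausdorffMeasure, anglesMeasure, Measure.map_smul, smul_smul]
  congr 1
  rw [ENNReal.mul_inv (Or.inl hc) (Or.inl ENNReal.ofReal_ne_top), mul_right_comm,
    ENNReal.inv_mul_cancel hc ENNReal.ofReal_ne_top, one_mul]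

theorem curveMeasure_prod (h : IsConstSpeedLoop β β' c) :
    (curveMeasure (range β)).prod (curveMeasure (range β)) =
      Measure.map (Prod.map β β) (anglesMeasure.prod anglesMeasure) := by
  rw [h.curveMeasure_range,
    Measure.map_prod_map _ _ h.continuous.measurable h.continuous.measurable]

theorem curveGlobalDistrib_eq_lintegral (h : IsConstSpeedLoop β β' c) (r : ℝ) :
    curveGlobalDistrib (range β) r =
      ∫⁻ s, anglesMeasure {t | dist (β s) (β t) ≤ r} ∂anglesMeasure := by
  have hm := h.continuous.measurable.prodMap h.continuous.measurable
  rw [curveGlobalDistrib, h.curveMeasure_prod, Measure.map_apply hm (measurableSet_dist_le r),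
    Measure.prod_apply (hm (measurableSet_dist_le r))]
  rfl

theorem anglesMeasure_dist_le (h : IsConstSpeedLoop β β' c) (s r : ℝ) :
    anglesMeasure {t | dist (β s) (β t) ≤ r} =
      (ENNReal.ofReal (2 * π))⁻¹ *
        volume ({t | dist (β s) (β t) ≤ r} ∩ Ioc (s - π) (s + π)) := by
  have hm : MeasurableSet {t | dist (β s) (β t) ≤ r} :=
    measurableSet_le (continuous_const.dist h.continuous).measurable measurable_const
  rw [anglesMeasure, Measure.smul_apply, Measure.restrict_apply hm, smul_eq_mul]
  congr 1
  have h1 := isAddFundamentalDomain_Ioc Real.two_pi_pos 0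
  have h2 := isAddFundamentalDomain_Ioc Real.two_pi_pos (s - π)
  rw [zero_add] at h1
  rw [show s - π + 2 * π = s + π by ring] at h2
  refine h1.measure_set_eq h2 hm ?_
  rintro ⟨_, n, rfl⟩
  ext t
  have : β (n * (2 * π) + t) = β t := by
    rw [add_comm]
    exact h.periodic.int_mul n t
  simp [AddSubgroup.vadd_def, this]

theorem le_curveGlobalDistrib (h : IsConstSpeedLoop β β' c) {r : ℝ} (hr : r ≤ c * π) :
    (ENNReal.ofReal (2 * π))⁻¹ * ENNReal.ofReal (2 * r / c) ≤ curveGlobalDistrib (range β) r := by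
  have hc := h.pos
  rw [h.curveGlobalDistrib_eq_lintegral]
  calc (ENNReal.ofReal (2 * π))⁻¹ * ENNReal.ofReal (2 * r / c)
      = ∫⁻ _, (ENNReal.ofReal (2 * π))⁻¹ * ENNReal.ofReal (2 * r / c) ∂anglesMeasure := by simp
    _ ≤ _ := lintegral_mono fun s => ?_
  simp only [h.anglesMeasure_dist_le]
  gcongr
  calc ENNReal.ofReal (2 * r / c) = volume (Ioc (s - r / c) (s + r / c)) := by
        rw [Real.volume_Ioc]
        congr 1
        ring
    _ ≤ _ := measure_mono fun t ht => ?_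
  have hrc : r / c ≤ π := (div_le_iff₀' hc).2 hr
  refine ⟨?_, by linarith [ht.1], by linarith [ht.2]⟩
  have h1 : |s - t| ≤ r / c := abs_le.2 ⟨by linarith [ht.2], by linarith [ht.1]⟩
  exact (h.dist_le s t).trans ((le_div_iff₀' hc).1 h1)

theorem exists_curveGlobalDistrib_le (h : IsConstSpeedLoop β β' c) {a : ℝ} (ha : 0 < a)
    (hac : a < c) : ∃ δ > 0, ∀ r ≤ δ,
      curveGlobalDistrib (range β) r ≤
        (ENNReal.ofReal (2 * π))⁻¹ * ENNReal.ofReal (2 * r / a) := by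
  obtain ⟨δ, hδ, H⟩ := h.exists_abs_sub_le_of_dist_le hac
  refine ⟨δ, hδ, fun r hr => ?_⟩
  rw [h.curveGlobalDistrib_eq_lintegral]
  calc _ ≤ ∫⁻ _, (ENNReal.ofReal (2 * π))⁻¹ * ENNReal.ofReal (2 * r / a) ∂anglesMeasure :=
        lintegral_mono_ae ?_
    _ = _ := by simp
  have hae : ∀ᵐ s ∂anglesMeasure, s ∈ Ioc 0 (2 * π) :=
    Measure.ae_smul_measure (ae_restrict_mem measurableSet_Ioc) _
  filter_upwards [hae] with s hs
  rw [h.anglesMeasure_dist_le]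
  gcongr
  calc _ ≤ volume (Icc (s - r / a) (s + r / a)) := measure_mono ?_
    _ = ENNReal.ofReal (2 * r / a) := by
        rw [Real.volume_Icc]
        congr 1
        ring
  rintro t ⟨hd, ht⟩
  have h1 : a * |s - t| ≤ r := (H s hs t ht (le_trans hd hr)).trans hd
  have h2 := abs_le.1 ((le_div_iff₀' ha).2 h1)
  exact ⟨by linarith [h2.2], by linarith [h2.1]⟩

/-- The small scale behaviour of the global distance distribution detects the length. -/
theorem speed_le_of_curveGlobalDistrib_le (h : IsConstSpeedLoop β β' c)
    (h₂ : IsConstSpeedLoop β₂ β₂' c₂)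
    (hH : ∀ r, 0 ≤ r → curveGlobalDistrib (range β₂) r ≤ curveGlobalDistrib (range β) r) :
    c ≤ c₂ := by
  refine le_of_forall_lt_imp_le_of_dense fun a hac => ?_
  have hc₂ := h₂.pos
  rcases le_or_gt a 0 with ha | ha
  · exact ha.trans hc₂.le
  obtain ⟨δ, hδ, H⟩ := h.exists_curveGlobalDistrib_le ha hac
  set r := min δ (c₂ * π) with hr
  have hr0 : 0 < r := lt_min hδ (by positivity)
  have h1 := ((h₂.le_curveGlobalDistrib (min_le_right _ _)).trans (hH r hr0.le)).trans
    (H r (min_le_left _ _))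
  rw [ENNReal.mul_le_mul_iff_right (ENNReal.inv_ne_zero.2 ENNReal.ofReal_ne_top)
    (ENNReal.inv_ne_top.2 ofReal_two_pi_ne_zero),
    ENNReal.ofReal_le_ofReal_iff (by positivity), div_le_div_iff₀ hc₂ ha] at h1
  exact le_of_mul_le_mul_left h1 (by positivity)

theorem integral_dist_sq_eq (h : IsConstSpeedLoop β β' c) (h₂ : IsConstSpeedLoop β₂ β₂' c₂)
    (hH : ∀ r, 0 ≤ r → curveGlobalDistrib (range β) r = curveGlobalDistrib (range β₂) r) :
    ∫ z, dist (β z.1) (β z.2) ^ 2 ∂(anglesMeasure.prod anglesMeasure) =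
      ∫ z, dist (β₂ z.1) (β₂ z.2) ^ 2 ∂(anglesMeasure.prod anglesMeasure) := by
  have hm := h.continuous.measurable.prodMap h.continuous.measurable
  have hm₂ := h₂.continuous.measurable.prodMap h₂.continuous.measurable
  have hd : Measurable fun z : ℝ × ℝ => dist (β z.1) (β z.2) := measurable_dist.comp hm
  have hd₂ : Measurable fun z : ℝ × ℝ => dist (β₂ z.1) (β₂ z.2) := measurable_dist.comp hm₂
  have key : Measure.map (fun z => dist (β z.1) (β z.2)) (anglesMeasure.prod anglesMeasure) =
      Measure.map (fun z => dist (β₂ z.1) (β₂ z.2)) (anglesMeasure.prod anglesMeasure) := by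
    have : IsFiniteMeasure
        (Measure.map (fun z => dist (β z.1) (β z.2)) (anglesMeasure.prod anglesMeasure)) :=
      Measure.isFiniteMeasure_map _ _
    refine Measure.ext_of_Iic _ _ fun r => ?_
    rw [Measure.map_apply hd measurableSet_Iic,
      Measure.map_apply hd₂ measurableSet_Iic]
    rcases lt_or_ge r 0 with hr | hr
    · have : ∀ f : ℝ → EucPlane, (fun z : ℝ × ℝ => dist (f z.1) (f z.2)) ⁻¹' Iic r = ∅ :=
        fun f => eq_empty_of_forall_notMem fun z hz => (hz.trans_lt hr).not_ge dist_nonneg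
      rw [this, this]
    · have := hH r hr
      rwa [curveGlobalDistrib, curveGlobalDistrib, h.curveMeasure_prod, h₂.curveMeasure_prod,
        Measure.map_apply hm (measurableSet_dist_le r),
        Measure.map_apply hm₂ (measurableSet_dist_le r)] at this
  have hsq : ∀ ν : Measure ℝ, AEStronglyMeasurable (fun x : ℝ => x ^ 2) ν := fun ν =>
    (continuous_pow 2).aestronglyMeasurable
  have h1 := integral_map (μ := anglesMeasure.prod anglesMeasure) hd.aemeasurable (hsq _)
  have h2 := integral_map (μ := anglesMeasure.prod anglesMeasure) hd₂.aemeasurable (hsq _)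
  exact h1.symm.trans ((congrArg (fun ν => ∫ x : ℝ, x ^ 2 ∂ν) key).trans h2)

end Plane

section InnerProductSpace

variable {E : Type*} [NormedAddCommGroup E] [InnerProductSpace ℝ E] [CompleteSpace E]
  {β β' : ℝ → E} {c : ℝ}

theorem integral_dist_sq (h : IsConstSpeedLoop β β' c) :
    ∫ z, dist (β z.1) (β z.2) ^ 2 ∂(anglesMeasure.prod anglesMeasure) =
      2 * (∫ s, ‖β s‖ ^ 2 ∂anglesMeasure - ‖∫ s, β s ∂anglesMeasure‖ ^ 2) := by
  have hβ := h.continuous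
  have hcont : Continuous fun z : ℝ × ℝ => dist (β z.1) (β z.2) ^ 2 := by fun_prop
  have hbdd : Bornology.IsBounded (range β) := by
    rw [← h.image_Ioc]
    exact (isCompact_Icc.image hβ).isBounded.subset (image_mono Ioc_subset_Icc_self)
  obtain ⟨M, hM⟩ := Metric.isBounded_iff.1 hbdd
  have hint : Integrable (fun z : ℝ × ℝ => dist (β z.1) (β z.2) ^ 2)
      (anglesMeasure.prod anglesMeasure) :=
    Integrable.of_bound hcont.aestronglyMeasurable (M ^ 2) <| Filter.Eventually.of_forall fun z => by
      rw [norm_pow, Real.norm_of_nonneg dist_nonneg]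
      exact pow_le_pow_left₀ dist_nonneg (hM (mem_range_self _) (mem_range_self _)) 2
  have hi : Integrable β anglesMeasure := integrable_anglesMeasure hβ
  have hi2 : Integrable (fun s => ‖β s‖ ^ 2) anglesMeasure :=
    integrable_anglesMeasure (by fun_prop)
  have hi1 : ∀ x, Integrable (fun t => 2 * inner ℝ x (β t)) anglesMeasure := fun x =>
    (hi.const_inner x).const_mul 2
  set m := ∫ s, β s ∂anglesMeasure with hm
  set q := ∫ s, ‖β s‖ ^ 2 ∂anglesMeasure with hq
  have hinner : ∀ s, ∫ t, dist (β s) (β t) ^ 2 ∂anglesMeasure =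
      ‖β s‖ ^ 2 - 2 * inner ℝ m (β s) + q := fun s => by
    simp only [dist_eq_norm, norm_sub_sq_real]
    rw [integral_add (f := fun t => ‖β s‖ ^ 2 - 2 * inner ℝ (β s) (β t))
        ((integrable_const _).sub (hi1 _)) hi2,
      integral_sub (integrable_const _) (hi1 _), integral_const_mul, integral_inner hi, real_inner_comm]
    simp [hm, hq]
  rw [integral_prod _ hint]
  simp only [hinner]
  rw [integral_add (f := fun s => ‖β s‖ ^ 2 - 2 * inner ℝ m (β s))
      (hi2.sub (hi1 _)) (integrable_const _),
    integral_sub hi2 (hi1 _), integral_const_mul, integral_inner hi, real_inner_self_eq_norm_sq]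
  simp only [integral_const, probReal_univ, one_smul]
  ring

end InnerProductSpace

end IsConstSpeedLoop

theorem isConstSpeedLoop_exp :
    IsConstSpeedLoop (fun s : ℝ => Complex.exp (s * Complex.I))
      (fun s : ℝ => Complex.exp (s * Complex.I) * Complex.I) 1 where
  pos := one_pos
  hasDerivAt s := by
    simpa using (((hasDerivAt_id (s : ℂ)).mul_const Complex.I).cexp).comp_ofReal
  continuous_deriv := by fun_prop
  speed s := by simp [Complex.norm_exp_ofReal_mul_I]
  periodic s := by
    have := Complex.exp_periodic (s * Complex.I)
    simpa [add_mul] using this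
  inj s t hst := by
    obtain ⟨n, hn⟩ := Complex.exp_eq_exp_iff_exists_int.1 hst.symm
    refine ⟨n, ?_⟩
    have := congrArg Complex.im hn
    simpa using this

theorem integral_exp_anglesMeasure :
    ∫ s, Complex.exp ((s : ℝ) * Complex.I) ∂anglesMeasure = 0 := by
  rw [integral_anglesMeasure]
  have := integral_exp_mul_complex (a := 0) (b := 2 * π) Complex.I_ne_zero
  simp only [mul_comm Complex.I] at this
  rw [this]
  simp [Complex.exp_two_pi_mul_I]

theorem range_exp_mul_I : range (fun s : ℝ => Complex.exp (s * Complex.I)) = sphere 0 1 := by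
  ext w
  rw [mem_sphere_zero_iff_norm, Complex.norm_eq_one_iff]
  rfl

/-- A trigonometric polynomial of degree one whose derivative has norm one parametrizes a unit
circle. -/
theorem range_trigPolynomial_eq_sphere (w u v : ℂ)
    (h : ∀ s : ℝ, ‖u * Complex.exp (s * Complex.I) - v * Complex.exp (-(s * Complex.I))‖ = 1) :
    range (fun s : ℝ => w + u * Complex.exp (s * Complex.I) + v * Complex.exp (-(s * Complex.I))) =
      sphere w 1 := by
  have hrot : ∀ s : ℝ, ‖u * Complex.exp ((2 * s : ℝ) * Complex.I) - v‖ = 1 := fun s => by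
    have h1 : u * Complex.exp ((2 * s : ℝ) * Complex.I) - v =
        (u * Complex.exp (s * Complex.I) - v * Complex.exp (-(s * Complex.I))) *
          Complex.exp (s * Complex.I) := by
      rw [sub_mul, mul_assoc, mul_assoc, ← Complex.exp_add, ← Complex.exp_add, neg_add_cancel,
        Complex.exp_zero, mul_one]
      congr 3
      push_cast
      ring
    rw [h1, norm_mul, h, Complex.norm_exp_ofReal_mul_I, one_mul]
  have huv : u = 0 ∨ v = 0 := by
    have h0 := hrot 0
    have h1 := hrot (π / 2)
    have h2 := hrot (π / 4)
    have h3 := hrot (-(π / 4))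
    rw [show 2 * (π / 2) = π by ring] at h1
    rw [show 2 * (π / 4) = π / 2 by ring] at h2
    rw [show 2 * (-(π / 4)) = -(π / 2) by ring] at h3
    rw [Complex.exp_ofReal_mul_I] at h0 h1 h2 h3
    simp only [← sq_eq_sq₀ (norm_nonneg _) zero_le_one, ← Complex.normSq_eq_norm_sq,
      Complex.normSq_apply] at h0 h1 h2 h3
    simp at h0 h1 h2 h3
    have hz : Complex.normSq u * Complex.normSq v = 0 := by
      rw [Complex.normSq_apply, Complex.normSq_apply]
      have e1 : u.re * v.re + u.im * v.im = 0 := by linarith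
      have e2 : u.re * v.im - u.im * v.re = 0 := by linarith
      linear_combination (u.re * v.re + u.im * v.im) * e1 + (u.re * v.im - u.im * v.re) * e2
    simpa using hz
  have hsurj : ∀ a : ℂ, ‖a‖ = 1 → ∀ x ∈ sphere w 1,
      ∃ s : ℝ, w + a * Complex.exp (s * Complex.I) = x := by
    intro a ha x hx
    have ha0 : a ≠ 0 := norm_ne_zero_iff.1 (by simp [ha])
    rw [mem_sphere_iff_norm] at hx
    obtain ⟨s, hs⟩ := (Complex.norm_eq_one_iff ((x - w) / a)).1 (by rw [norm_div, hx, ha, div_one])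
    refine ⟨s, ?_⟩
    rw [hs]
    field_simp
    ring
  have h0 := h 0
  refine Subset.antisymm ?_ fun x hx => ?_
  · rintro _ ⟨s, rfl⟩
    have hs := h s
    rw [mem_sphere_iff_norm]
    rcases huv with rfl | rfl <;> simpa using hs
  · rcases huv with rfl | rfl
    · obtain ⟨s, hs⟩ := hsurj v (by simpa using h0) x hx
      exact ⟨-s, by simpa using hs⟩
    · obtain ⟨s, hs⟩ := hsurj u (by simpa using h0) x hx
      exact ⟨s, by simpa using hs⟩

section Fourier

variable {z z' : ℝ → ℂ}

/-- The Fourier coefficients of a `2π`-periodic differentiable function and of its derivative. -/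
theorem fourierCoeffOn_deriv (hz : ∀ s, HasDerivAt z (z' s) s) (hz' : Continuous z')
    (hper : Function.Periodic z (2 * π)) (n : ℤ) :
    fourierCoeffOn Real.two_pi_pos z' n = Complex.I * n * fourierCoeffOn Real.two_pi_pos z n := by
  have hend : z (2 * π) - z 0 = 0 := by
    rw [sub_eq_zero]
    simpa using hper 0
  rcases eq_or_ne n 0 with rfl | hn
  · rw [fourierCoeffOn_eq_integral]
    simp only [neg_zero, fourier_zero, one_smul]
    rw [intervalIntegral.integral_eq_sub_of_hasDerivAt (fun s _ => hz s)
      (hz'.intervalIntegrable _ _), hend]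
    simp
  · have hπ : (π : ℂ) ≠ 0 := by exact_mod_cast Real.pi_ne_zero
    have hn' : (n : ℂ) ≠ 0 := by exact_mod_cast hn
    rw [fourierCoeffOn_of_hasDerivAt Real.two_pi_pos hn (fun s _ => hz s)
      (hz'.intervalIntegrable _ _), hend]
    push_cast
    field_simp
    ring

theorem hasSum_sq_fourierCoeffOn_two_pi (hz : Continuous z) :
    HasSum (fun n => ‖fourierCoeffOn Real.two_pi_pos z n‖ ^ 2)
      (∫ s, ‖z s‖ ^ 2 ∂anglesMeasure) := by
  have hmem : MemLp z 2 (volume.restrict (Ioc 0 (2 * π))) := by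
    rw [memLp_two_iff_integrable_sq_norm hz.aestronglyMeasurable]
    exact (hz.norm.pow 2).integrableOn_Ioc
  have := hasSum_sq_fourierCoeffOn Real.two_pi_pos hmem
  rwa [sub_zero, ← integral_anglesMeasure] at this

theorem fourierCoeffOn_two_pi_zero :
    fourierCoeffOn Real.two_pi_pos z 0 = ∫ s, z s ∂anglesMeasure := by
  rw [fourierCoeffOn_eq_integral, integral_anglesMeasure]
  simp

/-- A continuous `2π`-periodic function whose Fourier coefficients vanish outside `{-1, 0, 1}` is a
trigonometric polynomial of degree one. -/
theorem eq_trigPolynomial_of_fourierCoeffOn_eq_zero (hz : Continuous z)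
    (hper : Function.Periodic z (2 * π))
    (h0 : ∀ n : ℤ, n ^ 2 ≠ 1 → n ≠ 0 → fourierCoeffOn Real.two_pi_pos z n = 0) (s : ℝ) :
    z s = fourierCoeffOn Real.two_pi_pos z 0 +
      fourierCoeffOn Real.two_pi_pos z 1 * Complex.exp (s * Complex.I) +
      fourierCoeffOn Real.two_pi_pos z (-1) * Complex.exp (-(s * Complex.I)) := by
  have : Fact (0 < 2 * π - 0) := ⟨by simpa using Real.pi_pos⟩
  have hper' : Function.Periodic z (2 * π - 0) := by simpa using hper
  set f : C(AddCircle (2 * π - 0), ℂ) := ⟨hper'.lift, hz.quotient_liftOn' _⟩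
  have hfz : ∀ s : ℝ, f s = z s := fun s => hper'.lift_coe s
  have hcoeff : ∀ n, fourierCoeff f n = fourierCoeffOn Real.two_pi_pos z n := fun n => by
    rw [fourierCoeff_eq_intervalIntegral _ _ 0, fourierCoeffOn_eq_integral]
    simp only [hfz, zero_add, sub_zero]
  have hvan : ∀ n ∉ ({0, 1, -1} : Finset ℤ), fourierCoeff f n = 0 := fun n hn => by
    simp only [Finset.mem_insert, Finset.mem_singleton, not_or] at hn
    rw [hcoeff]
    exact h0 n (fun h => (by simpa using h : n = 1 ∨ n = -1).elim hn.2.1 hn.2.2) hn.1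
  have hsum := has_pointwise_sum_fourier_series_of_summable
    (summable_of_ne_finset_zero hvan) (s : AddCircle (2 * π - 0))
  have hfin : HasSum (fun n => fourierCoeff f n • fourier n (s : AddCircle (2 * π - 0)))
      (∑ n ∈ ({0, 1, -1} : Finset ℤ),
        fourierCoeff f n • fourier n (s : AddCircle (2 * π - 0))) :=
    hasSum_sum_of_ne_finset_zero fun n hn => by rw [hvan n hn, zero_smul]
  have heq := hsum.unique hfin
  have hπ : (π : ℂ) ≠ 0 := by exact_mod_cast Real.pi_ne_zero
  have e1 : (2 * π * Complex.I * s / (2 * π) : ℂ) = s * Complex.I := by field_simp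
  have e2 : (2 * π * Complex.I * -1 * s / (2 * π) : ℂ) = -(s * Complex.I) := by field_simp
  rw [hfz] at heq
  rw [heq]
  simp only [hcoeff]
  rw [Finset.sum_insert (by decide), Finset.sum_insert (by decide), Finset.sum_singleton]
  simp only [fourier_coe_apply, sub_zero]
  push_cast
  simp only [mul_one, mul_zero, zero_mul, zero_div, Complex.exp_zero, smul_eq_mul, e1, e2]
  ring

/-- Equality in Wirtinger's inequality: a unit speed closed curve of length `2π` whose variance is
`1` is a unit circle. -/
theorem IsConstSpeedLoop.exists_range_eq_sphere (h : IsConstSpeedLoop z z' 1)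
    (hvar : ∫ s, ‖z s‖ ^ 2 ∂anglesMeasure - ‖∫ s, z s ∂anglesMeasure‖ ^ 2 = 1) :
    ∃ w, range z = sphere w 1 := by
  set a : ℤ → ℂ := fun n => fourierCoeffOn Real.two_pi_pos z n with ha
  have hsum := hasSum_sq_fourierCoeffOn_two_pi h.continuous
  have hsum' := hasSum_sq_fourierCoeffOn_two_pi h.continuous_deriv
  simp only [h.speed, one_pow, integral_const, probReal_univ, one_smul,
    fourierCoeffOn_deriv h.hasDerivAt h.continuous_deriv h.periodic] at hsum'
  have hdefect : HasSum (fun n : ℤ => ((n : ℝ) ^ 2 - 1) * ‖a n‖ ^ 2 +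
      if n = 0 then ‖a 0‖ ^ 2 else 0) 0 := by
    have := (hsum'.sub hsum).add (hasSum_ite_eq (0 : ℤ) (‖a 0‖ ^ 2))
    have hval : 1 - ∫ s, ‖z s‖ ^ 2 ∂anglesMeasure + ‖a 0‖ ^ 2 = 0 := by
      simp only [ha, fourierCoeffOn_two_pi_zero]
      linarith
    rw [hval] at this
    have hterm : ∀ n : ℤ, ((n : ℝ) ^ 2 - 1) * ‖a n‖ ^ 2 =
        ‖Complex.I * n * a n‖ ^ 2 - ‖a n‖ ^ 2 := fun n => by
      rw [norm_mul, norm_mul, Complex.norm_I, one_mul, mul_pow, Complex.norm_intCast, sq_abs]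
      ring
    simp only [hterm]
    exact this
  have hnonneg : ∀ n : ℤ, 0 ≤ ((n : ℝ) ^ 2 - 1) * ‖a n‖ ^ 2 +
      if n = 0 then ‖a 0‖ ^ 2 else 0 := fun n => by
    split_ifs with hn
    · simp [hn]
    · have : (1 : ℝ) ≤ (n : ℝ) ^ 2 := by
        exact_mod_cast Int.one_le_abs hn |> (one_le_sq_iff_one_le_abs n).2
      rw [add_zero]
      exact mul_nonneg (by linarith) (sq_nonneg _)
  have hzero := (hasSum_zero_iff_of_nonneg hnonneg).1 hdefect
  have hvan : ∀ n : ℤ, n ^ 2 ≠ 1 → n ≠ 0 → a n = 0 := fun n hn1 hn0 => by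
    have := congrFun hzero n
    simp only [hn0, if_false, add_zero, Pi.zero_apply, mul_eq_zero] at this
    rcases this with h1 | h1
    · exact absurd (by exact_mod_cast sub_eq_zero.1 h1) hn1
    · simpa using h1
  have hpoly := eq_trigPolynomial_of_fourierCoeffOn_eq_zero h.continuous h.periodic hvan
  have hz : z = fun s : ℝ => a 0 + a 1 * Complex.exp (s * Complex.I) +
      a (-1) * Complex.exp (-(s * Complex.I)) := funext hpoly
  refine ⟨a 0, ?_⟩
  rw [hz]
  refine range_trigPolynomial_eq_sphere _ _ _ fun s => ?_
  have hE : HasDerivAt (fun s : ℝ => Complex.exp (s * Complex.I))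
      (Complex.exp (s * Complex.I) * Complex.I) s := isConstSpeedLoop_exp.hasDerivAt s
  have hE' : HasDerivAt (fun s : ℝ => Complex.exp (-(s * Complex.I)))
      (Complex.exp (-(s * Complex.I)) * -Complex.I) s := by
    simpa using (((hasDerivAt_id (s : ℂ)).mul_const Complex.I).neg.cexp).comp_ofReal
  have hd := ((hE.const_mul (a 1)).const_add (a 0)).add (hE'.const_mul (a (-1)))
  have hs := h.hasDerivAt s
  rw [hz] at hs
  have hz's := hs.unique hd
  have hspeed := h.speed s
  rw [hz's] at hspeed
  rw [← hspeed, ← mul_one ‖_ - _‖, ← Complex.norm_I, ← norm_mul]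
  congr 1
  ring

end Fourier

end

/-- **Proposition (distance-distribution rigidity of the circle).**
If a twice continuously differentiable regular simple closed plane curve has the same
global distance distribution as the unit circle, then it is a unit circle: the image of
the unit circle under a Euclidean isometry of `ℝ²`. -/
theorem circle_rigid_for_globalDistrib
    (γ : ℝ → EucPlane) (L : ℝ) (hγ : IsClosedC2Curve γ L)
    (hH : ∀ r : ℝ, 0 ≤ r →
      curveGlobalDistrib (Set.range γ) r =
      curveGlobalDistrib (Metric.sphere (0 : EucPlane) 1) r) :
    ∃ T : EucPlane ≃ᵢ EucPlane,
      T '' (Metric.sphere (0 : EucPlane) 1) = Set.range γ := by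
  obtain ⟨β, β', c, hβ, hrange⟩ := hγ.exists_isConstSpeedLoop
  set e : ℂ ≃ₗᵢ[ℝ] EucPlane := Complex.orthonormalBasisOneI.repr
  have hS := isConstSpeedLoop_exp.comp_isometry e
  have hcircle : Set.range (e ∘ fun s : ℝ => Complex.exp (s * Complex.I)) =
      Metric.sphere (0 : EucPlane) 1 := by
    rw [Set.range_comp, range_exp_mul_I, e.image_sphere, map_zero]
  rw [← hrange, ← hcircle] at hH
  have hc : c = 1 := le_antisymm
    (hβ.speed_le_of_curveGlobalDistrib_le hS fun r hr => (hH r hr).ge)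
    (hS.speed_le_of_curveGlobalDistrib_le hβ fun r hr => (hH r hr).le)
  subst hc
  have hz := hβ.comp_isometry e.symm
  have hmoment := hβ.integral_dist_sq_eq hS hH
  have hmoment' := hz.integral_dist_sq
  simp only [Function.comp_apply, LinearIsometryEquiv.dist_map] at hmoment hmoment'
  rw [hmoment', isConstSpeedLoop_exp.integral_dist_sq, integral_exp_anglesMeasure] at hmoment
  simp only [Complex.norm_exp_ofReal_mul_I, one_pow, integral_const, probReal_univ, one_smul,
    norm_zero, ne_eq, OfNat.ofNat_ne_zero, not_false_eq_true, zero_pow, sub_zero] at hmoment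
  obtain ⟨w, hw⟩ := hz.exists_range_eq_sphere
    (by simp only [Function.comp_apply]; linarith)
  refine ⟨IsometryEquiv.addRight (e w), ?_⟩
  rw [← hrange, IsometryEquiv.image_sphere]
  have : β = e ∘ (e.symm ∘ β) := by
    ext1 s
    simp
  rw [this, Set.range_comp, hw, e.image_sphere]
  simp
end

section
/- Let X₁ and X₂ be twice continuously differentiable simple closed plane curves, each regarded as an mm-space with Euclidean distance and normalized arclength measure, and assume each is generic in the sense that its signed curvature function has only isolated zeros. If there exists a twice continuously differentiable measure-preserving map φ: X₁ → X₂ such that h_{X₁}(x,r) = h_{X₂}(φ(x),r) for all x ∈ X₁ and all r ≥ 0, then X₁ is isometric to X₂ (a Euclidean isometry of ℝ² maps X₁ onto X₂). -/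
open MeasureTheory Metric ENNReal

/-- The signed curvature of a unit-speed plane curve `γ`:
`κ(t) = x'(t)·y''(t) − y'(t)·x''(t)`. -/
noncomputable def signedCurv (γ : ℝ → EucPlane) (t : ℝ) : ℝ :=
  deriv γ t 0 * deriv (deriv γ) t 1 - deriv γ t 1 * deriv (deriv γ) t 0

/-- A unit-speed curve which is injective on a set preserves one-dimensional measure there. -/
lemma hausdorffMeasure_image_of_unit_speed {γ : ℝ → EucPlane} (hd : Differentiable ℝ γ)
    (hu : ∀ t, ‖deriv γ t‖ = 1) {E : Set ℝ} (hE : MeasurableSet E) (hinj : Set.InjOn γ E) :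
    (Measure.hausdorffMeasure 1 : Measure EucPlane) (γ '' E) = volume E := by
  apply le_antisymm
  · have hl : LipschitzWith 1 γ := lipschitzWith_of_nnnorm_deriv_le hd (fun x => by
      rw [← NNReal.coe_le_coe]; simp [hu x])
    have := hl.hausdorffMeasure_image_le (zero_le_one) E
    simpa [hausdorffMeasure_real] using this
  · have key : ∀ K : NNReal, 1 < K → volume E ≤
        K * (Measure.hausdorffMeasure 1 : Measure EucPlane) (γ '' E) := by
      intro K hK
      have hK0 : (0 : ℝ) < K := lt_trans one_pos (by exact_mod_cast hK)
      set ε : NNReal := 1 - K⁻¹ with hε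
      have hK1 : K⁻¹ < 1 := inv_lt_one_of_one_lt₀ hK
      have hε0 : ε ≠ 0 := (tsub_pos_of_lt hK1).ne'
      have hεr : (ε : ℝ) = 1 - (K : ℝ)⁻¹ := by
        rw [hε, NNReal.coe_sub hK1.le]; simp
      obtain ⟨t, A, hdisj, hmeas, hcov, happ, hA⟩ :=
        exists_partition_approximatesLinearOn_of_hasFDerivWithinAt γ E (fderiv ℝ γ)
          (fun x _ => (hd x).hasFDerivAt.hasFDerivWithinAt) (fun _ => ε) (fun _ => hε0)
      have hpiece : ∀ n, volume (E ∩ t n) ≤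
          K * (Measure.hausdorffMeasure 1 : Measure EucPlane) (γ '' (E ∩ t n)) := by
        intro n
        have hanti : ∀ u ∈ E ∩ t n, ∀ v ∈ E ∩ t n, dist u v ≤ K * dist (γ u) (γ v) := by
          intro u hu' v hv'
          obtain ⟨y, -, hy⟩ := hA ⟨u, hu'.1⟩ n
          have h1 := happ n u hu' v hv'
          have h2 : ‖A n (u - v)‖ = ‖u - v‖ := by
            have : A n (u - v) = (u - v) • deriv γ y := by
              rw [hy, ← fderiv_apply_one_eq_deriv, ← map_smul]; simp
            rw [this, norm_smul, hu, mul_one]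
          have h3 : ‖A n (u - v)‖ ≤ ‖γ u - γ v‖ + ‖γ u - γ v - A n (u - v)‖ := by
            have := norm_sub_le (γ u - γ v) (γ u - γ v - A n (u - v))
            simpa using this
          rw [dist_eq_norm, dist_eq_norm]
          rw [h2] at h3
          have h4 : ‖u - v‖ * (K : ℝ)⁻¹ ≤ ‖γ u - γ v‖ := by
            rw [hεr] at h1
            linarith
          calc ‖u - v‖ = K * (‖u - v‖ * (K : ℝ)⁻¹) := by field_simp
            _ ≤ _ := by gcongr
        have hinj' : Set.InjOn γ (E ∩ t n) := hinj.mono Set.inter_subset_left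
        have hlip : LipschitzOnWith K (Function.invFunOn γ (E ∩ t n)) (γ '' (E ∩ t n)) := by
          apply LipschitzOnWith.of_dist_le_mul
          rintro _ ⟨u, hu', rfl⟩ _ ⟨v, hv', rfl⟩
          rw [hinj'.leftInvOn_invFunOn hu', hinj'.leftInvOn_invFunOn hv']
          exact hanti u hu' v hv'
        have := hlip.hausdorffMeasure_image_le (zero_le_one)
        rw [hinj'.leftInvOn_invFunOn.image_image] at this
        simpa [hausdorffMeasure_real] using this
      have hEu : E = ⋃ n, E ∩ t n := by
        rw [← Set.inter_iUnion]; exact (Set.inter_eq_left.2 hcov).symm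
      have hm : ∀ n, MeasurableSet (γ '' (E ∩ t n)) := fun n =>
        (hE.inter (hmeas n)).image_of_continuousOn_injOn hd.continuous.continuousOn
          (hinj.mono Set.inter_subset_left)
      have hdj : Pairwise (Function.onFun Disjoint fun n => γ '' (E ∩ t n)) := by
        intro i j hij
        have hij' := hdisj hij
        refine Set.disjoint_left.2 ?_
        rintro _ ⟨u, hu', rfl⟩ ⟨v, hv', hvu⟩
        have : v = u := hinj hv'.1 hu'.1 hvu
        subst this
        exact Set.disjoint_left.1 hij' hu'.2 hv'.2
      calc volume E = volume (⋃ n, E ∩ t n) := by rw [← hEu]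
        _ ≤ ∑' n, volume (E ∩ t n) := measure_iUnion_le _
        _ ≤ ∑' n, K * (Measure.hausdorffMeasure 1 : Measure EucPlane) (γ '' (E ∩ t n)) :=
            ENNReal.tsum_le_tsum hpiece
        _ = K * (Measure.hausdorffMeasure 1 : Measure EucPlane) (γ '' E) := by
            rw [ENNReal.tsum_mul_left, ← measure_iUnion hdj hm, ← Set.image_iUnion, ← hEu]
    set m := (Measure.hausdorffMeasure 1 : Measure EucPlane) (γ '' E)
    by_cases hm : m = ⊤
    · rw [hm]; exact le_top
    have ht : Filter.Tendsto (fun K : NNReal => (K : ℝ≥0∞) * m) (nhdsWithin 1 (Set.Ioi 1))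
        (nhds (((1 : NNReal) : ℝ≥0∞) * m)) := by
      apply ENNReal.Tendsto.mul_const _ (Or.inr hm)
      exact (ENNReal.continuous_coe.tendsto 1).mono_left nhdsWithin_le_nhds
    rw [ENNReal.coe_one, one_mul] at ht
    exact ge_of_tendsto ht (by filter_upwards [self_mem_nhdsWithin] with K hK using key K hK)

lemma injOn_Ico_of_periodic {γ : ℝ → EucPlane} {L : ℝ} (hL : 0 < L)
    (hp : ∀ t, γ (t + L) = γ t) (hinj : Set.InjOn γ (Set.Ico 0 L)) (a : ℝ) :
    Set.InjOn γ (Set.Ico a (a + L)) := by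
  intro u hu v hv huv
  have hper : Function.Periodic γ L := hp
  have h1 : γ (toIcoMod hL 0 u) = γ (toIcoMod hL 0 v) := by
    rw [toIcoMod, toIcoMod, hper.sub_zsmul_eq, hper.sub_zsmul_eq, huv]
  have h2 := hinj (by simpa using toIcoMod_mem_Ico hL 0 u)
    (by simpa using toIcoMod_mem_Ico hL 0 v) h1
  have h4 := (toIcoMod_inj (c := a) hL).2 ((toIcoMod_inj hL).1 h2)
  rwa [(toIcoMod_eq_self hL).2 hu, (toIcoMod_eq_self hL).2 hv] at h4

/-- A twice continuously differentiable simple closed curve parametrized by arclength. -/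
structure IsUnitSpeedCurve (γ : ℝ → EucPlane) (L : ℝ) : Prop where
  pos : 0 < L
  contDiff : ContDiff ℝ 2 γ
  periodic : Function.Periodic γ L
  injOn : ∀ a, Set.InjOn γ (Set.Ico a (a + L))
  unit : ∀ t, ‖deriv γ t‖ = 1

lemma IsClosedC2Curve.isUnitSpeedCurve {γ : ℝ → EucPlane} {L : ℝ} (h : IsClosedC2Curve γ L)
    (hu : ∀ t, ‖deriv γ t‖ = 1) : IsUnitSpeedCurve γ L :=
  ⟨h.1, h.2.1, h.2.2.1, injOn_Ico_of_periodic h.1 h.2.2.1 h.2.2.2.1, hu⟩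

/-- The length of the part of the curve within distance `r` of `γ t`. -/
noncomputable def ballVol (γ : ℝ → EucPlane) (L t r : ℝ) : ℝ≥0∞ :=
  volume {s | s ∈ Set.Ico (-(L / 2)) (L / 2) ∧ dist (γ (t + s)) (γ t) ≤ r}

namespace IsUnitSpeedCurve

variable {γ : ℝ → EucPlane} {L : ℝ}

lemma differentiable (h : IsUnitSpeedCurve γ L) : Differentiable ℝ γ :=
  h.contDiff.differentiable (by norm_num)

lemma lipschitz (h : IsUnitSpeedCurve γ L) : LipschitzWith 1 γ :=
  lipschitzWith_of_nnnorm_deriv_le h.differentiable (fun x => by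
    rw [← NNReal.coe_le_coe]; simp [h.unit x])

lemma range_eq (h : IsUnitSpeedCurve γ L) (a : ℝ) :
    Set.range γ = γ '' Set.Ico a (a + L) := by
  refine Set.Subset.antisymm ?_ (Set.image_subset_range _ _)
  rintro _ ⟨t, rfl⟩
  obtain ⟨y, hy, hty⟩ := h.periodic.exists_mem_Ico h.pos t a
  exact ⟨y, hy, hty.symm⟩

lemma hausdorffMeasure_inter (h : IsUnitSpeedCurve γ L) (a : ℝ) {B : Set EucPlane}
    (hB : MeasurableSet B) :
    (Measure.hausdorffMeasure 1 : Measure EucPlane) (B ∩ Set.range γ) =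
      volume (γ ⁻¹' B ∩ Set.Ico a (a + L)) := by
  rw [h.range_eq a, ← Set.image_preimage_inter]
  exact hausdorffMeasure_image_of_unit_speed h.differentiable h.unit
    ((h.differentiable.continuous.measurable hB).inter measurableSet_Ico)
    ((h.injOn a).mono Set.inter_subset_right)

lemma curveMeasure_eq (h : IsUnitSpeedCurve γ L) (a : ℝ) :
    curveMeasure (Set.range γ) =
      (ENNReal.ofReal L)⁻¹ • Measure.map γ (volume.restrict (Set.Ico a (a + L))) := by
  have h1 := h.hausdorffMeasure_inter a MeasurableSet.univ
  rw [Set.univ_inter, Set.preimage_univ, Set.univ_inter, Real.volume_Ico] at h1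
  rw [curveMeasure, h1, add_sub_cancel_left]
  congr 1
  ext B hB
  have hγ := h.differentiable.continuous.measurable
  rw [Measure.restrict_apply hB, Measure.map_apply hγ hB, Measure.restrict_apply (hγ hB)]
  exact h.hausdorffMeasure_inter a hB

lemma curveMeasure_apply (h : IsUnitSpeedCurve γ L) (a : ℝ) {B : Set EucPlane}
    (hB : MeasurableSet B) :
    curveMeasure (Set.range γ) B =
      (ENNReal.ofReal L)⁻¹ * volume (γ ⁻¹' B ∩ Set.Ico a (a + L)) := by
  have hγ := h.differentiable.continuous.measurable
  rw [h.curveMeasure_eq a, Measure.smul_apply, Measure.map_apply hγ hB,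
    Measure.restrict_apply (hγ hB), smul_eq_mul]

lemma curveMeasure_closedBall (h : IsUnitSpeedCurve γ L) (t r : ℝ) :
    curveMeasure (Set.range γ) (closedBall (γ t) r) =
      (ENNReal.ofReal L)⁻¹ * ballVol γ L t r := by
  rw [h.curveMeasure_apply (t - L / 2) measurableSet_closedBall, ballVol,
    ← measure_preimage_add volume t]
  congr 2
  ext s
  simp only [Set.mem_preimage, Set.mem_inter_iff, mem_closedBall, Set.mem_Ico, Set.mem_ofPred_eq]
  constructor
  · rintro ⟨h1, h2, h3⟩; exact ⟨⟨by linarith, by linarith⟩, h1⟩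
  · rintro ⟨⟨h2, h3⟩, h1⟩; exact ⟨h1, by linarith, by linarith⟩

lemma dist_le (h : IsUnitSpeedCurve γ L) (t s : ℝ) : dist (γ (t + s)) (γ t) ≤ |s| := by
  have := h.lipschitz.dist_le_mul (t + s) t
  simpa [Real.dist_eq] using this

/-- Points of the curve which are close in the plane are close along the curve. -/
lemma exists_radius (h : IsUnitSpeedCurve γ L) {δ : ℝ} (hδ : 0 < δ) :
    ∃ r₀ > 0, ∀ t, ∀ s ∈ Set.Ico (-(L / 2)) (L / 2),
      dist (γ (t + s)) (γ t) ≤ r₀ → |s| < δ := by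
  have hL := h.pos
  have hc := h.differentiable.continuous
  set C : Set (ℝ × ℝ) := Set.Icc 0 L ×ˢ (Set.Icc (-(L / 2)) (L / 2) ∩ {s | δ ≤ |s|})
  have hCc : IsCompact C := isCompact_Icc.prod
    (isCompact_Icc.inter_right (isClosed_le continuous_const continuous_abs))
  have hf : Continuous fun p : ℝ × ℝ => dist (γ (p.1 + p.2)) (γ p.1) := by fun_prop
  have hpos : ∀ p ∈ C, 0 < dist (γ (p.1 + p.2)) (γ p.1) := by
    rintro ⟨t, s⟩ ⟨ht, hs, hsδ⟩
    simp only [Set.mem_ofPred_eq, Set.mem_Icc] at hs hsδ ⊢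
    rw [dist_pos]
    intro heq
    have := h.injOn (t + min s 0) (x₁ := t + s) (x₂ := t)
      (by constructor <;> rcases le_total s 0 with h0 | h0 <;> simp [h0] <;> linarith)
      (by constructor <;> rcases le_total s 0 with h0 | h0 <;> simp [h0] <;> linarith) heq
    have : s = 0 := by linarith
    subst this
    simp at hsδ; linarith
  obtain ⟨r₀, hr₀, hr⟩ : ∃ r₀ > 0, ∀ p ∈ C, r₀ < dist (γ (p.1 + p.2)) (γ p.1) := by
    rcases C.eq_empty_or_nonempty with he | hne
    · exact ⟨1, one_pos, by simp [he]⟩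
    · obtain ⟨p, hp, hmin⟩ := hCc.exists_isMinOn hne hf.continuousOn
      exact ⟨_, half_pos (hpos p hp), fun q hq =>
        lt_of_lt_of_le (half_lt_self (hpos p hp)) (hmin hq)⟩
  refine ⟨r₀, hr₀, fun t s hs hd => ?_⟩
  by_contra! hcon
  have hmod := toIcoMod_mem_Ico hL 0 t
  have h1 := hr (toIcoMod hL 0 t, s)
    ⟨⟨hmod.1, by simpa using hmod.2.le⟩, ⟨hs.1, hs.2.le⟩, hcon⟩
  have h2 : γ (toIcoMod hL 0 t) = γ t := by rw [toIcoMod, h.periodic.sub_zsmul_eq]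
  have h3 : γ (toIcoMod hL 0 t + s) = γ (t + s) := by
    rw [toIcoMod, sub_add_eq_add_sub, h.periodic.sub_zsmul_eq]
  rw [h2, h3] at h1
  linarith

end IsUnitSpeedCurve

/-- If near one point a curve has longer chords than another curve of the same length, then some
small ball contains strictly less of its length. -/
lemma exists_ballVol_lt {γ₁ γ₂ : ℝ → EucPlane} {L : ℝ} (h₁ : IsUnitSpeedCurve γ₁ L)
    (h₂ : IsUnitSpeedCurve γ₂ L) {t₁ t₂ δ r₀ s₀ : ℝ}
    (hr₀ : ∀ s ∈ Set.Ico (-(L / 2)) (L / 2), dist (γ₁ (t₁ + s)) (γ₁ t₁) ≤ r₀ → |s| < δ)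
    (hle : ∀ s, |s| < δ → dist (γ₂ (t₂ + s)) (γ₂ t₂) ≤ dist (γ₁ (t₁ + s)) (γ₁ t₁))
    (hs₀ : |s₀| ≤ r₀) (hs₀L : |s₀| < L / 2)
    (hlt : dist (γ₂ (t₂ + s₀)) (γ₂ t₂) < dist (γ₁ (t₁ + s₀)) (γ₁ t₁)) :
    ∃ r ≥ 0, ballVol γ₁ L t₁ r < ballVol γ₂ L t₂ r := by
  obtain ⟨r, hr1, hr2⟩ := exists_between hlt
  have hc₁ := h₁.differentiable.continuous
  have hc₂ := h₂.differentiable.continuous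
  refine ⟨r, dist_nonneg.trans hr1.le, ?_⟩
  set A₁ := {s | s ∈ Set.Ico (-(L / 2)) (L / 2) ∧ dist (γ₁ (t₁ + s)) (γ₁ t₁) ≤ r}
  set A₂ := {s | s ∈ Set.Ico (-(L / 2)) (L / 2) ∧ dist (γ₂ (t₂ + s)) (γ₂ t₂) ≤ r}
  set U := Set.Ioo (-(L / 2)) (L / 2) ∩ ({s | dist (γ₂ (t₂ + s)) (γ₂ t₂) < r} ∩
    {s | r < dist (γ₁ (t₁ + s)) (γ₁ t₁)}) with hU
  have hUo : IsOpen U := isOpen_Ioo.inter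
    ((isOpen_lt (by fun_prop) (by fun_prop)).inter (isOpen_lt (by fun_prop) (by fun_prop)))
  have hUpos : 0 < volume U :=
    hUo.measure_pos volume ⟨s₀, abs_lt.1 hs₀L, hr1, hr2⟩
  have hA₁fin : volume A₁ ≠ ⊤ := by
    refine ne_top_of_le_ne_top ?_ (measure_mono (fun s hs => hs.1))
    simp
  have hdisj : Disjoint A₁ U := Set.disjoint_left.2 fun s hs hs' => not_lt.2 hs.2 hs'.2.2
  have hsub : A₁ ∪ U ⊆ A₂ := by
    rintro s (hs | hs)
    · refine ⟨hs.1, (hle s (hr₀ s hs.1 ?_)).trans hs.2⟩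
      exact hs.2.trans (hr2.le.trans ((h₁.dist_le _ _).trans hs₀))
    · exact ⟨Set.Ioo_subset_Ico_self hs.1, (le_of_lt hs.2.1)⟩
  calc volume A₁ < volume A₁ + volume U := ENNReal.lt_add_right hA₁fin hUpos.ne'
    _ = volume (A₁ ∪ U) := (measure_union hdisj hUo.measurableSet).symm
    _ ≤ volume A₂ := measure_mono hsub

namespace IsUnitSpeedCurve

variable {γ : ℝ → EucPlane} {L : ℝ}

lemma le_ballVol (h : IsUnitSpeedCurve γ L) (t : ℝ) {r : ℝ} (hr : r < L / 2) :
    ENNReal.ofReal (2 * r) ≤ ballVol γ L t r := by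
  have : volume (Set.Icc (-r) r) = ENNReal.ofReal (2 * r) := by
    rw [Real.volume_Icc]; ring_nf
  rw [← this]
  refine measure_mono fun s hs => ⟨⟨by linarith [hs.1], by linarith [hs.2]⟩, ?_⟩
  exact (h.dist_le t s).trans (abs_le.2 hs)

lemma ballVol_le (h : IsUnitSpeedCurve γ L) (t : ℝ) {K : ℝ} (hK : 1 < K) :
    ∃ r₁ > 0, ∀ r ≤ r₁, ballVol γ L t r ≤ ENNReal.ofReal (2 * (K * r)) := by
  have hK0 : 0 < K := by linarith
  have hε : 0 < 1 - K⁻¹ := by linarith [inv_lt_one_of_one_lt₀ hK]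
  have hd := (h.differentiable t).hasDerivAt
  have hev := (hasDerivAt_iff_isLittleO_nhds_zero.1 hd).def hε
  obtain ⟨δ, hδ, hδ'⟩ := Metric.eventually_nhds_iff.1 hev
  obtain ⟨r₀, hr₀, hr⟩ := h.exists_radius hδ
  refine ⟨r₀, hr₀, fun r hrr => ?_⟩
  have hvol : volume (Set.Icc (-(K * r)) (K * r)) = ENNReal.ofReal (2 * (K * r)) := by
    rw [Real.volume_Icc]; ring_nf
  rw [← hvol]
  refine measure_mono fun s hs => ?_
  rw [Set.mem_Icc, ← abs_le]
  have h1 := hδ' (by simpa using hr t s hs.1 (hs.2.trans hrr))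
  have h2 : ‖s • deriv γ t‖ = |s| := by rw [norm_smul, h.unit, mul_one, Real.norm_eq_abs]
  have h3 : ‖s • deriv γ t‖ ≤ ‖γ (t + s) - γ t‖ + ‖γ (t + s) - γ t - s • deriv γ t‖ := by
    have := norm_sub_le (γ (t + s) - γ t) (γ (t + s) - γ t - s • deriv γ t)
    simpa using this
  have h4 := hs.2
  rw [dist_eq_norm] at h4
  rw [h2] at h3
  rw [Real.norm_eq_abs] at h1
  have h5 : K⁻¹ * |s| ≤ r := by linarith
  calc |s| = K * (K⁻¹ * |s|) := by field_simp
    _ ≤ K * r := by gcongr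

end IsUnitSpeedCurve

lemma length_le_of_ballVol_eq {γ₁ γ₂ : ℝ → EucPlane} {L₁ L₂ : ℝ} (h₁ : IsUnitSpeedCurve γ₁ L₁)
    (h₂ : IsUnitSpeedCurve γ₂ L₂) {t₁ t₂ : ℝ}
    (heq : ∀ r, 0 ≤ r → (ENNReal.ofReal L₁)⁻¹ * ballVol γ₁ L₁ t₁ r =
      (ENNReal.ofReal L₂)⁻¹ * ballVol γ₂ L₂ t₂ r) : L₂ ≤ L₁ := by
  have hL₁ := h₁.pos
  have hL₂ := h₂.pos
  refine le_of_forall_gt_imp_ge_of_dense fun a ha => ?_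
  have hK : 1 < a / L₁ := (one_lt_div hL₁).2 ha
  obtain ⟨r₁, hr₁, hr⟩ := h₂.ballVol_le t₂ hK
  obtain ⟨r, hr0, hr2⟩ := exists_between (lt_min hr₁ (half_pos hL₁))
  have e1 := h₁.le_ballVol t₁ (hr2.trans_le (min_le_right _ _))
  have e2 := hr r (hr2.le.trans (min_le_left _ _))
  have e3 : (ENNReal.ofReal L₁)⁻¹ * ENNReal.ofReal (2 * r) ≤
      (ENNReal.ofReal L₂)⁻¹ * ENNReal.ofReal (2 * (a / L₁ * r)) :=
    (mul_le_mul_right e1 _).trans ((heq r hr0.le).le.trans (mul_le_mul_right e2 _))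
  rw [← ENNReal.ofReal_inv_of_pos hL₁, ← ENNReal.ofReal_inv_of_pos hL₂,
    ← ENNReal.ofReal_mul (by positivity), ← ENNReal.ofReal_mul (by positivity),
    ENNReal.ofReal_le_ofReal_iff (by have := ha.le; positivity)] at e3
  have e4 : L₁⁻¹ * (2 * r) * (L₁ * L₂) = 2 * r * L₂ := by field_simp
  have e5 : L₂⁻¹ * (2 * (a / L₁ * r)) * (L₁ * L₂) = 2 * r * a := by field_simp
  have e6 := mul_le_mul_of_nonneg_right e3 (mul_pos hL₁ hL₂).le
  rw [e4, e5] at e6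
  exact le_of_mul_le_mul_left e6 (by positivity)

namespace IsUnitSpeedCurve

variable {γ : ℝ → EucPlane} {L : ℝ}

lemma hasDerivAt_apply (h : IsUnitSpeedCurve γ L) (i : Fin 2) (t : ℝ) :
    HasDerivAt (fun t => γ t i) (deriv γ t i) t :=
  (EuclideanSpace.proj (𝕜 := ℝ) i).hasFDerivAt.comp_hasDerivAt t (h.differentiable t).hasDerivAt

lemma hasDerivAt_deriv (h : IsUnitSpeedCurve γ L) (t : ℝ) :
    HasDerivAt (deriv γ) (deriv (deriv γ) t) t := by
  have : ContDiff ℝ 1 (deriv γ) := h.contDiff.deriv' (n := 1)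
  exact (this.differentiable (by norm_num) t).hasDerivAt

lemma hasDerivAt_deriv_apply' (h : IsUnitSpeedCurve γ L) (i : Fin 2) (t : ℝ) :
    HasDerivAt (fun t => deriv γ t i) (deriv (deriv γ) t i) t :=
  (EuclideanSpace.proj (𝕜 := ℝ) i).hasFDerivAt.comp_hasDerivAt t (h.hasDerivAt_deriv t)

lemma continuous_signedCurv (h : IsUnitSpeedCurve γ L) : Continuous (signedCurv γ) := by
  have h1 : ContDiff ℝ 1 (deriv γ) := h.contDiff.deriv' (n := 1)
  have h2 : Continuous (deriv (deriv γ)) := h1.continuous_deriv (by norm_num)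
  have h3 := h1.continuous
  unfold signedCurv
  fun_prop

lemma sq_add_sq (h : IsUnitSpeedCurve γ L) (t : ℝ) :
    deriv γ t 0 ^ 2 + deriv γ t 1 ^ 2 = 1 := by
  have := EuclideanSpace.norm_sq_eq (deriv γ t)
  rw [h.unit, Fin.sum_univ_two] at this
  simpa using this.symm

lemma inner_eq_zero (h : IsUnitSpeedCurve γ L) (t : ℝ) :
    deriv γ t 0 * deriv (deriv γ) t 0 + deriv γ t 1 * deriv (deriv γ) t 1 = 0 := by
  have h1 := ((h.hasDerivAt_deriv_apply' 0 t).pow 2).add ((h.hasDerivAt_deriv_apply' 1 t).pow 2)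
  have h2 : HasDerivAt ((fun t => deriv γ t 0) ^ 2 + (fun t => deriv γ t 1) ^ 2) 0 t := by
    have : (fun t => deriv γ t 0) ^ 2 + (fun t => deriv γ t 1) ^ 2 = fun _ => (1 : ℝ) := by
      ext t; exact h.sq_add_sq t
    rw [this]; exact hasDerivAt_const _ _
  have := h1.unique h2
  simp at this
  linarith

/-- The first Frenet equation, first coordinate. -/
lemma hasDerivAt_deriv_zero (h : IsUnitSpeedCurve γ L) (t : ℝ) :
    HasDerivAt (fun t => deriv γ t 0) (-(signedCurv γ t * deriv γ t 1)) t := by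
  convert h.hasDerivAt_deriv_apply' 0 t using 1
  rw [signedCurv]
  linear_combination (-deriv γ t 0) * h.inner_eq_zero t + deriv (deriv γ) t 0 * h.sq_add_sq t

/-- The first Frenet equation, second coordinate. -/
lemma hasDerivAt_deriv_one (h : IsUnitSpeedCurve γ L) (t : ℝ) :
    HasDerivAt (fun t => deriv γ t 1) (signedCurv γ t * deriv γ t 0) t := by
  convert h.hasDerivAt_deriv_apply' 1 t using 1
  rw [signedCurv]
  linear_combination (-deriv γ t 1) * h.inner_eq_zero t + deriv (deriv γ) t 1 * h.sq_add_sq t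

end IsUnitSpeedCurve

lemma eqOn_of_hasDerivAt_eq {f g f' g' : ℝ → ℝ} {S : Set ℝ} (hS : Convex ℝ S)
    (hf : ∀ t, HasDerivAt f (f' t) t) (hg : ∀ t, HasDerivAt g (g' t) t)
    (heq : ∀ t ∈ S, f' t = g' t) {t₀ : ℝ} (ht₀ : t₀ ∈ S) (h₀ : f t₀ = g t₀) :
    Set.EqOn f g S := by
  intro t ht
  have := hS.norm_image_sub_le_of_norm_hasDerivWithin_le (f := f - g) (f' := fun t => f' t - g' t)
    (C := 0) (fun x _ => ((hf x).sub (hg x)).hasDerivWithinAt) (fun x hx => by simp [heq x hx])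
    ht₀ ht
  simp [h₀, sub_eq_zero] at this
  exact this

/-- The Euclidean motion taking the orthonormal frame with origin `z` and first axis `(p, q)`
to the standard one. -/
lemma exists_frame_isometry (z : EucPlane) {p q : ℝ} (hpq : p ^ 2 + q ^ 2 = 1) :
    ∃ e : EucPlane ≃ᵢ EucPlane, ∀ w, e w =
      !₂[p * (w 0 - z 0) + q * (w 1 - z 1), -q * (w 0 - z 0) + p * (w 1 - z 1)] := by
  refine ⟨IsometryEquiv.mk' (fun w => !₂[p * (w 0 - z 0) + q * (w 1 - z 1),
    -q * (w 0 - z 0) + p * (w 1 - z 1)])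
    (fun v => !₂[z 0 + p * v 0 - q * v 1, z 1 + q * v 0 + p * v 1]) ?_ ?_, fun w => rfl⟩
  · intro v
    ext i
    fin_cases i
    · simp
      linear_combination v 0 * hpq
    · simp
      linear_combination v 1 * hpq
  · refine Isometry.of_dist_eq fun u v => ?_
    rw [EuclideanSpace.dist_eq, EuclideanSpace.dist_eq]
    congr 1
    simp only [Fin.sum_univ_two, Real.dist_eq, sq_abs]
    simp
    linear_combination ((u 0 - v 0) ^ 2 + (u 1 - v 1) ^ 2) * hpq

/-- A curve seen in the moving frame at the parameter `t₀`: `A` is the angle of the tangent and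
`X`, `Y` are the coordinates. -/
structure IsFrameAt (γ : ℝ → EucPlane) (t₀ : ℝ) (A X Y : ℝ → ℝ) : Prop where
  angle_zero : A t₀ = 0
  fst_zero : X t₀ = 0
  snd_zero : Y t₀ = 0
  hasDerivAt_angle : ∀ t, HasDerivAt A (signedCurv γ t) t
  hasDerivAt_fst : ∀ t, HasDerivAt X (Real.cos (A t)) t
  hasDerivAt_snd : ∀ t, HasDerivAt Y (Real.sin (A t)) t
  exists_isometry : ∃ e : EucPlane ≃ᵢ EucPlane, ∀ t, e (γ t) = !₂[X t, Y t]

lemma IsFrameAt.dist_sq {γ : ℝ → EucPlane} {t₀ : ℝ} {A X Y : ℝ → ℝ} (h : IsFrameAt γ t₀ A X Y)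
    (u v : ℝ) : dist (γ u) (γ v) ^ 2 = (X u - X v) ^ 2 + (Y u - Y v) ^ 2 := by
  obtain ⟨e, he⟩ := h.exists_isometry
  rw [← e.dist_eq, he, he, EuclideanSpace.dist_eq, Real.sq_sqrt (by positivity)]
  simp [Real.dist_eq, sq_abs]

lemma IsUnitSpeedCurve.exists_isFrameAt {γ : ℝ → EucPlane} {L : ℝ} (h : IsUnitSpeedCurve γ L)
    (t₀ : ℝ) : ∃ A X Y, IsFrameAt γ t₀ A X Y := by
  set p := deriv γ t₀ 0 with hp
  set q := deriv γ t₀ 1 with hq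
  have hpq : p ^ 2 + q ^ 2 = 1 := h.sq_add_sq t₀
  set A : ℝ → ℝ := fun t => ∫ s in t₀..t, signedCurv γ s with hA
  have hA0 : A t₀ = 0 := by simp [hA]
  have hA' : ∀ t, HasDerivAt A (signedCurv γ t) t := fun t =>
    intervalIntegral.integral_hasDerivAt_right (h.continuous_signedCurv.intervalIntegrable _ _)
      (h.continuous_signedCurv.stronglyMeasurableAtFilter _ _)
      h.continuous_signedCurv.continuousAt
  set c : ℝ → ℝ := fun t => p * deriv γ t 0 + q * deriv γ t 1 with hc
  set d : ℝ → ℝ := fun t => -q * deriv γ t 0 + p * deriv γ t 1 with hd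
  have hc' : ∀ t, HasDerivAt c (-(signedCurv γ t * d t)) t := fun t => by
    refine HasDerivAt.congr_deriv (((h.hasDerivAt_deriv_zero t).const_mul p).add
      ((h.hasDerivAt_deriv_one t).const_mul q)) ?_
    ring
  have hd' : ∀ t, HasDerivAt d (signedCurv γ t * c t) t := fun t => by
    refine HasDerivAt.congr_deriv (((h.hasDerivAt_deriv_zero t).const_mul (-q)).add
      ((h.hasDerivAt_deriv_one t).const_mul p)) ?_
    ring
  have e1 : ∀ t, c t * Real.cos (A t) + d t * Real.sin (A t) = 1 := fun t =>
    eqOn_of_hasDerivAt_eq (g := fun _ => 1) (t₀ := t₀) convex_univ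
      (fun t => ((hc' t).mul (hA' t).cos).add ((hd' t).mul (hA' t).sin))
      (fun t => hasDerivAt_const _ _) (fun t _ => by ring) (Set.mem_univ _)
      (by simp [hA0, hc, ← hp, ← hq]; linarith) (Set.mem_univ t)
  have e2 : ∀ t, d t * Real.cos (A t) - c t * Real.sin (A t) = 0 := fun t =>
    eqOn_of_hasDerivAt_eq (g := fun _ => 0) (t₀ := t₀) convex_univ
      (fun t => ((hd' t).mul (hA' t).cos).sub ((hc' t).mul (hA' t).sin))
      (fun t => hasDerivAt_const _ _) (fun t _ => by ring) (Set.mem_univ _)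
      (by simp [hA0, hd, ← hp, ← hq]; ring) (Set.mem_univ t)
  have hcos : ∀ t, c t = Real.cos (A t) := fun t => by
    linear_combination Real.cos (A t) * e1 t - Real.sin (A t) * e2 t -
      c t * Real.sin_sq_add_cos_sq (A t)
  have hsin : ∀ t, d t = Real.sin (A t) := fun t => by
    linear_combination Real.sin (A t) * e1 t + Real.cos (A t) * e2 t -
      d t * Real.sin_sq_add_cos_sq (A t)
  obtain ⟨e, he⟩ := exists_frame_isometry (γ t₀) hpq
  refine ⟨A, fun t => p * (γ t 0 - γ t₀ 0) + q * (γ t 1 - γ t₀ 1),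
    fun t => -q * (γ t 0 - γ t₀ 0) + p * (γ t 1 - γ t₀ 1), hA0, by simp, by simp, hA',
    fun t => ?_, fun t => ?_, e, fun t => he _⟩
  · rw [← hcos]
    exact (((h.hasDerivAt_apply 0 t).sub_const _).const_mul p).add
      (((h.hasDerivAt_apply 1 t).sub_const _).const_mul q)
  · rw [← hsin]
    exact (((h.hasDerivAt_apply 0 t).sub_const _).const_mul (-q)).add
      (((h.hasDerivAt_apply 1 t).sub_const _).const_mul p)

open Filter Topology in
/-- The fourth-order expansion of the squared chord length. -/
lemma IsUnitSpeedCurve.tendsto_chord {γ : ℝ → EucPlane} {L : ℝ} (h : IsUnitSpeedCurve γ L)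
    (t : ℝ) : Tendsto (fun s => (dist (γ (t + s)) (γ t) ^ 2 - s ^ 2) / s ^ 4) (𝓝[≠] 0)
      (𝓝 (-(signedCurv γ t ^ 2) / 12)) := by
  obtain ⟨A, X, Y, hF⟩ := h.exists_isFrameAt t
  set a : ℝ → ℝ := fun s => A (t + s)
  set x : ℝ → ℝ := fun s => X (t + s) with hx
  set y : ℝ → ℝ := fun s => Y (t + s) with hy
  set k : ℝ → ℝ := fun s => signedCurv γ (t + s) with hk
  have hx0 : x 0 = 0 := by simp [hx, hF.fst_zero]
  have hy0 : y 0 = 0 := by simp [hy, hF.snd_zero]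
  have ha' : ∀ s, HasDerivAt a (k s) s := fun s => (hF.hasDerivAt_angle (t + s)).comp_const_add t s
  have hx' : ∀ s, HasDerivAt x (Real.cos (a s)) s :=
    fun s => (hF.hasDerivAt_fst (t + s)).comp_const_add t s
  have hy' : ∀ s, HasDerivAt y (Real.sin (a s)) s :=
    fun s => (hF.hasDerivAt_snd (t + s)).comp_const_add t s
  set V : ℝ → ℝ := fun s => x s * Real.cos (a s) + y s * Real.sin (a s) with hV
  set W : ℝ → ℝ := fun s => y s * Real.cos (a s) - x s * Real.sin (a s) with hW
  have hV0 : V 0 = 0 := by simp [hV, hx0, hy0]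
  have hW0 : W 0 = 0 := by simp [hW, hx0, hy0]
  have hV' : ∀ s, HasDerivAt V (1 + k s * W s) s := fun s => by
    refine HasDerivAt.congr_deriv (((hx' s).mul (ha' s).cos).add ((hy' s).mul (ha' s).sin)) ?_
    linear_combination Real.sin_sq_add_cos_sq (a s)
  have hW' : ∀ s, HasDerivAt W (-(k s * V s)) s := fun s => by
    refine HasDerivAt.congr_deriv (((hy' s).mul (ha' s).cos).sub ((hx' s).mul (ha' s).sin)) ?_
    ring
  have hVc : Continuous V := continuous_iff_continuousAt.2 fun s => (hV' s).continuousAt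
  have hWc : Continuous W := continuous_iff_continuousAt.2 fun s => (hW' s).continuousAt
  have hkc : Continuous k := h.continuous_signedCurv.comp (by fun_prop)
  have hk0 : k 0 = signedCurv γ t := by simp [hk]
  have lim0 : ∀ {f : ℝ → ℝ}, Continuous f → f 0 = 0 → Tendsto f (𝓝[≠] 0) (𝓝 0) :=
    fun hf h0 => by
      have := (hf.tendsto 0).mono_left (nhdsWithin_le_nhds (s := {0}ᶜ))
      rwa [h0] at this
  have hne : ∀ᶠ s : ℝ in 𝓝[≠] 0, s ≠ 0 := self_mem_nhdsWithin
  have l1 : Tendsto (fun s => V s / s) (𝓝[≠] 0) (𝓝 1) := by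
    have := hasDerivAt_iff_tendsto_slope_zero.1 (hV' 0)
    simpa [hV0, hW0, div_eq_inv_mul] using this
  have lk : Tendsto k (𝓝[≠] 0) (𝓝 (k 0)) := hkc.continuousWithinAt
  have l2 : Tendsto (fun s => W s / s ^ 2) (𝓝[≠] 0) (𝓝 (-(k 0) / 2)) := by
    refine HasDerivAt.lhopital_zero_nhdsNE (f' := fun s => -(k s * V s)) (g' := fun s => 2 * s)
      (Eventually.of_forall hW')
      (Eventually.of_forall fun s => by simpa using hasDerivAt_pow 2 s)
      (hne.mono fun s hs => by simpa using hs) (lim0 hWc hW0) (lim0 (by fun_prop) (by simp)) ?_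
    have := (lk.mul l1).const_mul (-(1 / 2))
    refine (this.congr' (hne.mono fun s hs => ?_)).trans (by ring_nf; rfl)
    field_simp
  have l3 : Tendsto (fun s => (2 * V s - 2 * s) / (4 * s ^ 3)) (𝓝[≠] 0) (𝓝 (-(k 0 ^ 2) / 12)) := by
    refine HasDerivAt.lhopital_zero_nhdsNE (f' := fun s => 2 * (1 + k s * W s) - 2)
      (g' := fun s => 12 * s ^ 2)
      (Eventually.of_forall fun s => by
        exact (((hV' s).const_mul 2).sub ((hasDerivAt_id s).const_mul 2)).congr_deriv (by ring))
      (Eventually.of_forall fun s => by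
        exact ((hasDerivAt_pow 3 s).const_mul 4).congr_deriv (by norm_num; ring))
      (hne.mono fun s hs => by positivity) (lim0 (by fun_prop) (by simp [hV0]))
      (lim0 (by fun_prop) (by simp)) ?_
    have := (lk.mul l2).const_mul (1 / 6)
    refine (this.congr' (hne.mono fun s hs => ?_)).trans (by ring_nf; rfl)
    field_simp
    ring
  have hdist : ∀ s, dist (γ (t + s)) (γ t) ^ 2 = x s ^ 2 + y s ^ 2 := fun s => by
    rw [hF.dist_sq, hF.fst_zero, hF.snd_zero]; simp [hx, hy]
  simp_rw [hdist, ← hk0]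
  have hxc : Continuous x := continuous_iff_continuousAt.2 fun s => (hx' s).continuousAt
  have hyc : Continuous y := continuous_iff_continuousAt.2 fun s => (hy' s).continuousAt
  refine HasDerivAt.lhopital_zero_nhdsNE (f' := fun s => 2 * V s - 2 * s)
      (g' := fun s => 4 * s ^ 3)
      (Eventually.of_forall fun s => by
        refine HasDerivAt.congr_deriv
          ((((hx' s).pow 2).add ((hy' s).pow 2)).sub (hasDerivAt_pow 2 s)) ?_
        simp only [hV]; norm_num; ring)
      (Eventually.of_forall fun s => by simpa using hasDerivAt_pow 4 s)
      (hne.mono fun s hs => by positivity) (lim0 (by fun_prop) (by simp [hx0, hy0]))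
      (lim0 (by fun_prop) (by simp)) l3

open Filter Topology in
/-- The lengths of small balls determine the absolute value of the curvature. -/
lemma sq_signedCurv_le {γ₁ γ₂ : ℝ → EucPlane} {L : ℝ} (h₁ : IsUnitSpeedCurve γ₁ L)
    (h₂ : IsUnitSpeedCurve γ₂ L) {t₁ t₂ : ℝ}
    (heq : ∀ r, 0 ≤ r → ballVol γ₁ L t₁ r = ballVol γ₂ L t₂ r) :
    signedCurv γ₂ t₂ ^ 2 ≤ signedCurv γ₁ t₁ ^ 2 := by
  by_contra! hlt
  obtain ⟨m, hm1, hm2⟩ := exists_between hlt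
  have e1 := (h₁.tendsto_chord t₁).eventually (lt_mem_nhds (a := -m / 12)
    (b := -(signedCurv γ₁ t₁ ^ 2) / 12) (by linarith))
  have e2 := (h₂.tendsto_chord t₂).eventually (gt_mem_nhds
    (show -(signedCurv γ₂ t₂ ^ 2) / 12 < -m / 12 by linarith))
  obtain ⟨δ, hδ, hδ'⟩ := Metric.eventually_nhds_iff.1 (eventually_nhdsWithin_iff.1 (e1.and e2))
  have hcmp : ∀ s, |s| < δ → s ≠ 0 →
      dist (γ₂ (t₂ + s)) (γ₂ t₂) < dist (γ₁ (t₁ + s)) (γ₁ t₁) := by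
    intro s hs hs0
    obtain ⟨f1, f2⟩ := hδ' (by simpa using hs) hs0
    have f3 := f2.trans f1
    rw [div_lt_div_iff_of_pos_right (by positivity)] at f3
    exact lt_of_pow_lt_pow_left₀ 2 dist_nonneg (by linarith)
  obtain ⟨r₀, hr₀, hr⟩ := h₁.exists_radius hδ
  have hL := h₁.pos
  obtain ⟨s₀, hs0, hs1⟩ := exists_between (lt_min hr₀ (lt_min hδ (half_pos hL)))
  rw [lt_min_iff, lt_min_iff] at hs1
  have habs : |s₀| = s₀ := abs_of_pos hs0
  obtain ⟨r, hr0, hlt'⟩ := exists_ballVol_lt h₁ h₂ (hr t₁)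
    (fun s hs => by
      rcases eq_or_ne s 0 with rfl | h0
      · simp
      · exact (hcmp s hs h0).le)
    (habs.trans_le hs1.1.le) (habs.trans_lt hs1.2.2) (hcmp s₀ (habs.trans_lt hs1.2.1) hs0.ne')
  exact hlt'.ne (heq r hr0)

lemma sq_signedCurv_eq {γ₁ γ₂ : ℝ → EucPlane} {L : ℝ} (h₁ : IsUnitSpeedCurve γ₁ L)
    (h₂ : IsUnitSpeedCurve γ₂ L) {t₁ t₂ : ℝ}
    (heq : ∀ r, 0 ≤ r → ballVol γ₁ L t₁ r = ballVol γ₂ L t₂ r) :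
    signedCurv γ₁ t₁ ^ 2 = signedCurv γ₂ t₂ ^ 2 :=
  le_antisymm (sq_signedCurv_le h₂ h₁ fun r hr => (heq r hr).symm) (sq_signedCurv_le h₁ h₂ heq)

lemma IsFrameAt.eqOn {γ₁ γ₂ : ℝ → EucPlane} {t₀ τ : ℝ} {A₁ X₁ Y₁ A₂ X₂ Y₂ : ℝ → ℝ}
    (h₁ : IsFrameAt γ₁ t₀ A₁ X₁ Y₁) (h₂ : IsFrameAt γ₂ t₀ A₂ X₂ Y₂) {S : Set ℝ}
    (hS : Convex ℝ S) (ht₀ : t₀ ∈ S) (hτ : τ = 1 ∨ τ = -1)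
    (hκ : ∀ t ∈ S, signedCurv γ₂ t = τ * signedCurv γ₁ t) :
    (∀ t ∈ S, X₂ t = X₁ t) ∧ ∀ t ∈ S, Y₂ t = τ * Y₁ t := by
  have hA : Set.EqOn A₂ (fun t => τ * A₁ t) S :=
    eqOn_of_hasDerivAt_eq hS h₂.hasDerivAt_angle (fun t => (h₁.hasDerivAt_angle t).const_mul τ)
      hκ ht₀ (by simp [h₁.angle_zero, h₂.angle_zero])
  constructor
  · refine eqOn_of_hasDerivAt_eq hS h₂.hasDerivAt_fst h₁.hasDerivAt_fst (fun t ht => ?_) ht₀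
      (by simp [h₁.fst_zero, h₂.fst_zero])
    rw [hA ht]
    rcases hτ with rfl | rfl <;> simp
  · refine eqOn_of_hasDerivAt_eq hS h₂.hasDerivAt_snd
      (fun t => (h₁.hasDerivAt_snd t).const_mul τ) (fun t ht => ?_) ht₀
      (by simp [h₁.snd_zero, h₂.snd_zero])
    rw [hA ht]
    rcases hτ with rfl | rfl <;> simp

/-- The signed curvature determines a curve up to a Euclidean isometry. -/
lemma exists_isometryEquiv_of_signedCurv {γ₁ γ₂ : ℝ → EucPlane} {L₁ L₂ τ : ℝ}
    (h₁ : IsUnitSpeedCurve γ₁ L₁) (h₂ : IsUnitSpeedCurve γ₂ L₂) (hτ : τ = 1 ∨ τ = -1)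
    (hκ : ∀ t, signedCurv γ₂ t = τ * signedCurv γ₁ t) :
    ∃ T : EucPlane ≃ᵢ EucPlane, T '' Set.range γ₁ = Set.range γ₂ := by
  obtain ⟨A₁, X₁, Y₁, hF₁⟩ := h₁.exists_isFrameAt 0
  obtain ⟨A₂, X₂, Y₂, hF₂⟩ := h₂.exists_isFrameAt 0
  obtain ⟨hX, hY⟩ := hF₁.eqOn hF₂ convex_univ (Set.mem_univ _) hτ fun t _ => hκ t
  obtain ⟨e₁, he₁⟩ := hF₁.exists_isometry
  obtain ⟨e₂, he₂⟩ := hF₂.exists_isometry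
  have hττ : τ * τ = 1 := by rcases hτ with rfl | rfl <;> norm_num
  let R : EucPlane ≃ᵢ EucPlane := IsometryEquiv.mk' (fun w => !₂[w 0, τ * w 1])
    (fun w => !₂[w 0, τ * w 1])
    (fun v => by
      ext i
      fin_cases i
      · simp
      · simp [← mul_assoc, hττ])
    (Isometry.of_dist_eq fun u v => by
      rw [EuclideanSpace.dist_eq, EuclideanSpace.dist_eq]
      congr 1
      simp only [Fin.sum_univ_two, Real.dist_eq, sq_abs]
      simp
      linear_combination (u 1 - v 1) ^ 2 * hττ)
  refine ⟨(e₁.trans R).trans e₂.symm, ?_⟩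
  rw [← Set.range_comp]
  congr 1
  ext1 t
  show e₂.symm (R (e₁ (γ₁ t))) = γ₂ t
  rw [IsometryEquiv.symm_apply_eq, he₁, he₂, hX t trivial, hY t trivial]
  rfl

lemma exists_ballVol_lt_of_far_side {γ₁ γ₂ : ℝ → EucPlane} {L t₀ η : ℝ}
    (h₁ : IsUnitSpeedCurve γ₁ L) (h₂ : IsUnitSpeedCurve γ₂ L) (hη : 0 < η)
    (hnear : ∀ u ∈ Set.Ioo (t₀ - η) t₀, ∀ v ∈ Set.Ioc (t₀ - η) t₀,
      dist (γ₂ v) (γ₂ u) = dist (γ₁ v) (γ₁ u))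
    (hfar : ∀ u ∈ Set.Ioo (t₀ - η) t₀, ∀ v ∈ Set.Ioo t₀ (t₀ + η),
      dist (γ₂ v) (γ₂ u) < dist (γ₁ v) (γ₁ u)) :
    ∃ t, ∃ r ≥ 0, ballVol γ₁ L t r < ballVol γ₂ L t r := by
  obtain ⟨r₀, hr₀, hr⟩ := h₁.exists_radius (half_pos hη)
  have hL := h₁.pos
  obtain ⟨a, ha0, ha1⟩ := exists_between
    (lt_min (half_pos hr₀) (lt_min (a := 0) (b := η / 4) (by positivity)
      (c := L / 4) (by positivity)))
  rw [lt_min_iff, lt_min_iff] at ha1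
  obtain ⟨ha1, ha2, ha3⟩ := ha1
  have habs : |2 * a| = 2 * a := abs_of_pos (by positivity)
  refine ⟨t₀ - a, exists_ballVol_lt h₁ h₂ (s₀ := 2 * a) (hr (t₀ - a)) (fun s hs => ?_) ?_ ?_ ?_⟩
  · rw [abs_lt] at hs
    rcases le_or_gt (t₀ - a + s) t₀ with hle | hgt
    · exact (hnear _ ⟨by linarith, by linarith⟩ _ ⟨by linarith, hle⟩).le
    · exact (hfar _ ⟨by linarith, by linarith⟩ _ ⟨hgt, by linarith⟩).le
  · linarith
  · linarith
  · exact hfar _ ⟨by linarith, by linarith⟩ _ ⟨by linarith, by linarith⟩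

lemma eq_mul_or_of_ne_zero {f g : ℝ → ℝ} {S : Set ℝ} (hS : IsPreconnected S)
    (hf : Continuous f) (hg : Continuous g) (hsq : ∀ t, f t ^ 2 = g t ^ 2)
    (hne : ∀ t ∈ S, f t ≠ 0) : ∃ τ : ℝ, (τ = 1 ∨ τ = -1) ∧ ∀ t ∈ S, g t = τ * f t := by
  rcases hS.eq_or_eq_neg_of_sq_eq hg.continuousOn hf.continuousOn (fun t _ => (hsq t).symm)
    (fun {t} ht => hne t ht) with h | h
  · exact ⟨1, Or.inl rfl, fun t ht => by simpa using h ht⟩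
  · exact ⟨-1, Or.inr rfl, fun t ht => by simpa using h ht⟩

lemma frame_snd_ne_zero {γ : ℝ → EucPlane} {t₀ v : ℝ} {A X Y : ℝ → ℝ} (h : IsFrameAt γ t₀ A X Y)
    (hv : v ≠ t₀) (hA : ∀ t ∈ Set.uIcc t₀ v, |A t| < Real.pi)
    (hκ : ∀ t ∈ Set.uIoo t₀ v, signedCurv γ t ≠ 0) : Y v ≠ 0 := by
  have rolle : ∀ (f f' : ℝ → ℝ), (∀ t, HasDerivAt f (f' t) t) → f t₀ = 0 → ∀ w ≠ t₀, f w = 0 →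
      ∃ c ∈ Set.uIoo t₀ w, f' c = 0 := by
    intro f f' hf h0 w hw h1
    rcases lt_or_gt_of_ne hw with hlt | hgt
    · obtain ⟨c, hc, hc'⟩ := exists_hasDerivAt_eq_zero hlt
        (fun t _ => (hf t).continuousAt.continuousWithinAt) (h1.trans h0.symm) fun t _ => hf t
      exact ⟨c, by rwa [Set.uIoo_of_ge hlt.le], hc'⟩
    · obtain ⟨c, hc, hc'⟩ := exists_hasDerivAt_eq_zero hgt
        (fun t _ => (hf t).continuousAt.continuousWithinAt) (h0.trans h1.symm) fun t _ => hf t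
      exact ⟨c, by rwa [Set.uIoo_of_le hgt.le], hc'⟩
  intro hY
  obtain ⟨c, hc, hc0⟩ := rolle Y _ h.hasDerivAt_snd h.snd_zero v hv hY
  have hcA := abs_lt.1 (hA c (Set.uIoo_subset_uIcc_self hc))
  have hct : c ≠ t₀ := by
    rintro rfl
    simp at hc
  have hAc : A c = 0 := (Real.sin_eq_zero_iff_of_lt_of_lt hcA.1 hcA.2).1 hc0
  obtain ⟨d, hd, hd0⟩ := rolle A _ h.hasDerivAt_angle h.angle_zero c hct hAc
  refine hκ d ?_ hd0
  rcases lt_or_gt_of_ne hv with hlt | hgt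
  · rw [Set.uIoo_of_ge hlt.le] at hc ⊢
    rw [Set.uIoo_of_ge hc.2.le] at hd
    exact ⟨hc.1.trans hd.1, hd.2⟩
  · rw [Set.uIoo_of_le hgt.le] at hc ⊢
    rw [Set.uIoo_of_le hc.1.le] at hd
    exact ⟨hd.1, hd.2.trans hc.2⟩

open Filter Topology in
/-- At an isolated zero of the curvature, the lengths of small balls determine whether the
curvature changes sign. -/
lemma exists_sign_of_signedCurv_eq_zero {γ₁ γ₂ : ℝ → EucPlane} {L t₀ : ℝ}
    (h₁ : IsUnitSpeedCurve γ₁ L) (h₂ : IsUnitSpeedCurve γ₂ L)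
    (hsq : ∀ t, signedCurv γ₁ t ^ 2 = signedCurv γ₂ t ^ 2)
    (hball : ∀ t r, 0 ≤ r → ballVol γ₁ L t r = ballVol γ₂ L t r)
    (ht₀ : signedCurv γ₁ t₀ = 0)
    (hiso : ∃ ε > 0, ∀ s, s ≠ t₀ → |s - t₀| < ε → signedCurv γ₁ s ≠ 0) :
    ∃ τ : ℝ, (τ = 1 ∨ τ = -1) ∧ ∀ᶠ t in 𝓝 t₀, signedCurv γ₂ t = τ * signedCurv γ₁ t := by
  obtain ⟨A₁, X₁, Y₁, hF₁⟩ := h₁.exists_isFrameAt t₀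
  obtain ⟨A₂, X₂, Y₂, hF₂⟩ := h₂.exists_isFrameAt t₀
  obtain ⟨ε, hε, hε'⟩ := hiso
  have hAc : ∀ᶠ t in 𝓝 t₀, |A₁ t| < Real.pi := by
    have : Tendsto (fun t => |A₁ t|) (𝓝 t₀) (𝓝 0) := by
      have := (hF₁.hasDerivAt_angle t₀).continuousAt.abs
      simpa [ContinuousAt, hF₁.angle_zero] using this
    exact this.eventually (gt_mem_nhds Real.pi_pos)
  obtain ⟨ε', hε'0, hε'1⟩ := Metric.eventually_nhds_iff.1 hAc
  set η := min ε ε'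
  have hη0 : 0 < η := lt_min hε hε'0
  have hne : ∀ t, t ≠ t₀ → |t - t₀| < η → signedCurv γ₁ t ≠ 0 := fun t h0 h1 =>
    hε' t h0 (h1.trans_le (min_le_left _ _))
  have hA : ∀ t, |t - t₀| < η → |A₁ t| < Real.pi := fun t ht =>
    hε'1 (by rw [Real.dist_eq]; exact ht.trans_le (min_le_right _ _))
  have hc₁ := h₁.continuous_signedCurv
  have hc₂ := h₂.continuous_signedCurv
  have ht₀' : signedCurv γ₂ t₀ = 0 := by
    have := hsq t₀
    rw [ht₀] at this
    exact pow_eq_zero_iff (two_ne_zero) |>.1 (by simpa using this.symm)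
  obtain ⟨τl, hτl, hl⟩ := eq_mul_or_of_ne_zero (S := Set.Ioo (t₀ - η) t₀) isPreconnected_Ioo
    hc₁ hc₂ hsq (fun t ht => hne t ht.2.ne (abs_lt.2 ⟨by linarith [ht.1], by linarith [ht.2]⟩))
  obtain ⟨τr, hτr, hr⟩ := eq_mul_or_of_ne_zero (S := Set.Ioo t₀ (t₀ + η)) isPreconnected_Ioo
    hc₁ hc₂ hsq (fun t ht => hne t ht.1.ne' (abs_lt.2 ⟨by linarith [ht.1], by linarith [ht.2]⟩))
  have hl' : ∀ t ∈ Set.Ioc (t₀ - η) t₀, signedCurv γ₂ t = τl * signedCurv γ₁ t := fun t ht => by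
    rcases ht.2.eq_or_lt with rfl | hlt
    · simp [ht₀, ht₀']
    · exact hl t ⟨ht.1, hlt⟩
  have hr' : ∀ t ∈ Set.Ico t₀ (t₀ + η), signedCurv γ₂ t = τr * signedCurv γ₁ t := fun t ht => by
    rcases ht.1.eq_or_lt with rfl | hlt
    · simp [ht₀, ht₀']
    · exact hr t ⟨hlt, ht.2⟩
  by_cases hτ : τl = τr
  · refine ⟨τl, hτl, ?_⟩
    filter_upwards [Ioo_mem_nhds (show t₀ - η < t₀ by linarith) (show t₀ < t₀ + η by linarith)]
      with t ht
    rcases le_total t t₀ with h | h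
    · exact hl' t ⟨ht.1, h⟩
    · rw [hτ]; exact hr' t ⟨h, ht.2⟩
  exfalso
  have hττ : τl * τr = -1 := by
    rcases hτl with rfl | rfl <;> rcases hτr with rfl | rfl <;> simp_all
  have hτl2 : τl ^ 2 = 1 := by rcases hτl with rfl | rfl <;> norm_num
  have hτr2 : τr ^ 2 = 1 := by rcases hτr with rfl | rfl <;> norm_num
  obtain ⟨hXl, hYl⟩ := hF₁.eqOn hF₂ (convex_Ioc _ _) ⟨by linarith, le_refl _⟩ hτl hl'
  obtain ⟨hXr, hYr⟩ := hF₁.eqOn hF₂ (convex_Ico _ _) ⟨le_refl _, by linarith⟩ hτr hr'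
  have hYc : Continuous Y₁ :=
    continuous_iff_continuousAt.2 fun t => (hF₁.hasDerivAt_snd t).continuousAt
  have hY0 : ∀ v, v ≠ t₀ → |v - t₀| < η → Y₁ v ≠ 0 := by
    intro v hv hv'
    have hsub : ∀ t ∈ Set.uIcc t₀ v, |t - t₀| < η := fun t ht =>
      (Set.abs_sub_left_of_mem_uIcc ht).trans_lt hv'
    refine frame_snd_ne_zero hF₁ hv (fun t ht => hA t (hsub t ht)) fun t ht => ?_
    refine hne t ?_ (hsub t (Set.uIoo_subset_uIcc_self ht))
    rintro rfl
    simp at ht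
  obtain ⟨σl, hσl, hYl0⟩ := eq_mul_or_of_ne_zero (S := Set.Ioo (t₀ - η) t₀) isPreconnected_Ioo
    hYc hYc.abs (fun t => (sq_abs _).symm)
    (fun t ht => hY0 t ht.2.ne (abs_lt.2 ⟨by linarith [ht.1], by linarith [ht.2]⟩))
  obtain ⟨σr, hσr, hYr0⟩ := eq_mul_or_of_ne_zero (S := Set.Ioo t₀ (t₀ + η)) isPreconnected_Ioo
    hYc hYc.abs (fun t => (sq_abs _).symm)
    (fun t ht => hY0 t ht.1.ne' (abs_lt.2 ⟨by linarith [ht.1], by linarith [ht.2]⟩))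
  have hprod : ∀ u ∈ Set.Ioo (t₀ - η) t₀, ∀ v ∈ Set.Ioo t₀ (t₀ + η),
      0 < σl * σr * (Y₁ u * Y₁ v) := by
    intro u hu v hv
    have e1 : 0 < |Y₁ u| := abs_pos.2
      (hY0 u hu.2.ne (abs_lt.2 ⟨by linarith [hu.1], by linarith [hu.2]⟩))
    have e2 : 0 < |Y₁ v| := abs_pos.2
      (hY0 v hv.1.ne' (abs_lt.2 ⟨by linarith [hv.1], by linarith [hv.2]⟩))
    have := mul_pos e1 e2
    rw [hYl0 u hu, hYr0 v hv] at this
    linarith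
  have hnear : ∀ u ∈ Set.Ioo (t₀ - η) t₀, ∀ v ∈ Set.Ioc (t₀ - η) t₀,
      dist (γ₂ v) (γ₂ u) = dist (γ₁ v) (γ₁ u) := by
    intro u hu v hv
    rw [← sq_eq_sq₀ dist_nonneg dist_nonneg, hF₁.dist_sq, hF₂.dist_sq, hXl v hv,
      hXl u (Set.Ioo_subset_Ioc_self hu), hYl v hv, hYl u (Set.Ioo_subset_Ioc_self hu)]
    linear_combination (Y₁ v - Y₁ u) ^ 2 * hτl2
  have hfar : ∀ u ∈ Set.Ioo (t₀ - η) t₀, ∀ v ∈ Set.Ioo t₀ (t₀ + η),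
      dist (γ₂ v) (γ₂ u) ^ 2 = dist (γ₁ v) (γ₁ u) ^ 2 + 4 * (Y₁ u * Y₁ v) := by
    intro u hu v hv
    rw [hF₁.dist_sq, hF₂.dist_sq, hXr v (Set.Ioo_subset_Ico_self hv),
      hXl u (Set.Ioo_subset_Ioc_self hu), hYr v (Set.Ioo_subset_Ico_self hv),
      hYl u (Set.Ioo_subset_Ioc_self hu)]
    linear_combination Y₁ v ^ 2 * hτr2 + Y₁ u ^ 2 * hτl2 - 2 * Y₁ u * Y₁ v * hττ
  have hσ : σl * σr = 1 ∨ σl * σr = -1 := by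
    rcases hσl with rfl | rfl <;> rcases hσr with rfl | rfl <;> norm_num
  rcases hσ with hσ | hσ
  · obtain ⟨t, r, hr0, hlt⟩ := exists_ballVol_lt_of_far_side h₂ h₁ hη0
      (fun u hu v hv => (hnear u hu v hv).symm) (fun u hu v hv => by
        have := hprod u hu v hv
        rw [hσ] at this
        exact lt_of_pow_lt_pow_left₀ 2 dist_nonneg (by linarith [hfar u hu v hv]))
    exact hlt.ne (hball t r hr0).symm
  · obtain ⟨t, r, hr0, hlt⟩ := exists_ballVol_lt_of_far_side h₁ h₂ hη0
      hnear (fun u hu v hv => by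
        have := hprod u hu v hv
        rw [hσ] at this
        exact lt_of_pow_lt_pow_left₀ 2 dist_nonneg (by linarith [hfar u hu v hv]))
    exact hlt.ne (hball t r hr0)

open Filter Topology in
lemma exists_sign_signedCurv {γ₁ γ₂ : ℝ → EucPlane} {L : ℝ}
    (h₁ : IsUnitSpeedCurve γ₁ L) (h₂ : IsUnitSpeedCurve γ₂ L)
    (hsq : ∀ t, signedCurv γ₁ t ^ 2 = signedCurv γ₂ t ^ 2)
    (hball : ∀ t r, 0 ≤ r → ballVol γ₁ L t r = ballVol γ₂ L t r)
    (hiso : ∀ t, signedCurv γ₁ t = 0 →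
      ∃ ε > 0, ∀ s, s ≠ t → |s - t| < ε → signedCurv γ₁ s ≠ 0) :
    ∃ τ : ℝ, (τ = 1 ∨ τ = -1) ∧ ∀ t, signedCurv γ₂ t = τ * signedCurv γ₁ t := by
  have hc₁ := h₁.continuous_signedCurv
  have hc₂ := h₂.continuous_signedCurv
  have hloc : ∀ t₀, ∃ τ : ℝ, (τ = 1 ∨ τ = -1) ∧
      ∀ᶠ t in 𝓝 t₀, signedCurv γ₂ t = τ * signedCurv γ₁ t := by
    intro t₀
    by_cases ht₀ : signedCurv γ₁ t₀ = 0
    · exact exists_sign_of_signedCurv_eq_zero h₁ h₂ hsq hball ht₀ (hiso t₀ ht₀)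
    · obtain ⟨δ, hδ, hδ'⟩ := Metric.eventually_nhds_iff_ball.1
        (hc₁.continuousAt.eventually_ne ht₀)
      obtain ⟨τ, hτ, h⟩ := eq_mul_or_of_ne_zero (convex_ball t₀ δ).isPreconnected hc₁ hc₂ hsq hδ'
      exact ⟨τ, hτ, Metric.eventually_nhds_iff_ball.2 ⟨δ, hδ, h⟩⟩
  have hfreq : ∀ t₀, ∃ᶠ t in 𝓝 t₀, signedCurv γ₁ t ≠ 0 := by
    intro t₀
    by_cases ht₀ : signedCurv γ₁ t₀ = 0
    · obtain ⟨ε, hε, hε'⟩ := hiso t₀ ht₀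
      have : ∀ᶠ t in 𝓝[≠] t₀, signedCurv γ₁ t ≠ 0 := eventually_nhdsWithin_iff.2
        (Metric.eventually_nhds_iff.2
          ⟨ε, hε, fun t ht ht' => hε' t ht' (by simpa [Real.dist_eq] using ht)⟩)
      exact this.frequently.filter_mono nhdsWithin_le_nhds
    · exact (hc₁.continuousAt.eventually_ne ht₀).frequently
  choose τ hτ hev using hloc
  have hlc : IsLocallyConstant τ := by
    rw [IsLocallyConstant.iff_eventually_eq]
    intro t₀
    filter_upwards [(hev t₀).eventually_nhds] with t ht
    obtain ⟨s, ⟨hs1, hs2⟩, hs3⟩ := ((ht.and (hev t)).and_frequently (hfreq t)).exists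
    exact (mul_right_cancel₀ hs3 (hs1.symm.trans hs2)).symm
  refine ⟨τ 0, hτ 0, fun t => ?_⟩
  rw [hlc.apply_eq_of_preconnectedSpace 0 t]
  exact (hev t).self_of_nhds

namespace IsUnitSpeedCurve

variable {γ : ℝ → EucPlane} {L : ℝ}

lemma isProbabilityMeasure_curveMeasure (h : IsUnitSpeedCurve γ L) :
    IsProbabilityMeasure (curveMeasure (Set.range γ)) := by
  refine ⟨?_⟩
  rw [h.curveMeasure_apply 0 MeasurableSet.univ, Set.preimage_univ, Set.univ_inter,
    Real.volume_Ico, zero_add, sub_zero]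
  exact ENNReal.inv_mul_cancel (ENNReal.ofReal_pos.2 h.pos).ne' ENNReal.ofReal_ne_top

lemma integrable_curveMeasure (h : IsUnitSpeedCurve γ L) {E : Type*} [NormedAddCommGroup E]
    {g : EucPlane → E} (hg : Continuous g) (hm : StronglyMeasurable g) :
    Integrable g (curveMeasure (Set.range γ)) := by
  have hγ := h.differentiable.continuous
  rw [h.curveMeasure_eq 0]
  refine Integrable.smul_measure ?_ (ENNReal.inv_ne_top.2 (ENNReal.ofReal_pos.2 h.pos).ne')
  rw [integrable_map_measure hm.aestronglyMeasurable hγ.measurable.aemeasurable]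
  exact ((hg.comp hγ).continuousOn.integrableOn_compact isCompact_Icc).mono_set
    Set.Ico_subset_Icc_self

lemma ae_mem_range (h : IsUnitSpeedCurve γ L) :
    ∀ᵐ x ∂(curveMeasure (Set.range γ)), x ∈ Set.range γ := by
  have hm : MeasurableSet (Set.range γ) := by
    rw [h.range_eq 0]
    exact measurableSet_Ico.image_of_continuousOn_injOn
      h.differentiable.continuous.continuousOn (h.injOn 0)
  exact (ae_restrict_mem hm).filter_mono (Measure.ae_mono' Measure.smul_absolutelyContinuous)

/-- Arcs of the curve have measure at most their length. -/
lemma volume_preimage_image_Icc_le (h : IsUnitSpeedCurve γ L) {s η : ℝ} (hη : η < L / 2) :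
    volume (γ ⁻¹' (γ '' Set.Icc (s - η) (s + η)) ∩ Set.Ico (s - L / 2) (s - L / 2 + L)) ≤
      ENNReal.ofReal (2 * η) := by
  have : γ ⁻¹' (γ '' Set.Icc (s - η) (s + η)) ∩ Set.Ico (s - L / 2) (s - L / 2 + L) ⊆
      Set.Icc (s - η) (s + η) := by
    rintro u ⟨⟨v, hv, hvu⟩, hu⟩
    have : v = u := h.injOn _ ⟨by linarith [hv.1], by linarith [hv.2]⟩ hu hvu
    exact this ▸ hv
  refine (measure_mono this).trans ?_
  rw [Real.volume_Icc]
  exact ENNReal.ofReal_le_ofReal (by linarith)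

end IsUnitSpeedCurve

/-- The mean squared distance from a point to a probability measure. -/
lemma integral_norm_sub_sq {μ : Measure EucPlane} [IsProbabilityMeasure μ]
    (hi : Integrable (fun y : EucPlane => y) μ)
    (hi2 : ∀ c : EucPlane, Integrable (fun y => ‖y - c‖ ^ 2) μ)
    (x : EucPlane) :
    ∫ y, ‖y - x‖ ^ 2 ∂μ = ‖x - ∫ y, y ∂μ‖ ^ 2 + ∫ y, ‖y - ∫ z, z ∂μ‖ ^ 2 ∂μ := by
  set c := ∫ y, y ∂μ with hc
  have hic : Integrable (fun y : EucPlane => y - c) μ := hi.sub (integrable_const c)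
  have h1 : ∀ y : EucPlane, ‖y - x‖ ^ 2 =
      ‖x - c‖ ^ 2 + (‖y - c‖ ^ 2 - 2 * inner ℝ (x - c) (y - c)) := by
    intro y
    have : y - x = (y - c) - (x - c) := by abel
    rw [this, norm_sub_sq_real, real_inner_comm]
    ring
  have h2 : ∫ y, inner ℝ (x - c) (y - c) ∂μ = 0 := by
    rw [integral_inner hic, integral_sub hi (integrable_const c), ← hc]
    simp
  have hinn : Integrable (fun y : EucPlane => 2 * inner ℝ (x - c) (y - c)) μ :=
    (hic.const_inner (x - c)).const_mul 2
  have hsub : Integrable (fun y => ‖y - c‖ ^ 2 - 2 * inner ℝ (x - c) (y - c)) μ :=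
    (hi2 c).sub hinn
  simp_rw [h1]
  rw [integral_add (integrable_const _) hsub, integral_sub (hi2 c) hinn,
    integral_const_mul, h2]
  simp

/-- A measure-preserving map which preserves the distribution of distances to each point
preserves the distance to the centroids. -/
lemma exists_center {γ₁ γ₂ : ℝ → EucPlane} {L₁ L₂ : ℝ}
    (h₁ : IsUnitSpeedCurve γ₁ L₁) (h₂ : IsUnitSpeedCurve γ₂ L₂)
    {φ : EucPlane → EucPlane} (hφ : Measurable φ)
    (hmp : Measure.map φ (curveMeasure (Set.range γ₁)) = curveMeasure (Set.range γ₂))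
    (hloc : ∀ x ∈ Set.range γ₁, ∀ r : ℝ, 0 ≤ r →
      curveMeasure (Set.range γ₁) (closedBall x r) =
      curveMeasure (Set.range γ₂) (closedBall (φ x) r)) :
    ∃ c₁ c₂ : EucPlane, ∀ x ∈ Set.range γ₁, ‖x - c₁‖ ^ 2 = ‖φ x - c₂‖ ^ 2 := by
  set μ₁ := curveMeasure (Set.range γ₁)
  set μ₂ := curveMeasure (Set.range γ₂)
  have hp₁ : IsProbabilityMeasure μ₁ := h₁.isProbabilityMeasure_curveMeasure
  have hp₂ : IsProbabilityMeasure μ₂ := h₂.isProbabilityMeasure_curveMeasure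
  have hcont : ∀ c : EucPlane, Continuous fun y => ‖y - c‖ ^ 2 := fun c => by fun_prop
  have hi₁ : ∀ c : EucPlane, Integrable (fun y => ‖y - c‖ ^ 2) μ₁ := fun c =>
    h₁.integrable_curveMeasure (hcont c) (hcont c).stronglyMeasurable
  have hi₂ : ∀ c : EucPlane, Integrable (fun y => ‖y - c‖ ^ 2) μ₂ := fun c =>
    h₂.integrable_curveMeasure (hcont c) (hcont c).stronglyMeasurable
  have hid₁ : Integrable (fun y : EucPlane => y) μ₁ :=
    h₁.integrable_curveMeasure continuous_id stronglyMeasurable_id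
  have hid₂ : Integrable (fun y : EucPlane => y) μ₂ :=
    h₂.integrable_curveMeasure continuous_id stronglyMeasurable_id
  have hG : ∀ x ∈ Set.range γ₁, ∫ y, ‖y - x‖ ^ 2 ∂μ₁ = ∫ y, ‖y - φ x‖ ^ 2 ∂μ₂ := by
    intro x hx
    have hd : ∀ c : EucPlane, Measurable fun y => dist y c := fun c => by fun_prop
    have hmap : Measure.map (fun y => dist y x) μ₁ = Measure.map (fun y => dist y (φ x)) μ₂ := by
      have : IsFiniteMeasure (Measure.map (fun y => dist y x) μ₁) := by infer_instance
      refine Measure.ext_of_Iic _ _ fun r => ?_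
      rw [Measure.map_apply (hd _) measurableSet_Iic, Measure.map_apply (hd _) measurableSet_Iic]
      change μ₁ (closedBall x r) = μ₂ (closedBall (φ x) r)
      rcases le_or_gt 0 r with hr | hr
      · exact hloc x hx r hr
      · rw [closedBall_eq_empty.2 hr, closedBall_eq_empty.2 hr, measure_empty, measure_empty]
    have hsq : StronglyMeasurable fun r : ℝ => r ^ 2 := (continuous_pow 2).stronglyMeasurable
    have e1 := integral_map (μ := μ₁) (hd x).aemeasurable hsq.aestronglyMeasurable
    have e2 := integral_map (μ := μ₂) (hd (φ x)).aemeasurable hsq.aestronglyMeasurable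
    rw [hmap, e2] at e1
    simpa only [dist_eq_norm] using e1.symm
  set c₁ := ∫ y, y ∂μ₁
  set c₂ := ∫ y, y ∂μ₂
  set V₁ := ∫ y, ‖y - c₁‖ ^ 2 ∂μ₁
  set V₂ := ∫ y, ‖y - c₂‖ ^ 2 ∂μ₂
  have hG' : ∀ x ∈ Set.range γ₁, ‖x - c₁‖ ^ 2 + V₁ = ‖φ x - c₂‖ ^ 2 + V₂ := fun x hx => by
    rw [← integral_norm_sub_sq hid₁ hi₁, ← integral_norm_sub_sq hid₂ hi₂, hG x hx]
  have hV : V₁ = V₂ := by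
    have e1 : ∫ x, (‖x - c₁‖ ^ 2 + V₁) ∂μ₁ = ∫ x, (‖φ x - c₂‖ ^ 2 + V₂) ∂μ₁ :=
      integral_congr_ae (h₁.ae_mem_range.mono hG')
    have e2 := integral_map (μ := μ₁) hφ.aemeasurable
      (f := fun y => ‖y - c₂‖ ^ 2 + V₂)
      ((hcont c₂).add continuous_const).stronglyMeasurable.aestronglyMeasurable
    rw [hmp] at e2
    rw [← e2, integral_add (hi₁ c₁) (integrable_const _),
      integral_add (hi₂ c₂) (integrable_const _)] at e1
    simp only [integral_const, probReal_univ, one_smul] at e1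
    change V₁ + V₁ = V₂ + V₂ at e1
    linarith
  exact ⟨c₁, c₂, fun x hx => by have := hG' x hx; linarith⟩

namespace IsUnitSpeedCurve

variable {γ : ℝ → EucPlane} {L : ℝ}

lemma exists_int_of_eq (h : IsUnitSpeedCurve γ L) {u v : ℝ} (huv : γ u = γ v) :
    ∃ n : ℤ, u = v + n * L := by
  have hL := h.pos
  have h1 : γ (toIcoMod hL 0 u) = γ (toIcoMod hL 0 v) := by
    rw [toIcoMod, toIcoMod, h.periodic.sub_zsmul_eq, h.periodic.sub_zsmul_eq, huv]
  have h2 := h.injOn 0 (toIcoMod_mem_Ico hL 0 u) (toIcoMod_mem_Ico hL 0 v) h1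
  refine ⟨toIcoDiv hL 0 u - toIcoDiv hL 0 v, ?_⟩
  have h3 := toIcoMod_add_toIcoDiv_zsmul hL 0 u
  have h4 := toIcoMod_add_toIcoDiv_zsmul hL 0 v
  rw [zsmul_eq_mul] at h3 h4
  push_cast
  linarith

/-- Reparametrization by an isometry of the line. -/
lemma comp_affine (h : IsUnitSpeedCurve γ L) {e : ℝ} (he : e = 1 ∨ e = -1) (c : ℝ) :
    IsUnitSpeedCurve (fun t => γ (e * t + c)) L := by
  have hd : ∀ t, HasDerivAt (fun t => γ (e * t + c)) (e • deriv γ (e * t + c)) t := fun t => by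
    have h1 : HasDerivAt (fun t => e * t + c) e t := by
      simpa using ((hasDerivAt_id t).const_mul e).add_const c
    exact (h.differentiable _).hasDerivAt.scomp t h1
  have hp : Function.Periodic (fun t => γ (e * t + c)) L := fun t => by
    rcases he with rfl | rfl
    · change γ (1 * (t + L) + c) = γ (1 * t + c)
      rw [← h.periodic (1 * t + c)]
      congr 1
      ring
    · change γ (-1 * (t + L) + c) = γ (-1 * t + c)
      rw [← h.periodic (-1 * (t + L) + c)]
      congr 1
      ring
  refine ⟨h.pos, ?_, hp, ?_, fun t => ?_⟩
  · exact h.contDiff.comp (by fun_prop)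
  · intro a u hu v hv huv
    obtain ⟨n, hn⟩ := h.exists_int_of_eq huv
    have h1 : |u - v| < L := abs_lt.2 ⟨by linarith [hu.1, hv.2], by linarith [hu.2, hv.1]⟩
    have h2 : |u - v| = |(n : ℝ)| * L := by
      rcases he with rfl | rfl
      · rw [show u - v = n * L by linarith, abs_mul, abs_of_pos h.pos]
      · rw [show u - v = -(n * L) by linarith, abs_neg, abs_mul, abs_of_pos h.pos]
    have h3 : |(n : ℝ)| < 1 := by
      have := h.pos
      by_contra! hge
      nlinarith
    have h4 : n = 0 := Int.abs_lt_one_iff.1 (by exact_mod_cast h3)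
    rw [h4] at h2
    simp only [Int.cast_zero, abs_zero, zero_mul, abs_eq_zero] at h2
    linarith
  · rw [(hd t).deriv, norm_smul, h.unit, mul_one]
    rcases he with rfl | rfl <;> simp

lemma range_comp_affine {e : ℝ} (he : e = 1 ∨ e = -1) (c : ℝ) :
    Set.range (fun t => γ (e * t + c)) = Set.range γ := by
  refine Set.Subset.antisymm (Set.range_subset_iff.2 fun t => ⟨_, rfl⟩)
    (Set.range_subset_iff.2 fun t => ⟨e * (t - c), congrArg γ ?_⟩)
  rcases he with rfl | rfl <;> ring

end IsUnitSpeedCurve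

lemma exists_sign_monotone {ψ : ℝ → ℝ} (hψ : Differentiable ℝ ψ) (hψ' : Continuous (deriv ψ))
    (hexp : ∀ t, 1 ≤ |deriv ψ t|) :
    ∃ e : ℝ, (e = 1 ∨ e = -1) ∧ Monotone fun t => e * ψ t - t := by
  obtain ⟨e, he, hee⟩ := eq_mul_or_of_ne_zero isPreconnected_univ hψ' hψ'.abs
    (fun t => (sq_abs _).symm) (fun t _ h0 => by
      have := hexp t
      rw [h0, abs_zero] at this
      linarith)
  have hd : ∀ t, HasDerivAt (fun t => e * ψ t - t) (e * deriv ψ t - 1) t := fun t =>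
    ((hψ t).hasDerivAt.const_mul e).sub (hasDerivAt_id t)
  refine ⟨e, he, monotone_of_deriv_nonneg (fun t => (hd t).differentiableAt) fun t => ?_⟩
  rw [(hd t).deriv, ← hee t trivial]
  exact sub_nonneg.2 (hexp t)

lemma surjective_of_one_le_abs_deriv {ψ : ℝ → ℝ} (hψ : Differentiable ℝ ψ)
    (hψ' : Continuous (deriv ψ)) (hexp : ∀ t, 1 ≤ |deriv ψ t|) : Function.Surjective ψ := by
  obtain ⟨e, he, hmono⟩ := exists_sign_monotone hψ hψ' hexp
  have hsurj : Function.Surjective fun t => e * ψ t := by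
    have hc : Continuous fun t => e * ψ t := continuous_const.mul hψ.continuous
    refine hc.surjective ?_ ?_
    · refine Filter.tendsto_atTop_mono' _ ?_
        (Filter.tendsto_atTop_add_const_right _ (e * ψ 0) Filter.tendsto_id)
      filter_upwards [Filter.eventually_ge_atTop 0] with t ht
      have := hmono ht
      simp only [sub_zero, id_eq] at this ⊢
      linarith
    · refine Filter.tendsto_atBot_mono' _ ?_
        (Filter.tendsto_atBot_add_const_right _ (e * ψ 0) Filter.tendsto_id)
      filter_upwards [Filter.eventually_le_atBot 0] with t ht
      have := hmono ht
      simp only [sub_zero, id_eq] at this ⊢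
      linarith
  intro s
  obtain ⟨t, ht⟩ := hsurj (e * s)
  exact ⟨t, mul_left_cancel₀ (by rcases he with rfl | rfl <;> norm_num) ht⟩

/-- The reparametrization `ψ` carries arclength measure along a period to arclength measure
along `γ`. -/
def PreservesArclength (γ : ℝ → EucPlane) (L : ℝ) (ψ : ℝ → ℝ) : Prop :=
  ∀ (a b : ℝ) (B : Set EucPlane), MeasurableSet B →
    volume ((fun t => γ (ψ t)) ⁻¹' B ∩ Set.Ico a (a + L)) =
      volume (γ ⁻¹' B ∩ Set.Ico b (b + L))

namespace PreservesArclength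

variable {γ : ℝ → EucPlane} {L : ℝ} {ψ : ℝ → ℝ}

lemma volume_le (hp : PreservesArclength γ L ψ) (h : IsUnitSpeedCurve γ L) {E : Set ℝ}
    {a s η : ℝ} (hE : E ⊆ Set.Ico a (a + L)) (hη : η < L / 2)
    (hmap : ∀ t ∈ E, γ (ψ t) ∈ γ '' Set.Icc (s - η) (s + η)) :
    volume E ≤ ENNReal.ofReal (2 * η) := by
  have hm : MeasurableSet (γ '' Set.Icc (s - η) (s + η)) :=
    (isCompact_Icc.image h.differentiable.continuous).isClosed.measurableSet
  calc volume E ≤ volume ((fun t => γ (ψ t)) ⁻¹' (γ '' Set.Icc (s - η) (s + η)) ∩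
        Set.Ico a (a + L)) := measure_mono fun t ht => ⟨hmap t ht, hE ht⟩
    _ = _ := hp a (s - L / 2) _ hm
    _ ≤ _ := h.volume_preimage_image_Icc_le hη

lemma exists_dist_le {t q : ℝ} (hd : DifferentiableAt ℝ ψ t) (hq : |deriv ψ t| < q) :
    ∃ δ > 0, ∀ u, |u - t| ≤ δ → |ψ u - ψ t| ≤ q * |u - t| := by
  have h1 := hd.hasDerivAt.isLittleO
  have h2 := h1.def (sub_pos.2 hq)
  obtain ⟨δ, hδ, h3⟩ := Metric.eventually_nhds_iff.1 h2
  refine ⟨δ / 2, by positivity, fun u hu => ?_⟩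
  have h4 := h3 (y := u) (by rw [Real.dist_eq]; linarith)
  simp only [smul_eq_mul, Real.norm_eq_abs] at h4
  have h5 : |(u - t) * deriv ψ t| = |u - t| * |deriv ψ t| := abs_mul _ _
  have h6 := abs_sub_abs_le_abs_sub (ψ u - ψ t) ((u - t) * deriv ψ t)
  nlinarith

/-- A measure-preserving reparametrization never contracts. -/
lemma one_le_abs_deriv (hp : PreservesArclength γ L ψ) (h : IsUnitSpeedCurve γ L)
    (hψ : Differentiable ℝ ψ) (t : ℝ) : 1 ≤ |deriv ψ t| := by
  have hL := h.pos
  by_contra! hlt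
  obtain ⟨q, hq, hq1⟩ := exists_between hlt
  have hq0 : 0 < q := (abs_nonneg _).trans_lt hq
  obtain ⟨δ, hδ, hb⟩ := exists_dist_le (hψ t) hq
  set η := min δ (L / 4)
  have hη0 : 0 < η := by positivity
  have hηL : η ≤ L / 4 := min_le_right _ _
  have := hp.volume_le h (E := Set.Icc (t - η) (t + η)) (a := t - L / 2) (s := ψ t)
    (η := q * η) (fun u hu => ⟨by linarith [hu.1], by linarith [hu.2]⟩) (by nlinarith)
    (fun u hu => by
      have h1 : |u - t| ≤ η := abs_le.2 ⟨by linarith [hu.1], by linarith [hu.2]⟩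
      have h2 := (hb u (h1.trans (min_le_left _ _))).trans
        (mul_le_mul_of_nonneg_left h1 hq0.le)
      rw [abs_le] at h2
      exact ⟨ψ u, ⟨by linarith, by linarith⟩, rfl⟩)
  rw [Real.volume_Icc, ENNReal.ofReal_le_ofReal_iff (by positivity)] at this
  nlinarith

/-- Where `ψ` has unit speed there is no room for a second preimage. -/
lemma ne_of_abs_deriv_eq_one (hp : PreservesArclength γ L ψ) (h : IsUnitSpeedCurve γ L)
    (hψ : Differentiable ℝ ψ) {t₁ t₂ : ℝ} (ht₁ : |deriv ψ t₁| = 1) (hlt : t₁ < t₂)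
    (hlt' : t₂ < t₁ + L) : γ (ψ t₂) ≠ γ (ψ t₁) := by
  intro heq
  have hL := h.pos
  set C := |deriv ψ t₂| + 1
  have hC1 : 1 ≤ C := by have := abs_nonneg (deriv ψ t₂); linarith
  have hC0 : 0 < C := by linarith
  set q := 1 + 1 / C with hq
  have hq1 : 1 < q := by have : 0 < 1 / C := by positivity
                         linarith
  have hq0 : 0 < q := by linarith
  obtain ⟨δ₁, hδ₁, hb₁⟩ := exists_dist_le (hψ t₁) (ht₁.trans_lt hq1)
  obtain ⟨δ₂, hδ₂, hb₂⟩ := exists_dist_le (hψ t₂) (lt_add_one |deriv ψ t₂|)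
  obtain ⟨η, hη0, hη⟩ : ∃ η > 0, η ≤ δ₁ ∧ η ≤ δ₂ ∧ η ≤ L / 4 ∧ η ≤ (t₂ - t₁) / 4 ∧
      η ≤ (t₁ + L - t₂) / 4 := by
    have h1 : 0 < (t₂ - t₁) / 4 := by linarith
    have h2 : 0 < (t₁ + L - t₂) / 4 := by linarith
    refine ⟨min δ₁ (min δ₂ (min (L / 4) (min ((t₂ - t₁) / 4) ((t₁ + L - t₂) / 4)))),
      by positivity, ?_⟩
    simp only [min_le_iff, le_refl, true_or, or_true, and_self]
  obtain ⟨hη₁, hη₂, hη₃, hη₄, hη₅⟩ := hη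
  have hq' : η / q ≤ η := div_le_self hη0.le hq1.le
  have hC' : η / C ≤ η := div_le_self hη0.le hC1
  have hq0' : 0 < η / q := by positivity
  have hC0' : 0 < η / C := by positivity
  have hdisj : Disjoint (Set.Icc (t₁ - η / q) (t₁ + η / q)) (Set.Icc (t₂ - η / C) (t₂ + η / C)) :=
    Set.disjoint_left.2 fun u hu hu' => by linarith [hu.2, hu'.1]
  obtain ⟨n, hn⟩ := h.exists_int_of_eq heq
  have := hp.volume_le h (E := Set.Icc (t₁ - η / q) (t₁ + η / q) ∪
      Set.Icc (t₂ - η / C) (t₂ + η / C)) (a := t₁ - (t₁ + L - t₂) / 2) (s := ψ t₁) (η := η)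
    (Set.union_subset (fun u hu => ⟨by linarith [hu.1], by linarith [hu.2]⟩)
      (fun u hu => ⟨by linarith [hu.1], by linarith [hu.2]⟩)) (by linarith) (by
      rintro u (hu | hu)
      · have h1 : |u - t₁| ≤ η / q := abs_le.2 ⟨by linarith [hu.1], by linarith [hu.2]⟩
        have h2 := (hb₁ u (h1.trans (hq'.trans hη₁))).trans
          (mul_le_mul_of_nonneg_left h1 hq0.le)
        rw [mul_div_cancel₀ _ hq0.ne', abs_le] at h2
        exact ⟨ψ u, ⟨by linarith, by linarith⟩, rfl⟩
      · have h1 : |u - t₂| ≤ η / C := abs_le.2 ⟨by linarith [hu.1], by linarith [hu.2]⟩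
        have h2 := (hb₂ u (h1.trans (hC'.trans hη₂))).trans
          (mul_le_mul_of_nonneg_left h1 hC0.le)
        rw [mul_div_cancel₀ _ hC0.ne', abs_le] at h2
        exact ⟨ψ u - n * L, ⟨by linarith, by linarith⟩, h.periodic.sub_int_mul_eq n⟩)
  rw [measure_union hdisj measurableSet_Icc, Real.volume_Icc, Real.volume_Icc,
    ← ENNReal.ofReal_add (by linarith) (by linarith),
    ENNReal.ofReal_le_ofReal_iff (by positivity)] at this
  have h1 : η / q + η / C ≤ η := by linarith
  have h2 : η / q = η * (C / (C + 1)) := by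
    rw [hq]; field_simp
  have h3 : η / q + η / C = η + η / (C * (C + 1)) := by
    rw [h2]; field_simp; ring
  have h4 : 0 < η / (C * (C + 1)) := by positivity
  linarith

/-- A curve which is traversed without contraction, and with unit speed at some point, is
traversed with unit speed throughout. -/
lemma exists_eq_affine (hp : PreservesArclength γ L ψ) (h : IsUnitSpeedCurve γ L)
    (hψ : Differentiable ℝ ψ) (hψ' : Continuous (deriv ψ))
    (hper : Function.Periodic (fun t => γ (ψ t)) L) {t₁ : ℝ} (ht₁ : |deriv ψ t₁| = 1) :
    ∃ e c : ℝ, (e = 1 ∨ e = -1) ∧ ∀ t, γ (ψ t) = γ (e * t + c) := by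
  have hL := h.pos
  obtain ⟨e, he, hmono⟩ := exists_sign_monotone hψ hψ' (hp.one_le_abs_deriv h hψ)
  have hee : e * e = 1 := by rcases he with rfl | rfl <;> norm_num
  set χ : ℝ → ℝ := fun t => e * ψ t - t with hχ
  have hend : χ (t₁ + L) = χ t₁ := by
    refine le_antisymm ?_ (hmono (by linarith))
    by_contra! hlt
    have hc : ContinuousOn (fun t => e * ψ t) (Set.Icc t₁ (t₁ + L)) := by
      have := hψ.continuous
      fun_prop
    obtain ⟨t₂, ht₂, heq⟩ := intermediate_value_Ioo (by linarith) hc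
      (show e * ψ t₁ + L ∈ Set.Ioo (e * ψ t₁) (e * ψ (t₁ + L)) from
        ⟨by linarith, by simp only [hχ] at hlt; linarith⟩)
    refine hp.ne_of_abs_deriv_eq_one h hψ ht₁ ht₂.1 ht₂.2 ?_
    rcases he with rfl | rfl
    · rw [show ψ t₂ = ψ t₁ + L by linarith, h.periodic]
    · rw [show ψ t₂ = ψ t₁ - L by linarith, h.periodic.sub_eq]
  have hcst : ∀ t ∈ Set.Icc t₁ (t₁ + L), χ t = χ t₁ := fun t ht =>
    le_antisymm ((hmono ht.2).trans_eq hend) (hmono ht.1)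
  refine ⟨e, e * χ t₁, he, fun t => ?_⟩
  have hper' := (h.comp_affine he (e * χ t₁)).periodic
  have hk : γ (ψ (toIcoMod hL t₁ t)) = γ (e * toIcoMod hL t₁ t + e * χ t₁) := by
    have h2 := hcst _ (Set.Ico_subset_Icc_self (toIcoMod_mem_Ico hL t₁ t))
    congr 1
    rw [← h2]
    linear_combination -(ψ (toIcoMod hL t₁ t)) * hee
  rw [toIcoMod] at hk
  exact (hper.sub_zsmul_eq _).symm.trans (hk.trans (hper'.sub_zsmul_eq _))

end PreservesArclength

/-- The radial component of the position of `γ t` relative to `c` along the tangent. -/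
noncomputable def radial (γ : ℝ → EucPlane) (c : EucPlane) (t : ℝ) : ℝ :=
  (γ t 0 - c 0) * deriv γ t 0 + (γ t 1 - c 1) * deriv γ t 1

/-- The component of the position of `γ t` relative to `c` orthogonal to the tangent. -/
noncomputable def transverse (γ : ℝ → EucPlane) (c : EucPlane) (t : ℝ) : ℝ :=
  (γ t 1 - c 1) * deriv γ t 0 - (γ t 0 - c 0) * deriv γ t 1

lemma norm_sub_sq_apply (x c : EucPlane) :
    ‖x - c‖ ^ 2 = (x 0 - c 0) ^ 2 + (x 1 - c 1) ^ 2 := by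
  rw [EuclideanSpace.norm_eq, Real.sq_sqrt (by positivity)]
  simp [sq_abs]

namespace IsUnitSpeedCurve

variable {γ : ℝ → EucPlane} {L : ℝ}

lemma radial_sq_add_transverse_sq (h : IsUnitSpeedCurve γ L) (c : EucPlane) (t : ℝ) :
    radial γ c t ^ 2 + transverse γ c t ^ 2 = ‖γ t - c‖ ^ 2 := by
  rw [norm_sub_sq_apply, radial, transverse]
  linear_combination ((γ t 0 - c 0) ^ 2 + (γ t 1 - c 1) ^ 2) * h.sq_add_sq t

lemma hasDerivAt_norm_sub_sq (h : IsUnitSpeedCurve γ L) (c : EucPlane) (t : ℝ) :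
    HasDerivAt (fun t => ‖γ t - c‖ ^ 2) (2 * radial γ c t) t := by
  simp_rw [norm_sub_sq_apply]
  refine ((((h.hasDerivAt_apply 0 t).sub_const (c 0)).pow 2).add
    (((h.hasDerivAt_apply 1 t).sub_const (c 1)).pow 2)).congr_deriv ?_
  rw [radial]
  ring

lemma hasDerivAt_radial (h : IsUnitSpeedCurve γ L) (c : EucPlane) (t : ℝ) :
    HasDerivAt (radial γ c) (1 + signedCurv γ t * transverse γ c t) t := by
  refine ((((h.hasDerivAt_apply 0 t).sub_const (c 0)).mul (h.hasDerivAt_deriv_zero t)).add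
    (((h.hasDerivAt_apply 1 t).sub_const (c 1)).mul (h.hasDerivAt_deriv_one t))).congr_deriv ?_
  rw [transverse]
  linear_combination h.sq_add_sq t

lemma continuous_radial (h : IsUnitSpeedCurve γ L) (c : EucPlane) : Continuous (radial γ c) :=
  continuous_iff_continuousAt.2 fun t => (h.hasDerivAt_radial c t).continuousAt

lemma continuous_transverse (h : IsUnitSpeedCurve γ L) (c : EucPlane) :
    Continuous (transverse γ c) := by
  have hx : ∀ i, Continuous fun t => γ t i := fun i =>
    continuous_iff_continuousAt.2 fun t => (h.hasDerivAt_apply i t).continuousAt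
  have h0 : Continuous fun t => deriv γ t 0 :=
    continuous_iff_continuousAt.2 fun t => (h.hasDerivAt_deriv_zero t).continuousAt
  have h1 : Continuous fun t => deriv γ t 1 :=
    continuous_iff_continuousAt.2 fun t => (h.hasDerivAt_deriv_one t).continuousAt
  exact (((hx 1).sub continuous_const).mul h0).sub (((hx 0).sub continuous_const).mul h1)

end IsUnitSpeedCurve

lemma nonpos_of_isLocalMax {f V : ℝ → ℝ} {v t₀ : ℝ} (hf : ∀ t, HasDerivAt f (2 * V t) t)
    (hV : HasDerivAt V v t₀) (hmax : IsLocalMax f t₀) : v ≤ 0 := by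
  by_contra! hv
  have hd : deriv f = fun t => 2 * V t := funext fun t => (hf t).deriv
  have hdd : HasDerivAt (deriv f) (2 * v) t₀ := hd ▸ hV.const_mul 2
  have hmin : IsLocalMin f t₀ := isLocalMin_of_deriv_deriv_pos (by rw [hdd.deriv]; linarith)
    hmax.deriv_eq_zero (hf t₀).continuousAt
  have hc : f =ᶠ[nhds t₀] fun _ => f t₀ := by
    filter_upwards [hmin, hmax] with t h1 h2 using le_antisymm h2 h1
  have h0 : deriv f =ᶠ[nhds t₀] fun _ => 0 := by simpa using hc.deriv
  have := h0.deriv_eq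
  rw [hdd.deriv, deriv_const] at this
  linarith

lemma eventually_eq_zero_of_hasDerivAt_mul {D k : ℝ → ℝ} {t₀ : ℝ} (hk : ContinuousAt k t₀)
    (hD : ∀ᶠ t in nhds t₀, HasDerivAt D (k t * D t) t) (h0 : D t₀ = 0) :
    ∀ᶠ t in nhds t₀, D t = 0 := by
  have hb : ∀ᶠ t in nhds t₀, |k t| < |k t₀| + 1 :=
    hk.abs.eventually_lt_const (lt_add_one _)
  refine ODE_solution_unique_of_eventually (v := fun t x => k t * x) (s := fun _ => Set.univ)
    (K := ⟨|k t₀| + 1, by positivity⟩) (f := D) (g := fun _ => 0) ?_ ?_ ?_ h0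
  · filter_upwards [hb] with t ht
    refine (LipschitzWith.of_dist_le_mul fun x y => ?_).lipschitzOnWith
    rw [Real.dist_eq, ← mul_sub, abs_mul, Real.dist_eq]
    exact mul_le_mul_of_nonneg_right ht.le (abs_nonneg _)
  · exact hD.mono fun t ht => ⟨ht, trivial⟩
  · exact Filter.Eventually.of_forall fun t => ⟨by simpa using hasDerivAt_const t (0 : ℝ), trivial⟩

section

variable {γ₁ γ₂ : ℝ → EucPlane} {L₁ L₂ : ℝ} {ψ : ℝ → ℝ} {c₁ c₂ : EucPlane}

lemma radial_eq_mul_deriv (h₁ : IsUnitSpeedCurve γ₁ L₁) (h₂ : IsUnitSpeedCurve γ₂ L₂)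
    (hψ : Differentiable ℝ ψ) (hF : ∀ t, ‖γ₁ t - c₁‖ ^ 2 = ‖γ₂ (ψ t) - c₂‖ ^ 2) (t : ℝ) :
    radial γ₁ c₁ t = radial γ₂ c₂ (ψ t) * deriv ψ t := by
  have e1 := h₁.hasDerivAt_norm_sub_sq c₁ t
  rw [funext hF] at e1
  have e2 := (h₂.hasDerivAt_norm_sub_sq c₂ (ψ t)).comp t (hψ t).hasDerivAt
  have := e1.unique e2
  linarith

/-- Near a maximum of the distance to the center, the radial components agree up to sign. -/
lemma eventually_radial_sq_eq (h₁ : IsUnitSpeedCurve γ₁ L₁) (h₂ : IsUnitSpeedCurve γ₂ L₂)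
    (hψ : ContDiff ℝ 2 ψ) (hF : ∀ t, ‖γ₁ t - c₁‖ ^ 2 = ‖γ₂ (ψ t) - c₂‖ ^ 2)
    (hκ : ∀ t, signedCurv γ₁ t ^ 2 = signedCurv γ₂ (ψ t) ^ 2) {t₀ : ℝ} (hne : deriv ψ t₀ ≠ 0)
    (hmax : IsLocalMax (fun t => ‖γ₁ t - c₁‖ ^ 2) t₀) :
    ∀ᶠ t in nhds t₀, radial γ₁ c₁ t ^ 2 = radial γ₂ c₂ (ψ t) ^ 2 := by
  have hψd : Differentiable ℝ ψ := hψ.differentiable (by norm_num)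
  have hstrict : HasStrictDerivAt ψ (deriv ψ t₀) t₀ :=
    (hψ.contDiffAt.hasStrictDerivAt (by norm_num))
  have hmax₂ : IsLocalMax (fun s => ‖γ₂ s - c₂‖ ^ 2) (ψ t₀) := by
    rw [IsLocalMax, IsMaxFilter, ← hstrict.map_nhds_eq hne, Filter.eventually_map]
    exact hmax.mono fun t ht => by simpa only [hF] using ht
  have hV := radial_eq_mul_deriv h₁ h₂ hψd hF
  have hz₂ : radial γ₂ c₂ (ψ t₀) = 0 := by
    have := hmax₂.hasDerivAt_eq_zero (h₂.hasDerivAt_norm_sub_sq c₂ (ψ t₀))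
    linarith
  have hz₁ : radial γ₁ c₁ t₀ = 0 := by rw [hV, hz₂, zero_mul]
  have hn₁ := nonpos_of_isLocalMax (h₁.hasDerivAt_norm_sub_sq c₁) (h₁.hasDerivAt_radial c₁ t₀) hmax
  have hn₂ := nonpos_of_isLocalMax (h₂.hasDerivAt_norm_sub_sq c₂)
    (h₂.hasDerivAt_radial c₂ (ψ t₀)) hmax₂
  set b₁ : ℝ → ℝ := fun t => -(signedCurv γ₁ t * transverse γ₁ c₁ t) with hb₁
  set b₂ : ℝ → ℝ := fun t => -(signedCurv γ₂ (ψ t) * transverse γ₂ c₂ (ψ t)) with hb₂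
  have hc₁ : Continuous b₁ := (h₁.continuous_signedCurv.mul (h₁.continuous_transverse c₁)).neg
  have hc₂ : Continuous b₂ :=
    ((h₂.continuous_signedCurv.mul (h₂.continuous_transverse c₂)).comp hψ.continuous).neg
  have hp₁ : 0 < b₁ t₀ := by simp only [hb₁]; linarith
  have hp₂ : 0 < b₂ t₀ := by simp only [hb₂]; linarith
  set D : ℝ → ℝ := fun t => radial γ₁ c₁ t ^ 2 - radial γ₂ c₂ (ψ t) ^ 2 with hD
  set k : ℝ → ℝ := fun t => 2 * radial γ₁ c₁ t * signedCurv γ₁ t ^ 2 / (b₁ t + b₂ t) with hk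
  have hD' : ∀ t, HasDerivAt D (2 * radial γ₁ c₁ t * (b₂ t - b₁ t)) t := fun t => by
    have e2 := (h₂.hasDerivAt_radial c₂ (ψ t)).comp t (hψd t).hasDerivAt
    refine (((h₁.hasDerivAt_radial c₁ t).pow 2).sub (e2.pow 2)).congr_deriv ?_
    simp only [hb₁, hb₂, Function.comp_apply]
    push_cast
    linear_combination 2 * (1 + signedCurv γ₂ (ψ t) * transverse γ₂ c₂ (ψ t)) * hV t
  have hsq : ∀ t, (b₂ t - b₁ t) * (b₁ t + b₂ t) = signedCurv γ₁ t ^ 2 * D t := fun t => by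
    have e1 := h₁.radial_sq_add_transverse_sq c₁ t
    have e2 := h₂.radial_sq_add_transverse_sq c₂ (ψ t)
    rw [← hF] at e2
    simp only [hb₁, hb₂, hD]
    linear_combination (signedCurv γ₁ t ^ 2) * (e2 - e1) -
      (transverse γ₂ c₂ (ψ t) ^ 2) * hκ t
  have hkc : ContinuousAt k t₀ := by
    refine ContinuousAt.div ?_ (hc₁.add hc₂).continuousAt (by positivity)
    exact ((continuous_const.mul (h₁.continuous_radial c₁)).mul
      (h₁.continuous_signedCurv.pow 2)).continuousAt
  have hDk : ∀ᶠ t in nhds t₀, HasDerivAt D (k t * D t) t := by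
    filter_upwards [hc₁.continuousAt.eventually (lt_mem_nhds hp₁),
      hc₂.continuousAt.eventually (lt_mem_nhds hp₂)] with t ht₁ ht₂
    refine (hD' t).congr_deriv ?_
    have : b₁ t + b₂ t ≠ 0 := by positivity
    simp only [hk]
    rw [div_mul_eq_mul_div, eq_div_iff this, mul_assoc, hsq]
    ring
  filter_upwards [eventually_eq_zero_of_hasDerivAt_mul hkc hDk (by simp [hD, hz₁, hz₂])] with t ht
  exact sub_eq_zero.1 ht

lemma exists_abs_deriv_eq_one (h₁ : IsUnitSpeedCurve γ₁ L₁) (h₂ : IsUnitSpeedCurve γ₂ L₂)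
    (hψ : ContDiff ℝ 2 ψ) (hexp : ∀ t, 1 ≤ |deriv ψ t|)
    (hF : ∀ t, ‖γ₁ t - c₁‖ ^ 2 = ‖γ₂ (ψ t) - c₂‖ ^ 2)
    (hκ : ∀ t, signedCurv γ₁ t ^ 2 = signedCurv γ₂ (ψ t) ^ 2)
    (hnc : ∃ t, radial γ₁ c₁ t ≠ 0) : ∃ t, |deriv ψ t| = 1 := by
  by_contra! hne
  have hψd : Differentiable ℝ ψ := hψ.differentiable (by norm_num)
  have hV := radial_eq_mul_deriv h₁ h₂ hψd hF
  set F : ℝ → ℝ := fun t => ‖γ₁ t - c₁‖ ^ 2 with hFdef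
  have hFc : Continuous F := continuous_iff_continuousAt.2 fun t =>
    (h₁.hasDerivAt_norm_sub_sq c₁ t).continuousAt
  have hFp : Function.Periodic F L₁ := fun t => by simp only [hFdef, h₁.periodic t]
  obtain ⟨tm, htm⟩ : ∃ tm, ∀ t, F t ≤ F tm := by
    obtain ⟨tm, -, htm⟩ := (isCompact_Icc (a := (0 : ℝ)) (b := L₁)).exists_isMaxOn
      (Set.nonempty_Icc.2 h₁.pos.le) hFc.continuousOn
    refine ⟨tm, fun t => ?_⟩
    obtain ⟨u, hu, hut⟩ := hFp.exists_mem_Ico₀ h₁.pos t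
    exact hut ▸ htm (Set.Ico_subset_Icc_self hu)
  have hclopen : IsClopen {t | F t = F tm} := by
    refine ⟨isClosed_eq hFc continuous_const, isOpen_iff_mem_nhds.2 fun t₀ ht₀ => ?_⟩
    have ht₀' : F t₀ = F tm := ht₀
    have hloc := eventually_radial_sq_eq h₁ h₂ hψ hF hκ (t₀ := t₀)
      (fun h0 => by have := hexp t₀; rw [h0, abs_zero] at this; linarith)
      (Filter.Eventually.of_forall fun t => (htm t).trans_eq ht₀'.symm)
    have hz : ∀ᶠ t in nhds t₀, radial γ₁ c₁ t = 0 := by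
      filter_upwards [hloc] with t ht
      have h1 : 1 < deriv ψ t ^ 2 := by
        rw [one_lt_sq_iff_one_lt_abs]
        exact lt_of_le_of_ne (hexp t) (hne t).symm
      rw [hV, mul_pow] at ht
      have h2 : radial γ₂ c₂ (ψ t) ^ 2 * (deriv ψ t ^ 2 - 1) = 0 := by linarith
      rcases mul_eq_zero.1 h2 with h3 | h3
      · rw [hV, pow_eq_zero_iff two_ne_zero |>.1 h3, zero_mul]
      · linarith
    obtain ⟨ε, hε, hb⟩ := Metric.eventually_nhds_iff_ball.1 hz
    refine Filter.mem_of_superset (ball_mem_nhds t₀ hε) fun t ht => ?_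
    have := eqOn_of_hasDerivAt_eq (convex_ball t₀ ε) (h₁.hasDerivAt_norm_sub_sq c₁)
      (fun t => hasDerivAt_const t (F t₀)) (fun u hu => by rw [hb u hu, mul_zero])
      (mem_ball_self hε) rfl ht
    exact this.trans ht₀'
  have huniv := hclopen.eq_univ ⟨tm, rfl⟩
  obtain ⟨t, ht⟩ := hnc
  have hmax : IsLocalMax F t := Filter.Eventually.of_forall fun u =>
    (htm u).trans_eq (huniv.symm ▸ Set.mem_univ t : t ∈ {t | F t = F tm}).symm
  have := hmax.hasDerivAt_eq_zero (h₁.hasDerivAt_norm_sub_sq c₁ t)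
  exact ht (by linarith)

end

/-- **Proposition (local distance distributions determine generic `C²` curves).**
Let `X₁ = range γ₁` and `X₂ = range γ₂` be twice continuously differentiable simple
closed plane curves (given by unit-speed parametrizations), each generic in the sense
that its signed curvature has only isolated zeros.  If there is a twice continuously
differentiable measure-preserving map `φ : X₁ → X₂` (expressed through a `C²`
reparametrization `ψ` with `φ ∘ γ₁ = γ₂ ∘ ψ`) preserving the local distance
distributions, i.e. `h_{X₁}(x,r) = h_{X₂}(φ(x),r)` for all `x ∈ X₁`, `r ≥ 0`,
then `X₁` and `X₂` are related by a Euclidean isometry of `ℝ²`. -/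
theorem local_distribution_determines_generic_curves
    (γ₁ γ₂ : ℝ → EucPlane) (L₁ L₂ : ℝ)
    (h₁ : IsClosedC2Curve γ₁ L₁) (h₂ : IsClosedC2Curve γ₂ L₂)
    (hunit₁ : ∀ t, ‖deriv γ₁ t‖ = 1) (hunit₂ : ∀ t, ‖deriv γ₂ t‖ = 1)
    (hgen₁ : ∀ t, signedCurv γ₁ t = 0 →
      ∃ ε > 0, ∀ s, s ≠ t → |s - t| < ε → signedCurv γ₁ s ≠ 0)
    (hgen₂ : ∀ t, signedCurv γ₂ t = 0 →
      ∃ ε > 0, ∀ s, s ≠ t → |s - t| < ε → signedCurv γ₂ s ≠ 0)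
    (φ : EucPlane → EucPlane) (hφmeas : Measurable φ)
    (ψ : ℝ → ℝ) (hψ : ContDiff ℝ 2 ψ) (hφψ : ∀ t, φ (γ₁ t) = γ₂ (ψ t))
    (hmp : Measure.map φ (curveMeasure (Set.range γ₁)) = curveMeasure (Set.range γ₂))
    (hloc : ∀ x ∈ Set.range γ₁, ∀ r : ℝ, 0 ≤ r →
      curveMeasure (Set.range γ₁) (Metric.closedBall x r) =
      curveMeasure (Set.range γ₂) (Metric.closedBall (φ x) r)) :
    ∃ T : EucPlane ≃ᵢ EucPlane, T '' (Set.range γ₁) = Set.range γ₂ := by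
  have hu₁ := h₁.isUnitSpeedCurve hunit₁
  have hu₂ := h₂.isUnitSpeedCurve hunit₂
  have hlocγ : ∀ t r, 0 ≤ r → (ENNReal.ofReal L₁)⁻¹ * ballVol γ₁ L₁ t r =
      (ENNReal.ofReal L₂)⁻¹ * ballVol γ₂ L₂ (ψ t) r := fun t r hr => by
    rw [← hu₁.curveMeasure_closedBall, ← hu₂.curveMeasure_closedBall, ← hφψ]
    exact hloc _ ⟨t, rfl⟩ r hr
  obtain rfl : L₁ = L₂ := le_antisymm
    (length_le_of_ballVol_eq hu₂ hu₁ fun r hr => (hlocγ 0 r hr).symm)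
    (length_le_of_ballVol_eq hu₁ hu₂ (hlocγ 0))
  have hL0 : (ENNReal.ofReal L₁)⁻¹ ≠ 0 := ENNReal.inv_ne_zero.2 ENNReal.ofReal_ne_top
  have hLtop : (ENNReal.ofReal L₁)⁻¹ ≠ ⊤ :=
    ENNReal.inv_ne_top.2 (ENNReal.ofReal_pos.2 hu₁.pos).ne'
  have hball : ∀ t r, 0 ≤ r → ballVol γ₁ L₁ t r = ballVol γ₂ L₁ (ψ t) r := fun t r hr =>
    (ENNReal.mul_right_inj hL0 hLtop).1 (hlocγ t r hr)
  have hκ : ∀ t, signedCurv γ₁ t ^ 2 = signedCurv γ₂ (ψ t) ^ 2 := fun t =>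
    sq_signedCurv_eq hu₁ hu₂ (hball t)
  have hp : PreservesArclength γ₂ L₁ ψ := fun a b B hB => by
    have h := congrArg (fun μ => μ B) hmp
    simp only [Measure.map_apply hφmeas hB] at h
    rw [hu₁.curveMeasure_apply a (hφmeas hB), hu₂.curveMeasure_apply b hB,
      ENNReal.mul_right_inj hL0 hLtop] at h
    rw [← h]
    congr 2
    ext t
    simp only [Set.mem_preimage, hφψ]
  have hper : Function.Periodic (fun t => γ₂ (ψ t)) L₁ := fun t => by
    simp only [← hφψ, hu₁.periodic t]
  have hψd : Differentiable ℝ ψ := hψ.differentiable (by norm_num)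
  have hψ' : Continuous (deriv ψ) := hψ.continuous_deriv (by norm_num)
  have hexp := hp.one_le_abs_deriv hu₂ hψd
  obtain ⟨c₁, c₂, hc⟩ := exists_center hu₁ hu₂ hφmeas hmp hloc
  have hF : ∀ t, ‖γ₁ t - c₁‖ ^ 2 = ‖γ₂ (ψ t) - c₂‖ ^ 2 := fun t => by
    rw [hc _ ⟨t, rfl⟩, hφψ]
  by_cases hnc : ∃ t, radial γ₁ c₁ t ≠ 0
  · obtain ⟨t₁, ht₁⟩ := exists_abs_deriv_eq_one hu₁ hu₂ hψ hexp hF hκ hnc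
    obtain ⟨e, c, he, hec⟩ := hp.exists_eq_affine hu₂ hψd hψ' hper ht₁
    have hu₃ := hu₂.comp_affine he c
    have hball₃ : ∀ t r, 0 ≤ r →
        ballVol γ₁ L₁ t r = ballVol (fun t => γ₂ (e * t + c)) L₁ t r := fun t r hr => by
      refine (ENNReal.mul_right_inj hL0 hLtop).1 ?_
      rw [hlocγ t r hr, ← hu₂.curveMeasure_closedBall, ← hu₃.curveMeasure_closedBall,
        IsUnitSpeedCurve.range_comp_affine he, hec]
    obtain ⟨τ, hτ, hκτ⟩ := exists_sign_signedCurv hu₁ hu₃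
      (fun t => sq_signedCurv_eq hu₁ hu₃ (hball₃ t)) hball₃ hgen₁
    obtain ⟨T, hT⟩ := exists_isometryEquiv_of_signedCurv hu₁ hu₃ hτ hκτ
    exact ⟨T, hT.trans (IsUnitSpeedCurve.range_comp_affine he c)⟩
  · push Not at hnc
    have hρ : ∀ t, signedCurv γ₁ t ^ 2 * ‖γ₁ 0 - c₁‖ ^ 2 = 1 := fun t => by
      have h1 : 1 + signedCurv γ₁ t * transverse γ₁ c₁ t = 0 :=
        ((hu₁.hasDerivAt_radial c₁ t).unique
          ((funext hnc : radial γ₁ c₁ = fun _ => 0) ▸ hasDerivAt_const t (0 : ℝ)))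
      have h2 : ‖γ₁ t - c₁‖ ^ 2 = ‖γ₁ 0 - c₁‖ ^ 2 :=
        is_const_of_deriv_eq_zero
          (fun t => (hu₁.hasDerivAt_norm_sub_sq c₁ t).differentiableAt)
          (fun t => by rw [(hu₁.hasDerivAt_norm_sub_sq c₁ t).deriv, hnc, mul_zero]) t 0
      have h3 := hu₁.radial_sq_add_transverse_sq c₁ t
      rw [hnc, h2] at h3
      linear_combination -(signedCurv γ₁ t ^ 2) * h3 +
        (signedCurv γ₁ t * transverse γ₁ c₁ t - 1) * h1
    have hsq : ∀ t, signedCurv γ₁ t ^ 2 = signedCurv γ₂ t ^ 2 := fun t => by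
      obtain ⟨u, rfl⟩ := surjective_of_one_le_abs_deriv hψd hψ' hexp t
      rw [← hκ u]
      refine mul_right_cancel₀ (b := ‖γ₁ 0 - c₁‖ ^ 2) (fun h0 => ?_) ((hρ _).trans (hρ u).symm)
      have := hρ 0
      rw [h0, mul_zero] at this
      exact zero_ne_one this
    obtain ⟨τ, hτ, hκτ⟩ := eq_mul_or_of_ne_zero isPreconnected_univ hu₁.continuous_signedCurv
      hu₂.continuous_signedCurv hsq (fun t _ h0 => by
        have := hρ t
        rw [h0, zero_pow two_ne_zero, zero_mul] at this
        exact zero_ne_one this)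
    exact exists_isometryEquiv_of_signedCurv hu₁ hu₂ hτ fun t => hκτ t trivial
end

section
/- Fix A ≥ B > 0 and A' ≥ B' > 0 and let X_{A,B} and X_{A',B'} be the ellipses in ℝ² with semi-axes (A,B) and (A',B') respectively, each regarded as an mm-space with Euclidean distance and normalized arclength measure. If H_{X_{A,B}}(r) = H_{X_{A',B'}}(r) for all r ≥ 0, then A = A' and B = B'; hence the two ellipses are related by a rigid motion of the plane. -/
open MeasureTheory Metric ENNReal

/-- The ellipse `{(A cos t, B sin t) : t ∈ ℝ} ⊂ ℝ²` with semi-axes `A`, `B`. -/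
noncomputable def ellipseSet (A B : ℝ) : Set EucPlane :=
  {p | ∃ t : ℝ,
    p = (EuclideanSpace.equiv (Fin 2) ℝ).symm ![A * Real.cos t, B * Real.sin t]}

/-- The standard parametrization of the ellipse with semi-axes `A`, `B`. -/
noncomputable def ellipsePt (A B t : ℝ) : EucPlane :=
  (EuclideanSpace.equiv (Fin 2) ℝ).symm ![A * Real.cos t, B * Real.sin t]

/-- The squared speed of `ellipsePt A B`. -/
noncomputable def ellipseSpeedSq (A B t : ℝ) : ℝ :=
  A ^ 2 * Real.sin t ^ 2 + B ^ 2 * Real.cos t ^ 2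

lemma dist_sq_eq (x y : EucPlane) : dist x y ^ 2 = (x 0 - y 0) ^ 2 + (x 1 - y 1) ^ 2 := by
  rw [EuclideanSpace.dist_eq, Real.sq_sqrt (by positivity), Fin.sum_univ_two, Real.dist_eq,
    Real.dist_eq, sq_abs, sq_abs]

@[simp] lemma ellipsePt_zero (A B t : ℝ) : ellipsePt A B t 0 = A * Real.cos t := by
  simp [ellipsePt]

@[simp] lemma ellipsePt_one (A B t : ℝ) : ellipsePt A B t 1 = B * Real.sin t := by
  simp [ellipsePt]

lemma dist_sq_ellipsePt (A B t s : ℝ) :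
    dist (ellipsePt A B t) (ellipsePt A B s) ^ 2 =
      4 * Real.sin ((t - s) / 2) ^ 2 * ellipseSpeedSq A B ((t + s) / 2) := by
  rw [dist_sq_eq]
  simp only [ellipsePt_zero, ellipsePt_one, ellipseSpeedSq, ← mul_sub, Real.cos_sub_cos,
    Real.sin_sub_sin]
  ring

lemma sq_le_ellipseSpeedSq {A B : ℝ} (hB : 0 < B) (hAB : B ≤ A) (t : ℝ) :
    B ^ 2 ≤ ellipseSpeedSq A B t := by
  have h := Real.sin_sq_add_cos_sq t
  have h2 : B ^ 2 ≤ A ^ 2 := by gcongr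
  have h3 := mul_le_mul_of_nonneg_right h2 (sq_nonneg (Real.sin t))
  unfold ellipseSpeedSq
  nlinarith

lemma ellipseSpeedSq_le_sq {A B : ℝ} (hB : 0 < B) (hAB : B ≤ A) (t : ℝ) :
    ellipseSpeedSq A B t ≤ A ^ 2 := by
  have h := Real.sin_sq_add_cos_sq t
  have h2 : B ^ 2 ≤ A ^ 2 := by gcongr
  have h3 := mul_le_mul_of_nonneg_right h2 (sq_nonneg (Real.cos t))
  unfold ellipseSpeedSq
  nlinarith

lemma abs_ellipseSpeedSq_sub_le {A B : ℝ} (hB : 0 < B) (hAB : B ≤ A) (t s : ℝ) :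
    |ellipseSpeedSq A B t - ellipseSpeedSq A B s| ≤ A ^ 2 * |t - s| := by
  have h2 : B ^ 2 ≤ A ^ 2 := by gcongr
  have key : ellipseSpeedSq A B t - ellipseSpeedSq A B s =
      (A ^ 2 - B ^ 2) * (Real.sin (t - s) * Real.sin (t + s)) := by
    have h := Real.sin_sq_add_cos_sq t
    have h' := Real.sin_sq_add_cos_sq s
    rw [Real.sin_sub, Real.sin_add]
    unfold ellipseSpeedSq
    rw [Real.cos_sq' t, Real.cos_sq' s]
    linear_combination (A ^ 2 - B ^ 2) *
      (- Real.sin t ^ 2 * h' + Real.sin s ^ 2 * h)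
  rw [key, abs_mul, abs_mul, abs_of_nonneg (by linarith)]
  have h4 : |Real.sin (t - s)| * |Real.sin (t + s)| ≤ |t - s| * 1 := by
    exact mul_le_mul Real.abs_sin_le_abs (Real.abs_sin_le_one _) (abs_nonneg _) (abs_nonneg _)
  have : A ^ 2 - B ^ 2 ≤ A ^ 2 := by nlinarith
  calc _ ≤ A ^ 2 * (|t - s| * 1) := by gcongr
    _ = _ := by ring

lemma dist_ellipsePt_le {A B : ℝ} (hB : 0 < B) (hAB : B ≤ A) (t s : ℝ) :
    dist (ellipsePt A B t) (ellipsePt A B s) ≤ A * |t - s| := by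
  have hA : 0 < A := hB.trans_le hAB
  refine abs_le_of_sq_le_sq' ?_ (by positivity) |>.2
  rw [dist_sq_ellipsePt, mul_pow, sq_abs]
  have h1 : Real.sin ((t - s) / 2) ^ 2 ≤ ((t - s) / 2) ^ 2 := sq_le_sq.2 Real.abs_sin_le_abs
  have h2 := ellipseSpeedSq_le_sq hB hAB ((t + s) / 2)
  have h3 := (sq_nonneg B).trans (sq_le_ellipseSpeedSq hB hAB ((t + s) / 2))
  calc _ ≤ 4 * ((t - s) / 2) ^ 2 * A ^ 2 := by gcongr
    _ = _ := by ring

lemma continuous_ellipsePt (A B : ℝ) : Continuous (ellipsePt A B) := by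
  unfold ellipsePt
  refine (EuclideanSpace.equiv (Fin 2) ℝ).symm.continuous.comp ?_
  refine continuous_pi fun i => ?_
  fin_cases i <;> simp <;> fun_prop

lemma ellipsePt_mem (A B t : ℝ) : ellipsePt A B t ∈ ellipseSet A B := ⟨t, rfl⟩

lemma exists_near_eq_ellipsePt (A B t₀ : ℝ) {x : EucPlane} (hx : x ∈ ellipseSet A B) :
    ∃ t, |t - t₀| ≤ Real.pi ∧ x = ellipsePt A B t := by
  obtain ⟨u, rfl⟩ := hx
  have h := toIcoMod_mem_Ico (Real.two_pi_pos) (t₀ - Real.pi) u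
  refine ⟨toIcoMod Real.two_pi_pos (t₀ - Real.pi) u, ?_, ?_⟩
  · rw [abs_le]; constructor <;> linarith [h.1, h.2]
  · simp only [ellipsePt]
    rw [toIcoMod, zsmul_eq_mul, Real.cos_sub_int_mul_two_pi,
      Real.sin_sub_int_mul_two_pi]

lemma isCompact_ellipseSet (A B : ℝ) : IsCompact (ellipseSet A B) := by
  have : ellipseSet A B = ellipsePt A B '' Metric.closedBall 0 Real.pi := by
    ext x
    constructor
    · intro hx
      obtain ⟨t, ht, rfl⟩ := exists_near_eq_ellipsePt A B 0 hx
      exact ⟨t, by simpa [Real.dist_eq] using ht, rfl⟩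
    · rintro ⟨t, -, rfl⟩
      exact ellipsePt_mem A B t
  rw [this]
  exact (isCompact_closedBall _ _).image (continuous_ellipsePt A B)

lemma mul_sq_le_sin_sq {η x : ℝ} (hx : |x| ≤ 1) (hη : x ^ 2 ≤ η) :
    (1 - η) * x ^ 2 ≤ Real.sin x ^ 2 := by
  have main : ∀ y : ℝ, 0 < y → y ≤ 1 → y ^ 2 ≤ η → (1 - η) * y ^ 2 ≤ Real.sin y ^ 2 := by
    intro y h0 h1 h2
    have h3 := Real.sin_gt_sub_cube h0
    have h4 : y - y ^ 3 / 6 = y * (1 - y ^ 2 / 6) := by ring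
    have h5 : y ^ 2 ≤ 1 := by nlinarith
    have h6 : 0 ≤ y * (1 - y ^ 2 / 6) := mul_nonneg h0.le (by linarith)
    have h7 : (y * (1 - y ^ 2 / 6)) ^ 2 ≤ Real.sin y ^ 2 := by
      gcongr; linarith
    refine le_trans ?_ h7
    rw [mul_pow, mul_comm]
    gcongr
    nlinarith [sq_nonneg (y ^ 2)]
  rcases lt_trichotomy x 0 with h | rfl | h
  · have := main (-x) (by linarith) (by linarith [neg_abs_le x]) (by simpa using hη)
    simpa using this
  · simp
  · exact main x h (by linarith [le_abs_self x]) hη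

lemma exists_local_bilipschitz {A B : ℝ} (hB : 0 < B) (hAB : B ≤ A) {η : ℝ} (h0 : 0 < η)
    (h1 : η < 1) :
    ∃ δ > 0, ∀ t₀ t s : ℝ, |t - t₀| ≤ δ → |s - t₀| ≤ δ →
      (1 - η) * Real.sqrt (ellipseSpeedSq A B t₀) * |t - s| ≤
          dist (ellipsePt A B t) (ellipsePt A B s) ∧
        dist (ellipsePt A B t) (ellipsePt A B s) ≤
          (1 + η) * Real.sqrt (ellipseSpeedSq A B t₀) * |t - s| := by
  have hA : 0 < A := hB.trans_le hAB
  refine ⟨min η (η * B ^ 2 / A ^ 2), by positivity, fun t₀ t s ht hs => ?_⟩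
  set δ := min η (η * B ^ 2 / A ^ 2) with hδ
  have hδη : δ ≤ η := min_le_left _ _
  have hδA : A ^ 2 * δ ≤ η * B ^ 2 := by
    have : δ ≤ η * B ^ 2 / A ^ 2 := min_le_right _ _
    rw [le_div_iff₀ (by positivity)] at this
    linarith
  rw [abs_le] at ht hs
  have hx : |(t - s) / 2| ≤ δ := by rw [abs_le]; constructor <;> linarith
  have hm : |(t + s) / 2 - t₀| ≤ δ := by rw [abs_le]; constructor <;> linarith
  have hx2 : ((t - s) / 2) ^ 2 ≤ η := by
    rw [← sq_abs]; nlinarith [abs_nonneg ((t - s) / 2)]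
  have hsin := mul_sq_le_sin_sq (by linarith) hx2
  have hsin' : Real.sin ((t - s) / 2) ^ 2 ≤ ((t - s) / 2) ^ 2 := sq_le_sq.2 Real.abs_sin_le_abs
  have hq0 := sq_le_ellipseSpeedSq hB hAB t₀
  have hqm := sq_le_ellipseSpeedSq hB hAB ((t + s) / 2)
  have hd := (abs_ellipseSpeedSq_sub_le hB hAB ((t + s) / 2) t₀).trans
    (mul_le_mul_of_nonneg_left hm (sq_nonneg A))
  have hηq := mul_le_mul_of_nonneg_left hq0 h0.le
  rw [abs_le] at hd
  have hB2 : 0 < B ^ 2 := by positivity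
  have hq00 : 0 ≤ ellipseSpeedSq A B t₀ := by linarith
  have hqm0 : 0 ≤ ellipseSpeedSq A B ((t + s) / 2) := by linarith
  constructor
  · refine abs_le_of_sq_le_sq' ?_ dist_nonneg |>.2
    rw [dist_sq_ellipsePt, mul_pow, mul_pow, sq_abs, Real.sq_sqrt hq00]
    calc _ = 4 * ((1 - η) * ((t - s) / 2) ^ 2) * ((1 - η) * ellipseSpeedSq A B t₀) := by ring
      _ ≤ _ := by
        gcongr
        linarith
  · have : 0 ≤ (1 + η) := by linarith
    refine abs_le_of_sq_le_sq' ?_ (by positivity) |>.2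
    rw [dist_sq_ellipsePt, mul_pow, mul_pow, sq_abs, Real.sq_sqrt hq00]
    calc _ ≤ 4 * (((t - s) / 2) ^ 2) * ((1 + η) * ellipseSpeedSq A B t₀) := by
          gcongr
          linarith
      _ = (1 + η) * ellipseSpeedSq A B t₀ * (t - s) ^ 2 := by ring
      _ ≤ _ := by
        gcongr
        nlinarith

lemma hausdorffMeasure_image_le_of_dist_le {X Y : Type*} [MetricSpace X]
    [MeasurableSpace X] [BorelSpace X] [MetricSpace Y] [MeasurableSpace Y] [BorelSpace Y]
    {f : X → Y} {S : Set X} {K : ℝ} (hK : 0 ≤ K)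
    (h : ∀ x ∈ S, ∀ y ∈ S, dist (f x) (f y) ≤ K * dist x y) :
    Measure.hausdorffMeasure 1 (f '' S) ≤ ENNReal.ofReal K * Measure.hausdorffMeasure 1 S := by
  have hL : LipschitzOnWith K.toNNReal f S :=
    LipschitzOnWith.of_dist_le_mul fun x hx y hy => by
      rw [Real.coe_toNNReal _ hK]; exact h x hx y hy
  simpa [ENNReal.ofReal] using hL.hausdorffMeasure_image_le zero_le_one

lemma le_hausdorffMeasure_image_of_le_dist {X Y : Type*} [MetricSpace X] [Nonempty X]
    [MeasurableSpace X] [BorelSpace X] [MetricSpace Y] [MeasurableSpace Y] [BorelSpace Y]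
    {f : X → Y} {S : Set X} {K : ℝ} (hK : 0 < K)
    (h : ∀ x ∈ S, ∀ y ∈ S, K * dist x y ≤ dist (f x) (f y)) :
    ENNReal.ofReal K * Measure.hausdorffMeasure 1 S ≤ Measure.hausdorffMeasure 1 (f '' S) := by
  have hinj : Set.InjOn f S := fun x hx y hy hxy => by
    have h1 := h x hx y hy
    rw [hxy, dist_self] at h1
    exact dist_le_zero.1 (nonpos_of_mul_nonpos_right h1 hK)
  have hg := hinj.leftInvOn_invFunOn
  have h1 : Measure.hausdorffMeasure 1 (Function.invFunOn f S '' (f '' S)) ≤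
      ENNReal.ofReal K⁻¹ * Measure.hausdorffMeasure 1 (f '' S) := by
    refine hausdorffMeasure_image_le_of_dist_le (inv_nonneg.2 hK.le) ?_
    rintro _ ⟨x, hx, rfl⟩ _ ⟨y, hy, rfl⟩
    rw [hg hx, hg hy, inv_mul_eq_div, le_div_iff₀ hK, mul_comm]
    exact h x hx y hy
  rw [hg.image_image] at h1
  calc _ ≤ ENNReal.ofReal K * (ENNReal.ofReal K⁻¹ * Measure.hausdorffMeasure 1 (f '' S)) := by
        gcongr
    _ = _ := by
      rw [← mul_assoc, ← ENNReal.ofReal_mul hK.le, mul_inv_cancel₀ hK.ne', ENNReal.ofReal_one,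
        one_mul]

/-- Small balls of radius `r` centred on the set carry one-dimensional Hausdorff measure
asymptotic to `2 * r`, uniformly in the centre. -/
def HasUniformUnitDensity (E : Set EucPlane) : Prop :=
  ∀ η : ℝ, 0 < η → η < 1 → ∃ r₀ > 0, ∀ r : ℝ, 0 < r → r ≤ r₀ → ∀ x ∈ E,
    ENNReal.ofReal ((1 - η) / (1 + η) * (2 * r)) ≤
        Measure.hausdorffMeasure 1 (closedBall x r ∩ E) ∧
      Measure.hausdorffMeasure 1 (closedBall x r ∩ E) ≤
        ENNReal.ofReal ((1 + η) / (1 - η) * (2 * r))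

lemma two_mul_abs_le_dist_ellipsePt {A B : ℝ} (hB : 0 < B) (hAB : B ≤ A) {t s : ℝ}
    (h : |t - s| ≤ Real.pi) :
    2 * B / Real.pi * |t - s| ≤ dist (ellipsePt A B t) (ellipsePt A B s) := by
  have hpi := Real.pi_pos
  refine abs_le_of_sq_le_sq' ?_ dist_nonneg |>.2
  rw [dist_sq_ellipsePt]
  have h1 : 2 / Real.pi * |(t - s) / 2| ≤ |Real.sin ((t - s) / 2)| :=
    Real.mul_abs_le_abs_sin (by rw [abs_div, abs_of_pos (two_pos : (0 : ℝ) < 2)]; linarith)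
  have h2 : (2 / Real.pi * |(t - s) / 2|) ^ 2 ≤ Real.sin ((t - s) / 2) ^ 2 := by
    rw [← sq_abs (Real.sin _)]; gcongr
  have h3 := sq_le_ellipseSpeedSq hB hAB ((t + s) / 2)
  calc _ = 4 * (2 / Real.pi * |(t - s) / 2|) ^ 2 * B ^ 2 := by
        rw [abs_div, abs_of_pos (two_pos : (0 : ℝ) < 2)]; ring
    _ ≤ _ := by gcongr

lemma hasUniformUnitDensity_ellipseSet {A B : ℝ} (hB : 0 < B) (hAB : B ≤ A) :
    HasUniformUnitDensity (ellipseSet A B) := by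
  intro η h0 h1
  obtain ⟨δ, hδ, hloc⟩ := exists_local_bilipschitz hB hAB h0 h1
  have hpi := Real.pi_pos
  have h1η : 0 < 1 - η := by linarith
  have h1η' : 0 < 1 + η := by linarith
  refine ⟨min (B * δ * (1 - η)) (2 * B / Real.pi * δ), by positivity, ?_⟩
  rintro r hr hrr _ ⟨t₀, rfl⟩
  change _ ≤ Measure.hausdorffMeasure 1 (closedBall (ellipsePt A B t₀) r ∩ _) ∧
    Measure.hausdorffMeasure 1 (closedBall (ellipsePt A B t₀) r ∩ _) ≤ _
  set v := Real.sqrt (ellipseSpeedSq A B t₀) with hv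
  have hBv : B ≤ v := Real.le_sqrt_of_sq_le (sq_le_ellipseSpeedSq hB hAB t₀)
  have hv0 : 0 < v := hB.trans_le hBv
  have hr1 : r ≤ B * δ * (1 - η) := hrr.trans (min_le_left _ _)
  have hr2 : r ≤ 2 * B / Real.pi * δ := hrr.trans (min_le_right _ _)
  have hρ : r / ((1 - η) * v) ≤ δ := by
    rw [div_le_iff₀ (by positivity)]
    calc r ≤ B * δ * (1 - η) := hr1
      _ ≤ v * δ * (1 - η) := by gcongr
      _ = _ := by ring
  have hρ' : r / ((1 + η) * v) ≤ δ := by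
    refine le_trans ?_ hρ
    gcongr
    linarith
  constructor
  · have hsub : ellipsePt A B '' closedBall t₀ (r / ((1 + η) * v)) ⊆
        closedBall (ellipsePt A B t₀) r ∩ ellipseSet A B := by
      rintro _ ⟨t, ht, rfl⟩
      refine ⟨?_, ellipsePt_mem A B t⟩
      rw [mem_closedBall, Real.dist_eq] at ht
      rw [mem_closedBall]
      refine (hloc t₀ t t₀ (ht.trans hρ') (by simpa using hδ.le)).2.trans ?_
      rw [le_div_iff₀ (by positivity)] at ht
      rw [mul_comm]
      exact ht
    refine le_trans ?_ (measure_mono hsub)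
    refine le_trans ?_ (le_hausdorffMeasure_image_of_le_dist (K := (1 - η) * v) (by positivity) ?_)
    · rw [hausdorffMeasure_real, Real.volume_closedBall, ← ENNReal.ofReal_mul (by positivity)]
      apply ENNReal.ofReal_le_ofReal
      apply le_of_eq
      field_simp
    · intro t ht s hs
      rw [mem_closedBall, Real.dist_eq] at ht hs
      rw [Real.dist_eq]
      exact (hloc t₀ t s (ht.trans hρ') (hs.trans hρ')).1
  · have hsub : closedBall (ellipsePt A B t₀) r ∩ ellipseSet A B ⊆
        ellipsePt A B '' closedBall t₀ (r / ((1 - η) * v)) := by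
      rintro x ⟨hx, hxE⟩
      obtain ⟨t, ht, rfl⟩ := exists_near_eq_ellipsePt A B t₀ hxE
      refine ⟨t, ?_, rfl⟩
      rw [mem_closedBall] at hx
      have h2 : |t - t₀| ≤ δ := by
        have := (two_mul_abs_le_dist_ellipsePt hB hAB ht).trans (hx.trans hr2)
        exact le_of_mul_le_mul_left this (by positivity)
      have h3 := (hloc t₀ t t₀ h2 (by simpa using hδ.le)).1.trans hx
      rw [mem_closedBall, Real.dist_eq, le_div_iff₀ (by positivity), mul_comm]
      exact h3
    refine (measure_mono hsub).trans ?_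
    refine (hausdorffMeasure_image_le_of_dist_le (K := (1 + η) * v) (by positivity) ?_).trans ?_
    · intro t ht s hs
      rw [mem_closedBall, Real.dist_eq] at ht hs
      rw [Real.dist_eq]
      exact (hloc t₀ t s (ht.trans hρ) (hs.trans hρ)).2
    · rw [hausdorffMeasure_real, Real.volume_closedBall, ← ENNReal.ofReal_mul (by positivity)]
      apply ENNReal.ofReal_le_ofReal
      apply le_of_eq
      field_simp

lemma HasUniformUnitDensity.hausdorffMeasure_ne_top {E : Set EucPlane}
    (h : HasUniformUnitDensity E) (hE : IsCompact E) :
    (Measure.hausdorffMeasure 1 : Measure EucPlane) E ≠ ∞ := by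
  obtain ⟨r₀, hr₀, h⟩ := h (1 / 2) (by norm_num) (by norm_num)
  have := hE.measure_lt_top_of_nhdsWithin
    (μ := (Measure.hausdorffMeasure 1 : Measure EucPlane)) fun x hx =>
      ⟨closedBall x r₀ ∩ E, Filter.inter_mem (mem_nhdsWithin_of_mem_nhds
        (closedBall_mem_nhds x hr₀)) self_mem_nhdsWithin,
        (h r₀ hr₀ le_rfl x hx).2.trans_lt ENNReal.ofReal_lt_top⟩
  exact this.ne

lemma HasUniformUnitDensity.hausdorffMeasure_closedBall_inter_pos {E : Set EucPlane}
    (h : HasUniformUnitDensity E) {x : EucPlane} (hx : x ∈ E) {r : ℝ} (hr : 0 < r) :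
    0 < (Measure.hausdorffMeasure 1 : Measure EucPlane) (closedBall x r ∩ E) := by
  obtain ⟨r₀, hr₀, h⟩ := h (1 / 2) (by norm_num) (by norm_num)
  have h1 := (h (min r r₀) (by positivity) (min_le_right _ _) x hx).1
  refine lt_of_lt_of_le ?_ (h1.trans (measure_mono
    (Set.inter_subset_inter_left E (closedBall_subset_closedBall (min_le_left _ _)))))
  have : 0 < min r r₀ := by positivity
  rw [ENNReal.ofReal_pos]
  positivity

lemma HasUniformUnitDensity.hausdorffMeasure_ne_zero {E : Set EucPlane}
    (h : HasUniformUnitDensity E) (hE : E.Nonempty) :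
    (Measure.hausdorffMeasure 1 : Measure EucPlane) E ≠ 0 := by
  obtain ⟨x, hx⟩ := hE
  exact ((h.hausdorffMeasure_closedBall_inter_pos hx one_pos).trans_le
    (measure_mono Set.inter_subset_right)).ne'

lemma isProbabilityMeasure_curveMeasure {E : Set EucPlane}
    (h0 : (Measure.hausdorffMeasure 1 : Measure EucPlane) E ≠ 0)
    (h1 : (Measure.hausdorffMeasure 1 : Measure EucPlane) E ≠ ∞) :
    IsProbabilityMeasure (curveMeasure E) := by
  refine ⟨?_⟩
  rw [curveMeasure, Measure.smul_apply, Measure.restrict_apply_univ, smul_eq_mul,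
    ENNReal.inv_mul_cancel h0 h1]

lemma curveMeasure_apply {E : Set EucPlane} (hE : MeasurableSet E) (S : Set EucPlane) :
    curveMeasure E S = (Measure.hausdorffMeasure 1 E)⁻¹ * Measure.hausdorffMeasure 1 (S ∩ E) := by
  rw [curveMeasure, Measure.smul_apply, Measure.restrict_apply' hE, smul_eq_mul]

lemma ae_mem_curveMeasure {E : Set EucPlane} (hE : MeasurableSet E) :
    ∀ᵐ x ∂curveMeasure E, x ∈ E := by
  rw [ae_iff, curveMeasure_apply hE]
  have : {a | a ∉ E} ∩ E = ∅ := Set.compl_inter_self E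
  simp [this]

lemma curveGlobalDistrib_eq_lintegral {E : Set EucPlane} [IsProbabilityMeasure (curveMeasure E)]
    (r : ℝ) :
    curveGlobalDistrib E r = ∫⁻ x, curveMeasure E (closedBall x r) ∂curveMeasure E := by
  rw [curveGlobalDistrib, Measure.prod_apply
    (isClosed_le continuous_dist continuous_const).measurableSet]
  congr! with x
  ext y
  simp [dist_comm]

lemma HasUniformUnitDensity.curveGlobalDistrib_bounds {E : Set EucPlane}
    (h : HasUniformUnitDensity E) (hE : IsCompact E) (hne : E.Nonempty) {η : ℝ} (h0 : 0 < η)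
    (h1 : η < 1) :
    ∃ r₀ > 0, ∀ r : ℝ, 0 < r → r ≤ r₀ →
      (Measure.hausdorffMeasure 1 E)⁻¹ * ENNReal.ofReal ((1 - η) / (1 + η) * (2 * r)) ≤
          curveGlobalDistrib E r ∧
        curveGlobalDistrib E r ≤
          (Measure.hausdorffMeasure 1 E)⁻¹ * ENNReal.ofReal ((1 + η) / (1 - η) * (2 * r)) := by
  have hP := isProbabilityMeasure_curveMeasure (h.hausdorffMeasure_ne_zero hne)
    (h.hausdorffMeasure_ne_top hE)
  obtain ⟨r₀, hr₀, hb⟩ := h η h0 h1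
  refine ⟨r₀, hr₀, fun r hr hrr => ?_⟩
  rw [curveGlobalDistrib_eq_lintegral]
  have hae := ae_mem_curveMeasure hE.measurableSet
  constructor
  · calc _ = ∫⁻ _, (Measure.hausdorffMeasure 1 E)⁻¹ *
          ENNReal.ofReal ((1 - η) / (1 + η) * (2 * r)) ∂curveMeasure E := by simp
      _ ≤ _ := by
        refine lintegral_mono_ae (hae.mono fun x hx => ?_)
        rw [curveMeasure_apply hE.measurableSet]
        gcongr
        exact (hb r hr hrr x hx).1
  · calc
      _ ≤ ∫⁻ _, (Measure.hausdorffMeasure 1 E)⁻¹ *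
          ENNReal.ofReal ((1 + η) / (1 - η) * (2 * r)) ∂curveMeasure E := by
        refine lintegral_mono_ae (hae.mono fun x hx => ?_)
        rw [curveMeasure_apply hE.measurableSet]
        gcongr
        exact (hb r hr hrr x hx).2
      _ = _ := by simp

lemma HasUniformUnitDensity.hausdorffMeasure_le_of_curveGlobalDistrib_eq {E F : Set EucPlane}
    (hE : HasUniformUnitDensity E) (hEc : IsCompact E) (hEn : E.Nonempty)
    (hF : HasUniformUnitDensity F) (hFc : IsCompact F) (hFn : F.Nonempty)
    (hH : ∀ r : ℝ, 0 ≤ r → curveGlobalDistrib E r = curveGlobalDistrib F r) :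
    (Measure.hausdorffMeasure 1 : Measure EucPlane) F ≤ Measure.hausdorffMeasure 1 E := by
  have hE0 := hE.hausdorffMeasure_ne_zero hEn
  have hET := hE.hausdorffMeasure_ne_top hEc
  have hF0 := hF.hausdorffMeasure_ne_zero hFn
  have hFT := hF.hausdorffMeasure_ne_top hFc
  set a := (Measure.hausdorffMeasure 1 : Measure EucPlane) E
  set b := (Measure.hausdorffMeasure 1 : Measure EucPlane) F
  have key : ∀ η : ℝ, 0 < η → η < 1 →
      b.toReal * (1 - η) ^ 2 ≤ a.toReal * (1 + η) ^ 2 := by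
    intro η h0 h1
    obtain ⟨r₁, hr₁, hb₁⟩ := hE.curveGlobalDistrib_bounds hEc hEn h0 h1
    obtain ⟨r₂, hr₂, hb₂⟩ := hF.curveGlobalDistrib_bounds hFc hFn h0 h1
    have hr : 0 < min r₁ r₂ := lt_min hr₁ hr₂
    have hle := (hb₁ _ hr (min_le_left _ _)).1.trans
      ((hH _ hr.le).trans_le (hb₂ _ hr (min_le_right _ _)).2)
    have h1η : 0 < 1 - η := by linarith
    have h1η' : 0 < 1 + η := by linarith
    have hle' := ENNReal.toReal_mono
      (ENNReal.mul_ne_top (ENNReal.inv_ne_top.2 hF0) ENNReal.ofReal_ne_top) hle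
    rw [ENNReal.toReal_mul, ENNReal.toReal_mul, ENNReal.toReal_ofReal (by positivity),
      ENNReal.toReal_ofReal (by positivity), ENNReal.toReal_inv, ENNReal.toReal_inv] at hle'
    have ha := ENNReal.toReal_pos hE0 hET
    have hb := ENNReal.toReal_pos hF0 hFT
    change a.toReal⁻¹ * _ ≤ b.toReal⁻¹ * _ at hle'
    rw [inv_mul_eq_div, inv_mul_eq_div, div_le_div_iff₀ ha hb, mul_right_comm,
      mul_right_comm _ _ a.toReal, mul_le_mul_iff_left₀ (by positivity), div_mul_eq_mul_div,
      div_mul_eq_mul_div, div_le_div_iff₀ h1η' h1η] at hle'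
    linarith
  rw [← ENNReal.toReal_le_toReal hFT hET]
  have hc1 : Filter.Tendsto (fun η : ℝ => b.toReal * (1 - η) ^ 2) (nhdsWithin 0 (Set.Ioi 0))
      (nhds (b.toReal * (1 - 0) ^ 2)) :=
    (Continuous.tendsto (by fun_prop) 0).mono_left nhdsWithin_le_nhds
  have hc2 : Filter.Tendsto (fun η : ℝ => a.toReal * (1 + η) ^ 2) (nhdsWithin 0 (Set.Ioi 0))
      (nhds (a.toReal * (1 + 0) ^ 2)) :=
    (Continuous.tendsto (by fun_prop) 0).mono_left nhdsWithin_le_nhds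
  have := le_of_tendsto_of_tendsto hc1 hc2 (by
    filter_upwards [Ioo_mem_nhdsGT (zero_lt_one' ℝ)] with η hη using key η hη.1 hη.2)
  simpa using this

lemma ellipseSet_nonempty (A B : ℝ) : (ellipseSet A B).Nonempty := ⟨_, ellipsePt_mem A B 0⟩

lemma isProbabilityMeasure_curveMeasure_ellipseSet {A B : ℝ} (hB : 0 < B) (hAB : B ≤ A) :
    IsProbabilityMeasure (curveMeasure (ellipseSet A B)) :=
  have h := hasUniformUnitDensity_ellipseSet hB hAB
  isProbabilityMeasure_curveMeasure (h.hausdorffMeasure_ne_zero (ellipseSet_nonempty A B))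
    (h.hausdorffMeasure_ne_top (isCompact_ellipseSet A B))

lemma curveGlobalDistrib_ellipseSet_eq_one {A B : ℝ} (hB : 0 < B) (hAB : B ≤ A) :
    curveGlobalDistrib (ellipseSet A B) (2 * A) = 1 := by
  have hA : 0 < A := hB.trans_le hAB
  have hP := isProbabilityMeasure_curveMeasure_ellipseSet hB hAB
  have hae := ae_mem_curveMeasure (isCompact_ellipseSet A B).measurableSet
  rw [curveGlobalDistrib_eq_lintegral]
  have : ∀ᵐ x ∂curveMeasure (ellipseSet A B),
      curveMeasure (ellipseSet A B) (closedBall x (2 * A)) = 1 := by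
    filter_upwards [hae] with x hx
    rw [← mem_ae_iff_prob_eq_one isClosed_closedBall.measurableSet]
    filter_upwards [hae] with y hy
    obtain ⟨t, rfl⟩ := hx
    obtain ⟨s, rfl⟩ := hy
    change dist (ellipsePt A B s) (ellipsePt A B t) ≤ 2 * A
    refine abs_le_of_sq_le_sq' ?_ (by positivity) |>.2
    rw [dist_sq_ellipsePt]
    have h1 := Real.sin_sq_le_one ((s - t) / 2)
    have h2 := ellipseSpeedSq_le_sq hB hAB ((s + t) / 2)
    have h3 := (sq_nonneg B).trans (sq_le_ellipseSpeedSq hB hAB ((s + t) / 2))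
    calc _ ≤ 4 * 1 * A ^ 2 := by gcongr
      _ = _ := by ring
  rw [lintegral_congr_ae this]
  simp

lemma two_mul_le_of_curveGlobalDistrib_eq_one {A B r : ℝ} (hB : 0 < B) (hAB : B ≤ A)
    (h : curveGlobalDistrib (ellipseSet A B) r = 1) : 2 * A ≤ r := by
  by_contra! hr
  have hA : 0 < A := hB.trans_le hAB
  have hP := isProbabilityMeasure_curveMeasure_ellipseSet hB hAB
  have hE := (isCompact_ellipseSet A B).measurableSet
  have hD := hasUniformUnitDensity_ellipseSet hB hAB
  rw [curveGlobalDistrib, ← prob_compl_eq_zero_iff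
    (isClosed_le continuous_dist continuous_const).measurableSet] at h
  set ρ := (2 * A - r) / 3 with hρ
  have hρ0 : 0 < ρ := by rw [hρ]; linarith
  set p := ellipsePt A B 0
  set q := ellipsePt A B Real.pi
  have hpq : dist p q = 2 * A := by
    rw [← sq_eq_sq₀ dist_nonneg (by positivity), dist_sq_eq]
    simp [p, q]
    ring
  have hpos : ∀ t, curveMeasure (ellipseSet A B) (closedBall (ellipsePt A B t) ρ) ≠ 0 := by
    intro t
    rw [curveMeasure_apply hE]
    exact mul_ne_zero
      (ENNReal.inv_ne_zero.2 (hD.hausdorffMeasure_ne_top (isCompact_ellipseSet A B)))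
      (hD.hausdorffMeasure_closedBall_inter_pos (ellipsePt_mem A B t) hρ0).ne'
  have hsub : closedBall p ρ ×ˢ closedBall q ρ ⊆
      {z : EucPlane × EucPlane | dist z.1 z.2 ≤ r}ᶜ := by
    rintro ⟨x, y⟩ ⟨hx, hy⟩
    simp only [mem_closedBall] at hx hy
    simp only [Set.mem_compl_iff, Set.mem_ofPred_eq, not_le]
    have := dist_triangle4 p x y q
    rw [dist_comm p x] at this
    linarith
  have h0 := measure_mono_null hsub h
  rw [Measure.prod_prod, mul_eq_zero] at h0
  exact h0.elim (hpos _) (hpos _)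

/-- Scaling of the plane in the second coordinate. -/
noncomputable def scaleSnd (k : ℝ) (x : EucPlane) : EucPlane :=
  (EuclideanSpace.equiv (Fin 2) ℝ).symm ![x 0, k * x 1]

@[simp] lemma scaleSnd_zero (k : ℝ) (x : EucPlane) : scaleSnd k x 0 = x 0 := by
  simp [scaleSnd]

@[simp] lemma scaleSnd_one (k : ℝ) (x : EucPlane) : scaleSnd k x 1 = k * x 1 := by
  simp [scaleSnd]

lemma scaleSnd_image_ellipseSet (A B k : ℝ) :
    scaleSnd k '' ellipseSet A B = ellipseSet A (k * B) := by
  have h : ∀ t, scaleSnd k (ellipsePt A B t) = ellipsePt A (k * B) t := by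
    intro t
    ext i
    fin_cases i <;> simp [mul_assoc]
  ext x
  constructor
  · rintro ⟨_, ⟨t, rfl⟩, rfl⟩
    exact ⟨t, h t⟩
  · rintro ⟨t, rfl⟩
    exact ⟨_, ⟨t, rfl⟩, h t⟩

lemma dist_scaleSnd_le {k : ℝ} (hk : 0 ≤ k) (hk1 : k ≤ 1) (x y : EucPlane) :
    dist (scaleSnd k x) (scaleSnd k y) ≤ dist x y := by
  refine abs_le_of_sq_le_sq' ?_ dist_nonneg |>.2
  rw [dist_sq_eq, dist_sq_eq, scaleSnd_zero, scaleSnd_zero, scaleSnd_one, scaleSnd_one, ← mul_sub,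
    mul_pow]
  have : k ^ 2 ≤ 1 := by nlinarith
  nlinarith [mul_le_mul_of_nonneg_right this (sq_nonneg (x 1 - y 1))]

lemma exists_dist_scaleSnd_le {A B k : ℝ} (hA : 0 < A) (hB : 0 < B) (hk : 0 ≤ k) (hk1 : k < 1) :
    ∃ c : ℝ, 0 ≤ c ∧ c < 1 ∧ ∀ x ∈ ellipseSet A B, ∀ y ∈ ellipseSet A B,
      A / 2 ≤ x 0 → A / 2 ≤ y 0 → dist (scaleSnd k x) (scaleSnd k y) ≤ c * dist x y := by
  have hk2 : k ^ 2 < 1 := by nlinarith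
  refine ⟨Real.sqrt ((4 * A ^ 2 + k ^ 2 * B ^ 2) / (4 * A ^ 2 + B ^ 2)),
    Real.sqrt_nonneg _, ?_, ?_⟩
  · rw [Real.sqrt_lt' one_pos, div_lt_iff₀ (by positivity)]
    have : k ^ 2 * B ^ 2 < 1 * B ^ 2 := by gcongr
    linarith
  · rintro _ ⟨t, rfl⟩ _ ⟨s, rfl⟩ hx hy
    change A / 2 ≤ ellipsePt A B t 0 at hx
    change A / 2 ≤ ellipsePt A B s 0 at hy
    change dist (scaleSnd k (ellipsePt A B t)) (scaleSnd k (ellipsePt A B s)) ≤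
      _ * dist (ellipsePt A B t) (ellipsePt A B s)
    refine abs_le_of_sq_le_sq' ?_ (by positivity) |>.2
    rw [mul_pow, Real.sq_sqrt (by positivity), dist_sq_eq, dist_sq_eq, scaleSnd_zero,
      scaleSnd_zero, scaleSnd_one, scaleSnd_one]
    simp only [ellipsePt_zero, ellipsePt_one] at hx hy ⊢
    have ht := Real.sin_sq_add_cos_sq t
    have hs := Real.sin_sq_add_cos_sq s
    have hct : 1 / 2 ≤ Real.cos t := by
      refine le_of_mul_le_mul_left ?_ hA
      linarith
    have hcs : 1 / 2 ≤ Real.cos s := by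
      refine le_of_mul_le_mul_left ?_ hA
      linarith
    have key : (Real.cos t - Real.cos s) ^ 2 ≤ 4 * (Real.sin t - Real.sin s) ^ 2 := by
      have e : (Real.cos t - Real.cos s) * (Real.cos t + Real.cos s) =
          -((Real.sin t - Real.sin s) * (Real.sin t + Real.sin s)) := by
        linear_combination ht - hs
      have h1 : (1 : ℝ) ≤ (Real.cos t + Real.cos s) ^ 2 := by nlinarith
      have h2 : (Real.sin t + Real.sin s) ^ 2 ≤ 4 := by
        nlinarith [sq_nonneg (Real.sin t - Real.sin s), sq_nonneg (Real.cos t),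
          sq_nonneg (Real.cos s)]
      calc _ ≤ (Real.cos t - Real.cos s) ^ 2 * (Real.cos t + Real.cos s) ^ 2 :=
            le_mul_of_one_le_right (sq_nonneg _) h1
        _ = (Real.sin t - Real.sin s) ^ 2 * (Real.sin t + Real.sin s) ^ 2 := by
            rw [← mul_pow, e, neg_sq, mul_pow]
        _ ≤ (Real.sin t - Real.sin s) ^ 2 * 4 := by gcongr
        _ = _ := mul_comm _ _
    rw [div_mul_eq_mul_div, le_div_iff₀ (by positivity)]
    have key2 := mul_le_mul_of_nonneg_left key
      (by have : 0 ≤ 1 - k ^ 2 := by linarith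
          positivity : 0 ≤ (1 - k ^ 2) * A ^ 2 * B ^ 2)
    linarith

lemma hausdorffMeasure_ellipseSet_lt {A B B' : ℝ} (hB : 0 < B) (hBB' : B < B') (hAB : B' ≤ A) :
    (Measure.hausdorffMeasure 1 : Measure EucPlane) (ellipseSet A B) <
      Measure.hausdorffMeasure 1 (ellipseSet A B') := by
  have hB' : 0 < B' := hB.trans hBB'
  have hA : 0 < A := hB'.trans_le hAB
  have hk : 0 ≤ B / B' := by positivity
  have hk1 : B / B' < 1 := (div_lt_one hB').2 hBB'
  obtain ⟨c, hc0, hc1, hc⟩ := exists_dist_scaleSnd_le hA hB' hk hk1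
  have hD := hasUniformUnitDensity_ellipseSet hB' hAB
  have hfin := hD.hausdorffMeasure_ne_top (isCompact_ellipseSet A B')
  set μ : Measure EucPlane := Measure.hausdorffMeasure 1 with hμ
  set E := ellipseSet A B' with hE
  set S : Set EucPlane := {x | A / 2 ≤ x 0} with hS
  have hSm : MeasurableSet S :=
    (isClosed_le continuous_const (by fun_prop)).measurableSet
  have hpos : 0 < μ (E ∩ S) := by
    refine (hD.hausdorffMeasure_closedBall_inter_pos (ellipsePt_mem A B' 0)
      (half_pos hA)).trans_le (measure_mono ?_)
    rintro x ⟨hx, hxE⟩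
    refine ⟨hxE, ?_⟩
    rw [mem_closedBall] at hx
    have h1 : dist x (ellipsePt A B' 0) ^ 2 ≤ (A / 2) ^ 2 := by gcongr
    rw [dist_sq_eq, ellipsePt_zero, Real.cos_zero, mul_one] at h1
    have h2 : (x 0 - A) ^ 2 ≤ (A / 2) ^ 2 := by
      linarith [sq_nonneg (x 1 - ellipsePt A B' 0 1)]
    have := (abs_le_of_sq_le_sq' h2 (by positivity)).1
    simp only [hS, Set.mem_ofPred_eq]
    linarith
  have hfin1 : μ (E ∩ S) ≠ ∞ := measure_ne_top_of_subset Set.inter_subset_left hfin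
  have hfin2 : μ (E \ S) ≠ ∞ := measure_ne_top_of_subset Set.sdiff_subset hfin
  have him : ellipseSet A B = scaleSnd (B / B') '' (E ∩ S) ∪ scaleSnd (B / B') '' (E \ S) := by
    rw [← Set.image_union, Set.inter_union_sdiff, hE, scaleSnd_image_ellipseSet,
      div_mul_cancel₀ _ hB'.ne']
  calc μ (ellipseSet A B)
    _ ≤ μ (scaleSnd (B / B') '' (E ∩ S)) + μ (scaleSnd (B / B') '' (E \ S)) := by
        rw [him]; exact measure_union_le _ _
    _ ≤ ENNReal.ofReal c * μ (E ∩ S) + ENNReal.ofReal 1 * μ (E \ S) := by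
        gcongr
        · exact hausdorffMeasure_image_le_of_dist_le hc0 fun x hx y hy =>
            hc x hx.1 y hy.1 hx.2 hy.2
        · exact hausdorffMeasure_image_le_of_dist_le zero_le_one fun x _ y _ => by
            rw [one_mul]; exact dist_scaleSnd_le hk hk1.le x y
    _ < μ (E ∩ S) + μ (E \ S) := by
        rw [ENNReal.ofReal_one, one_mul]
        refine ENNReal.add_lt_add_right hfin2 ?_
        calc _ < 1 * μ (E ∩ S) := by
              rw [ENNReal.mul_lt_mul_iff_left hpos.ne' hfin1]
              exact ENNReal.ofReal_lt_one.2 hc1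
          _ = _ := one_mul _
    _ = μ E := measure_inter_add_sdiff E hSm

/-- **Example (ellipses are determined by their distance distributions).**
If two ellipses `X_{A,B}` and `X_{A',B'}` (`A ≥ B > 0`, `A' ≥ B' > 0`), regarded as
mm-spaces with Euclidean distance and normalized arclength measure, have the same
global distance distribution, then `A = A'` and `B = B'`; hence the two ellipses are
related by a rigid motion of the plane. -/
theorem ellipse_determined_by_globalDistrib
    (A B A' B' : ℝ) (hB : 0 < B) (hAB : B ≤ A) (hB' : 0 < B') (hAB' : B' ≤ A')
    (hH : ∀ r : ℝ, 0 ≤ r →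
      curveGlobalDistrib (ellipseSet A B) r = curveGlobalDistrib (ellipseSet A' B') r) :
    A = A' ∧ B = B' ∧
    ∃ T : EucPlane ≃ᵢ EucPlane, T '' (ellipseSet A B) = ellipseSet A' B' := by
  have hDE := hasUniformUnitDensity_ellipseSet hB hAB
  have hDF := hasUniformUnitDensity_ellipseSet hB' hAB'
  have hA : A = A' := by
    have hA0 : 0 ≤ 2 * A := by linarith
    have hA0' : 0 ≤ 2 * A' := by linarith
    have h1 := two_mul_le_of_curveGlobalDistrib_eq_one hB' hAB'
      ((hH _ hA0).symm.trans (curveGlobalDistrib_ellipseSet_eq_one hB hAB))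
    have h2 := two_mul_le_of_curveGlobalDistrib_eq_one hB hAB
      ((hH _ hA0').trans (curveGlobalDistrib_ellipseSet_eq_one hB' hAB'))
    linarith
  subst hA
  have hcE := isCompact_ellipseSet A B
  have hcF := isCompact_ellipseSet A B'
  have hnE := ellipseSet_nonempty A B
  have hnF := ellipseSet_nonempty A B'
  have hBeq : B = B' := by
    rcases lt_trichotomy B B' with h | h | h
    · exact absurd (hDE.hausdorffMeasure_le_of_curveGlobalDistrib_eq hcE hnE hDF hcF hnF hH)
        (hausdorffMeasure_ellipseSet_lt hB h hAB').not_ge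
    · exact h
    · exact absurd (hDF.hausdorffMeasure_le_of_curveGlobalDistrib_eq hcF hnF hDE hcE hnE
        fun r hr => (hH r hr).symm) (hausdorffMeasure_ellipseSet_lt hB' h hAB).not_ge
  subst hBeq
  exact ⟨rfl, rfl, IsometryEquiv.refl _, Set.image_id _⟩
end
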